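/- Let h > h_star. Then for every κ > 0 there exist constants c_{h,κ} > 0 and K_{h,κ} > 0 such that for all n ≥ 1, P^{G_n}[ |C_max^{G_n,h}| ≥ K_{h,κ}·ln(N_n) ] ≤ c_{h,κ}·N_n^{−κ}, where C_max^{G_n,h} denotes a connected component of maximal cardinality of the level set {x ∈ G_n : Ψ_{G_n}(x) ≥ h}. In particular, there exists K_h > 0 with lim_{n→∞} P^{G_n}[ |C_max^{G_n,h}| ≤ K_h·ln(N_n) ] = 1. -/

import Mathlib

open MeasureTheory ProbabilityTheory Filter Set
open scoped ENNReal NNReal ENat Classical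

namespace GFF

variable {V : Type*} {T : Type*}

/-- Number of ordered adjacent pairs inside `U` (twice the number of edges of the induced
subgraph). -/
noncomputable def adjPairs (G : SimpleGraph V) (U : Set V) : ℕ :=
  Set.ncard {p : V × V | p.1 ∈ U ∧ p.2 ∈ U ∧ G.Adj p.1 p.2}

/-- `U` (assumed connected) induces a tree, i.e. has tree excess zero. -/
def TxZero (G : SimpleGraph V) (U : Set V) : Prop :=
  adjPairs G U = 2 * (Set.ncard U - 1)

/-- Closed ball of radius `R` for the graph distance. -/
def gball (G : SimpleGraph V) (x : V) (R : ℕ) : Set V := {y | G.dist x y ≤ R}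

/-- Set of vertices within distance `R` of the set `A`. -/
def sball (G : SimpleGraph V) (A : Set V) (R : ℕ) : Set V := {y | ∃ a ∈ A, G.dist a y ≤ R}

/-- Connected component containing `x` of the level set `{ω ≥ h}`. -/
def levelComp (G : SimpleGraph V) (h : ℝ) (ω : V → ℝ) (x : V) : Set V :=
  {y | ∃ p : G.Walk x y, ∀ v ∈ p.support, h ≤ ω v}

/-- `G` is `d`-regular. -/
def IsReg (G : SimpleGraph V) (d : ℕ) : Prop := ∀ v, Nat.card (G.neighborSet v) = d

/-- `G` is an infinite `d`-regular tree. -/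
def IsRegTree (G : SimpleGraph V) (d : ℕ) : Prop :=
  G.Connected ∧ G.IsAcyclic ∧ IsReg G d

/-- Transition matrix of SRW on a `d`-regular graph. -/
noncomputable def transP [Fintype V] (G : SimpleGraph V) (d : ℕ) : Matrix V V ℝ :=
  Matrix.of fun u v => if G.Adj u v then ((d : ℝ))⁻¹ else 0

/-- All non-zero eigenvalues of `I - P` are at least `β`. -/
def SpectralGapLB [Fintype V] (G : SimpleGraph V) (d : ℕ) (β : ℝ) : Prop :=
  ∀ (f : V → ℝ) (lam : ℝ),
    Matrix.mulVec ((1 : Matrix V V ℝ) - transP G d) f = lam • f → f ≠ 0 → lam = 0 ∨ β ≤ lam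

/-- `P_x[X̄_t = y]` for the continuous-time SRW with i.i.d. mean-one exponential holding
times (Poissonized jump chain). -/
noncomputable def heatK [Fintype V] (G : SimpleGraph V) (d : ℕ) (t : ℝ) (x y : V) : ℝ :=
  ∑' k : ℕ, Real.exp (-t) * t ^ k / (Nat.factorial k) * ((transP G d) ^ k) x y

/-- The zero-average Green function. -/
noncomputable def zGreen [Fintype V] (G : SimpleGraph V) (d Nn : ℕ) (x y : V) : ℝ :=
  ∫ t in Set.Ioi (0 : ℝ), (heatK G d t x y - 1 / (Nn : ℝ))

/-- Green function of SRW on the `d`-regular tree. -/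
noncomputable def treeGreen (G : SimpleGraph V) (d : ℕ) (x y : V) : ℝ :=
  (((d : ℝ) - 1) / ((d : ℝ) - 2)) * (((d : ℝ) - 1)⁻¹) ^ (G.dist x y)

/-- `μ` is the law of the centred Gaussian field with covariance `K`. -/
def IsGaussianField {I : Type*} (μ : Measure (I → ℝ)) (K : I → I → ℝ) : Prop :=
  IsProbabilityMeasure μ ∧
    ∀ c : I →₀ ℝ,
      μ.map (fun ω => ∑ i ∈ c.support, c i * ω i) =
        gaussianReal 0 (Real.toNNReal (∑ i ∈ c.support, ∑ j ∈ c.support, c i * c j * K i j))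

/-- One-step transition probability of SRW. -/
noncomputable def srwStep (G : SimpleGraph V) (d : ℕ) (u v : V) : ℝ≥0∞ :=
  if G.Adj u v then (d : ℝ≥0∞)⁻¹ else 0

/-- `W x` is the law of discrete-time SRW on `G` started at `x`. -/
def IsSRW [MeasurableSpace V] (G : SimpleGraph V) (d : ℕ) (W : V → Measure (ℕ → V)) : Prop :=
  (∀ x, IsProbabilityMeasure (W x)) ∧
    ∀ (x : V) (k : ℕ) (p : ℕ → V),
      W x {ω | ∀ i ≤ k, ω i = p i} =
        (if p 0 = x then 1 else 0) * ∏ i ∈ Finset.range k, srwStep G d (p i) (p (i + 1))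

/-- Entrance time of the set `A` (`⊤` if never entered). -/
noncomputable def hitTime (A : Set V) (ω : ℕ → V) : ℕ∞ :=
  sInf ((Nat.cast : ℕ → ℕ∞) '' {k | ω k ∈ A})

/-- Exit time of the set `U`. -/
noncomputable def exitTime (U : Set V) (ω : ℕ → V) : ℕ∞ := hitTime Uᶜ ω

/-- Position of the walk at the entrance time of `A`. -/
noncomputable def stopAt (A : Set V) (ω : ℕ → V) : V := ω (hitTime A ω).toNat

/-- `π` is a cover tree of `G` at `x`. -/
def IsCoverMap (Gt : SimpleGraph T) (G : SimpleGraph V) (o : T) (x : V) (π : T → V) : Prop :=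
  π o = x ∧ Function.Surjective π ∧ ∀ y : T, π '' (Gt.neighborSet y) = G.neighborSet (π y)

/-- `T_d^+`: the vertices of the tree whose geodesic to `o` avoids the fixed neighbour
`obar` of `o`. -/
def treePlus (Gt : SimpleGraph T) (o obar : T) : Set T :=
  {z | Gt.dist z obar = Gt.dist z o + 1}

/-- `S^+_{T_d}(o,R)`. -/
def spherePlus (Gt : SimpleGraph T) (o obar : T) (R : ℕ) : Set T :=
  {z | z ∈ treePlus Gt o obar ∧ Gt.dist o z = R}

/-- The critical value for level-set percolation on the tree (w.r.t. the law `μT`). -/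
noncomputable def hstar (Gt : SimpleGraph T) (o : T) (μT : Measure (T → ℝ)) : ℝ :=
  sInf {h : ℝ | μT {ω | (levelComp Gt h ω o).Infinite} = 0}

/-- The forward percolation probability `η⁺(h)`. -/
noncomputable def etaPlus (Gt : SimpleGraph T) (o obar : T) (μT : Measure (T → ℝ)) (h : ℝ) :
    ℝ :=
  (μT {ω | (levelComp Gt h ω o ∩ treePlus Gt o obar).Infinite}).toReal

/-- `s_n`. -/
noncomputable def sn (d Nn : ℕ) : ℕ :=
  max 1 ⌊(8 : ℝ) * Real.logb ((d : ℝ) - 1) (Real.logb ((d : ℝ) - 1) (Nn : ℝ))⌋₊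

/-- `c₀ = αβ/(d-1)`. -/
noncomputable def c0 (d : ℕ) (α β : ℝ) : ℝ := α * β / ((d : ℝ) - 1)

/-- `r_n`. -/
noncomputable def rn (d : ℕ) (α β : ℝ) (Nn : ℕ) : ℕ :=
  max 1 ⌊(c0 d α β / 18) * Real.logb ((d : ℝ) - 1) (Nn : ℝ)⌋₊

/-- `R_n`. -/
noncomputable def Rn (d : ℕ) (α β : ℝ) (Nn : ℕ) : ℕ :=
  max 1 ⌊(c0 d α β / 6) * Real.logb ((d : ℝ) - 1) (Nn : ℝ)⌋₊

/-- `F_A(x,s)`: the vertices of `B(A,s) ∖ A` connected to `x` within `B(A,s) ∖ A`. -/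
def Fset (G : SimpleGraph V) (A : Set V) (s : ℕ) (x : V) : Set V :=
  {z | ∃ p : G.Walk x z, ∀ v ∈ p.support, v ∈ sball G A s ∧ v ∉ A}

/-- Good vertex at the boundary of `A`. -/
def GoodVertex (G : SimpleGraph V) (A : Set V) (s : ℕ) (x : V) : Prop :=
  x ∉ A ∧ (∃! y, y ∈ A ∧ G.Adj x y) ∧
    TxZero G (Fset G A s x) ∧
    ∀ y : V, y ∉ A → (∃ a ∈ A, G.Adj y a) → y ≠ x →
      ∀ p : G.Walk y x, (∀ v ∈ p.support, v ∉ A) → ∃ v ∈ p.support, v ∉ sball G A s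

end GFF

namespace GFF

lemma pl_aux {A : Set ℝ} (hA : MeasurableSet A) (hne : A.Nonempty) (p q c : ℝ≥0∞)
    (H : ∀ K ⊆ A, IsCompact K → K.Nonempty → p * volume K + q ≤ c) : p * volume A + q ≤ c := by
  obtain ⟨x, hx⟩ := hne
  have h0 := H {x} (by simpa using hx) isCompact_singleton (by simp)
  simp at h0
  by_cases hq : q = ⊤
  · subst hq; rw [top_le_iff] at h0; simp [h0]
  have : p * volume A ≤ c - q := by
    rw [hA.measure_eq_iSup_isCompact]
    simp only [ENNReal.mul_iSup]
    refine iSup_le fun K => iSup_le fun hK => iSup_le fun hc => ?_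
    rcases K.eq_empty_or_nonempty with rfl | hn
    · simp
    · exact ENNReal.le_sub_of_add_le_right hq (H K hK hc hn)
  calc p * volume A + q ≤ (c - q) + q := by gcongr
    _ = c := tsub_add_cancel_of_le h0

lemma vol_bm {A B C : Set ℝ} (hA : MeasurableSet A) (hB : MeasurableSet B) (hAn : A.Nonempty)
    (hBn : B.Nonempty) {s t : ℝ} (hs : 0 < s) (ht : 0 < t)
    (h : ∀ x ∈ A, ∀ y ∈ B, s * x + t * y ∈ C) :
    ENNReal.ofReal s * volume A + ENNReal.ofReal t * volume B ≤ volume C := by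
  refine pl_aux hA hAn _ _ _ fun K hK hKc hKn => ?_
  rw [add_comm]
  refine pl_aux hB hBn _ _ _ fun L hL hLc hLn => ?_
  obtain ⟨x, hx, hxm⟩ := hKc.exists_isGreatest hKn
  obtain ⟨y, hy, hym⟩ := hLc.exists_isLeast hLn
  have e1 : volume ((fun z => s * x + t * z) '' L) = ENNReal.ofReal t * volume L := by
    have : (fun z => s * x + t * z) '' L = (fun w => s * x + w) '' ((t • · ) '' L) := by
      rw [image_image]; simp
    rw [this, image_add_left, measure_preimage_add, image_smul, Measure.addHaar_smul]
    simp [abs_of_pos ht]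
  have e2 : volume ((fun z => s * z + t * y) '' K) = ENNReal.ofReal s * volume K := by
    have : (fun z => s * z + t * y) '' K = (fun w => w + t * y) '' ((s • · ) '' K) := by
      rw [image_image]; simp
    rw [this, image_add_right, measure_preimage_add_right, image_smul, Measure.addHaar_smul]
    simp [abs_of_pos hs]
  rw [← e1, ← e2]
  have hd : AEDisjoint volume ((fun z => s * x + t * z) '' L) ((fun z => s * z + t * y) '' K) := by
    refine measure_mono_null (t := {s * x + t * y}) ?_ (by simp)
    rintro _ ⟨⟨z, hz, rfl⟩, ⟨w, hw, hwz⟩⟩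
    have h1 := hxm hw
    have h2 := hym hz
    have : s * w ≤ s * x := by gcongr
    have : t * y ≤ t * z := by gcongr
    simp only [mem_singleton_iff]
    simp only at hwz
    linarith
  rw [← measure_union₀' ((hLc.image (by fun_prop)).measurableSet.nullMeasurableSet) hd]
  refine measure_mono (union_subset ?_ ?_)
  · rintro _ ⟨z, hz, rfl⟩; exact h _ (hK hx) _ (hL hz)
  · rintro _ ⟨z, hz, rfl⟩; exact h _ (hK hz) _ (hL hy)

lemma pl_norm {F G H : ℝ → ℝ} (mF : Measurable F) (mG : Measurable G) (mH : Measurable H)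
    (F0 : ∀ x, 0 ≤ F x) (G0 : ∀ x, 0 ≤ G x) (F1 : ∀ x, F x ≤ 1) (G1 : ∀ x, G x ≤ 1)
    (Fs : ∀ r < 1, ∃ x, r < F x) (Gs : ∀ r < 1, ∃ x, r < G x) {s t : ℝ} (hs : 0 < s) (ht : 0 < t)
    (hst : s + t = 1) (H0 : ∀ x, 0 ≤ H x)
    (h : ∀ x y, F x ^ s * G y ^ t ≤ H (s * x + t * y)) :
    ENNReal.ofReal s * (∫⁻ x, ENNReal.ofReal (F x)) + ENNReal.ofReal t * ∫⁻ x, ENNReal.ofReal (G x)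
      ≤ ∫⁻ x, ENNReal.ofReal (H x) := by
  have key : ∀ {f : ℝ → ℝ}, Measurable f → (∀ x, 0 ≤ f x) →
      ∫⁻ x, ENNReal.ofReal (f x) = ∫⁻ r in Ioi 0, volume {x | r < f x} := fun hf h0 =>
    lintegral_eq_lintegral_meas_lt _ (Eventually.of_forall h0) hf.aemeasurable
  have mm : ∀ f : ℝ → ℝ, Measurable fun r : ℝ => volume {x | r < f x} := fun f =>
    Antitone.measurable fun r r' hr => measure_mono fun x (hx : r' < f x) => lt_of_le_of_lt hr hx
  rw [key mF F0, key mG G0, key mH H0, ← lintegral_const_mul _ (mm F), ← lintegral_const_mul _ (mm G),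
    ← lintegral_add_left ((mm F).const_mul _)]
  refine setLIntegral_mono (mm H) fun r hr => ?_
  simp only [mem_Ioi] at hr
  rcases lt_or_ge r 1 with h1 | h1
  · refine vol_bm (measurableSet_lt measurable_const mF) (measurableSet_lt measurable_const mG)
      (Fs r h1) (Gs r h1) hs ht fun x hx y hy => ?_
    refine lt_of_lt_of_le ?_ (h x y)
    simp only [mem_ofPred_eq] at hx hy
    calc r = r ^ s * r ^ t := by rw [← Real.rpow_add hr, hst, Real.rpow_one]
      _ < F x ^ s * G y ^ t := by
        apply mul_lt_mul'' <;> first | positivity | (apply Real.rpow_lt_rpow <;> linarith)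
  · have e : ∀ f : ℝ → ℝ, (∀ x, f x ≤ 1) → {x | r < f x} = ∅ := fun f hf => by
      ext x; simp; exact (hf x).trans h1
    rw [e F F1, e G G1]; simp

lemma prekopa {F G H : ℝ → ℝ} (mF : Measurable F) (mG : Measurable G) (mH : Measurable H)
    (F0 : ∀ x, 0 ≤ F x) (G0 : ∀ x, 0 ≤ G x) {c : ℝ} (F1 : ∀ x, F x ≤ c) (G1 : ∀ x, G x ≤ c)
    (iF : Integrable F) (iG : Integrable G) (iH : Integrable H)
    {s t : ℝ} (hs : 0 < s) (ht : 0 < t)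
    (hst : s + t = 1) (H0 : ∀ x, 0 ≤ H x)
    (h : ∀ x y, F x ^ s * G y ^ t ≤ H (s * x + t * y)) :
    (∫ x, F x) ^ s * (∫ x, G x) ^ t ≤ ∫ x, H x := by
  have bF : BddAbove (range F) := ⟨c, by rintro _ ⟨x, rfl⟩; exact F1 x⟩
  have bG : BddAbove (range G) := ⟨c, by rintro _ ⟨x, rfl⟩; exact G1 x⟩
  set f := ⨆ x, F x
  set g := ⨆ x, G x
  have hf : ∀ x, F x ≤ f := fun x => le_ciSup bF x
  have hg : ∀ x, G x ≤ g := fun x => le_ciSup bG x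
  rcases (F0 0).trans (hf 0) |>.eq_or_lt with hf0 | hf0
  · have : F = 0 := by ext x; exact le_antisymm ((hf x).trans hf0.ge) (F0 x)
    simp [this, Real.zero_rpow hs.ne']; exact integral_nonneg H0
  rcases (G0 0).trans (hg 0) |>.eq_or_lt with hg0 | hg0
  · have : G = 0 := by ext x; exact le_antisymm ((hg x).trans hg0.ge) (G0 x)
    simp [this, Real.zero_rpow ht.ne']; exact integral_nonneg H0
  set k := f ^ s * g ^ t
  have hk : 0 < k := by positivity
  have := pl_norm (F := fun x => F x / f) (G := fun x => G x / g) (H := fun x => H x / k)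
    (mF.div_const _) (mG.div_const _) (mH.div_const _) (fun x => div_nonneg (F0 x) hf0.le)
    (fun x => div_nonneg (G0 x) hg0.le) (fun x => (div_le_one hf0).2 (hf x))
    (fun x => (div_le_one hg0).2 (hg x))
    (fun r hr => by
      obtain ⟨x, hx⟩ := exists_lt_of_lt_ciSup (show r * f < ⨆ x, F x by change r * f < f; nlinarith)
      exact ⟨x, (lt_div_iff₀ hf0).2 hx⟩)
    (fun r hr => by
      obtain ⟨x, hx⟩ := exists_lt_of_lt_ciSup (show r * g < ⨆ x, G x by change r * g < g; nlinarith)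
      exact ⟨x, (lt_div_iff₀ hg0).2 hx⟩) hs ht hst (fun x => div_nonneg (H0 x) hk.le)
    (fun x y => by
      rw [Real.div_rpow (F0 x) hf0.le, Real.div_rpow (G0 y) hg0.le, div_mul_div_comm]
      exact div_le_div_of_nonneg_right (h x y) hk.le)
  have cv : ∀ {u : ℝ → ℝ} {k : ℝ}, Integrable u → (∀ x, 0 ≤ u x) → 0 < k →
      ∫⁻ x, ENNReal.ofReal (u x / k) = ENNReal.ofReal ((∫ x, u x) / k) := fun hu h0 hk => by
    rw [← ofReal_integral_eq_lintegral_ofReal (hu.div_const _)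
      (Eventually.of_forall fun x => div_nonneg (h0 x) hk.le), integral_div]
  have iF0 : 0 ≤ ∫ x, F x := integral_nonneg F0
  have iG0 : 0 ≤ ∫ x, G x := integral_nonneg G0
  have iH0 : 0 ≤ ∫ x, H x := integral_nonneg H0
  rw [cv iF F0 hf0, cv iG G0 hg0, cv iH H0 hk, ← ENNReal.ofReal_mul hs.le, ← ENNReal.ofReal_mul ht.le,
    ← ENNReal.ofReal_add (by positivity) (by positivity), ENNReal.ofReal_le_ofReal_iff (by positivity)] at this
  have am := Real.geom_mean_le_arith_mean2_weighted hs.le ht.le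
    (div_nonneg iF0 hf0.le) (div_nonneg iG0 hg0.le) hst
  have := am.trans this
  rw [Real.div_rpow iF0 hf0.le, Real.div_rpow iG0 hg0.le, div_mul_div_comm] at this
  exact (div_le_div_iff_of_pos_right hk).1 this
end GFF

namespace GFF

noncomputable def gv (b : ℕ) : ℝ≥0 := (b + 1) / b
noncomputable abbrev gam (b : ℕ) : Measure ℝ := gaussianReal 0 (gv b)
noncomputable def mm (b : ℕ) (h : ℝ) : ℕ → ℝ → ℝ
  | 0, a => if h ≤ a then 1 else 0
  | j + 1, a => if h ≤ a then b * ∫ y, mm b h j (a / b + y) ∂gam b else 0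

lemma gv_pos {b : ℕ} (hb : 2 ≤ b) : 0 < gv b := by
  unfold gv; have : 0 < b := by omega
  positivity

lemma integrable_bdd {Ω : Type*} [MeasurableSpace Ω] {μ : Measure Ω} [IsFiniteMeasure μ] {f : Ω → ℝ}
    (hf : Measurable f) {c : ℝ} (h0 : ∀ x, 0 ≤ f x) (hc : ∀ x, f x ≤ c) : Integrable f μ :=
  Integrable.of_bound hf.aestronglyMeasurable c (Eventually.of_forall fun x => by
    rw [Real.norm_of_nonneg (h0 x)]; exact hc x)

lemma mm_basic (b : ℕ) (h : ℝ) (j : ℕ) :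
    Monotone (mm b h j) ∧ (∀ a, 0 ≤ mm b h j a) ∧ ∀ a, mm b h j a ≤ (b : ℝ) ^ j := by
  induction j with
  | zero =>
    refine ⟨fun a a' haa => ?_, fun a => ?_, fun a => ?_⟩ <;> simp only [mm]
    · split_ifs <;> first | linarith | norm_num
    · split_ifs <;> norm_num
    · split_ifs <;> norm_num
  | succ j ih =>
    obtain ⟨i1, i2, i3⟩ := ih
    have hm := i1.measurable
    have hi : ∀ a : ℝ, Integrable (fun y => mm b h j (a / b + y)) (gam b) := fun a =>
      integrable_bdd (hm.comp (by fun_prop)) (fun y => i2 _) (fun y => i3 _)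
    refine ⟨fun a a' haa => ?_, fun a => ?_, fun a => ?_⟩ <;> simp only [mm]
    · split_ifs
      · refine mul_le_mul_of_nonneg_left (integral_mono (hi a) (hi a') fun y => i1 ?_) (by positivity)
        gcongr
      · linarith
      · exact mul_nonneg (by positivity) (integral_nonneg fun y => i2 _)
      · rfl
    · split_ifs
      · exact mul_nonneg (by positivity) (integral_nonneg fun y => i2 _)
      · rfl
    · split_ifs
      · rw [pow_succ, mul_comm]
        gcongr
        calc _ ≤ ∫ y, (b : ℝ) ^ j ∂gam b := integral_mono (hi a) (integrable_const _) fun y => i3 _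
          _ = _ := by simp
      · positivity

lemma mm_mono (b h j) : Monotone (mm b h j) := (mm_basic b h j).1
lemma mm_nonneg (b h j a) : 0 ≤ mm b h j a := (mm_basic b h j).2.1 a
lemma mm_le (b h j a) : mm b h j a ≤ (b : ℝ) ^ j := (mm_basic b h j).2.2 a
lemma mm_meas (b h j) : Measurable (mm b h j) := (mm_mono b h j).measurable
lemma mm_int (b : ℕ) (h j) (a : ℝ) : Integrable (fun y => mm b h j (a + y)) (gam b) :=
  integrable_bdd ((mm_meas b h j).comp (by fun_prop)) (fun y => mm_nonneg _ _ _ _) (fun y => mm_le _ _ _ _)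
lemma mm_zero (b h j) {a : ℝ} (ha : a < h) : mm b h j a = 0 := by
  cases j <;> simp [mm, not_le.2 ha]
lemma mm_succ (b : ℕ) (h j) {a : ℝ} (ha : h ≤ a) :
    mm b h (j + 1) a = b * ∫ y, mm b h j (a / b + y) ∂gam b := by simp [mm, ha]

lemma pdf_lc (v : ℝ≥0) {s t : ℝ} (hs : 0 < s) (ht : 0 < t) (hst : s + t = 1) (x y : ℝ) :
    gaussianPDFReal 0 v x ^ s * gaussianPDFReal 0 v y ^ t ≤ gaussianPDFReal 0 v (s * x + t * y) := by
  simp only [gaussianPDFReal]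
  have hc : 0 ≤ (√(2 * Real.pi * v))⁻¹ := by positivity
  rw [Real.mul_rpow hc (by positivity), Real.mul_rpow hc (by positivity), ← Real.exp_mul, ← Real.exp_mul]
  calc _ = ((√(2 * Real.pi * v))⁻¹ ^ s * (√(2 * Real.pi * v))⁻¹ ^ t) *
      Real.exp (-(x - 0) ^ 2 / (2 * v) * s + -(y - 0) ^ 2 / (2 * v) * t) := by rw [Real.exp_add]; ring
    _ ≤ _ := by
      rw [← Real.rpow_add_of_nonneg hc hs.le ht.le, hst, Real.rpow_one]
      gcongr
      rw [show -(x - 0) ^ 2 / (2 * v) * s + -(y - 0) ^ 2 / (2 * v) * t =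
        (-(s * x ^ 2 + t * y ^ 2)) / (2 * v) by ring]
      gcongr
      obtain rfl : t = 1 - s := by linarith
      nlinarith [mul_pos hs ht, mul_nonneg (mul_pos hs ht).le (sq_nonneg (x - y))]

lemma mm_lc {b : ℕ} (hb : 2 ≤ b) {s t : ℝ} (hs : 0 < s) (ht : 0 < t) (hst : s + t = 1) (h₁ h₂ : ℝ) (j : ℕ) :
    ∀ a₁ a₂ : ℝ, mm b h₁ j a₁ ^ s * mm b h₂ j a₂ ^ t ≤ mm b (s * h₁ + t * h₂) j (s * a₁ + t * a₂) := by
  induction j with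
  | zero =>
    intro a₁ a₂
    rcases lt_or_ge a₁ h₁ with h1 | h1
    · rw [mm_zero _ _ _ h1, Real.zero_rpow hs.ne', zero_mul]; exact mm_nonneg _ _ _ _
    rcases lt_or_ge a₂ h₂ with h2 | h2
    · rw [mm_zero _ _ _ h2, Real.zero_rpow ht.ne', mul_zero]; exact mm_nonneg _ _ _ _
    have : s * h₁ + t * h₂ ≤ s * a₁ + t * a₂ := by gcongr
    simp [mm, h1, h2, this]
  | succ j ih =>
    intro a₁ a₂
    rcases lt_or_ge a₁ h₁ with h1 | h1
    · rw [mm_zero _ _ _ h1, Real.zero_rpow hs.ne', zero_mul]; exact mm_nonneg _ _ _ _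
    rcases lt_or_ge a₂ h₂ with h2 | h2
    · rw [mm_zero _ _ _ h2, Real.zero_rpow ht.ne', mul_zero]; exact mm_nonneg _ _ _ _
    have h3 : s * h₁ + t * h₂ ≤ s * a₁ + t * a₂ := by gcongr
    rw [mm_succ _ _ _ h1, mm_succ _ _ _ h2, mm_succ _ _ _ h3]
    have hv := (gv_pos hb).ne'
    rw [Real.mul_rpow (by positivity) (integral_nonneg fun y => mm_nonneg _ _ _ _),
      Real.mul_rpow (by positivity) (integral_nonneg fun y => mm_nonneg _ _ _ _), mul_mul_mul_comm,
      ← Real.rpow_add_of_nonneg (by positivity) hs.le ht.le, hst, Real.rpow_one]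
    gcongr
    simp only [integral_gaussianReal_eq_integral_smul hv, smul_eq_mul]
    have me : ∀ (h a : ℝ), Measurable fun y => gaussianPDFReal 0 (gv b) y * mm b h j (a + y) :=
      fun h a => (measurable_gaussianPDFReal _ _).mul ((mm_meas b h j).comp (by fun_prop))
    have int : ∀ (h a : ℝ), Integrable fun y => gaussianPDFReal 0 (gv b) y * mm b h j (a + y) :=
      fun h a => (integrable_gaussianPDFReal _ _).mul_bdd (c := (b : ℝ) ^ j)
        ((mm_meas b h j).comp (by fun_prop)).aestronglyMeasurable (Eventually.of_forall fun y => by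
          rw [Real.norm_of_nonneg (mm_nonneg _ _ _ _)]; exact mm_le _ _ _ _)
    have nn : ∀ (h a y : ℝ), 0 ≤ gaussianPDFReal 0 (gv b) y * mm b h j (a + y) := fun h a y =>
      mul_nonneg (gaussianPDFReal_nonneg _ _ _) (mm_nonneg _ _ _ _)
    have bd : ∀ (h a y : ℝ), gaussianPDFReal 0 (gv b) y * mm b h j (a + y) ≤
        (√(2 * Real.pi * gv b))⁻¹ * (b : ℝ) ^ j := fun h a y => by
      refine mul_le_mul ?_ (mm_le _ _ _ _) (mm_nonneg _ _ _ _) (by positivity)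
      rw [gaussianPDFReal]
      refine mul_le_of_le_one_right (by positivity) (Real.exp_le_one_iff.2 ?_)
      rw [neg_div]; simp; positivity
    refine prekopa (me _ _) (me _ _) (me _ _) (nn _ _) (nn _ _) (bd _ _) (bd _ _) (int _ _)
      (int _ _) (int _ _) hs ht hst (nn _ _) fun x y => ?_
    rw [Real.mul_rpow (gaussianPDFReal_nonneg _ _ _) (mm_nonneg _ _ _ _),
      Real.mul_rpow (gaussianPDFReal_nonneg _ _ _) (mm_nonneg _ _ _ _), mul_mul_mul_comm]
    refine mul_le_mul (pdf_lc _ hs ht hst x y) ((ih _ _).trans_eq ?_)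
      (mul_nonneg (Real.rpow_nonneg (mm_nonneg _ _ _ _) _) (Real.rpow_nonneg (mm_nonneg _ _ _ _) _))
      (gaussianPDFReal_nonneg _ _ _)
    congr 1; ring
end GFF

namespace GFF

lemma gam_tail_pos {b : ℕ} (hb : 2 ≤ b) (x : ℝ) : 0 < (gam b).real (Ici x) := by
  rw [measureReal_def, ENNReal.toReal_pos_iff]
  refine ⟨pos_iff_ne_zero.2 fun h => ?_, measure_lt_top _ _⟩
  have := gaussianReal_absolutelyContinuous' 0 (gv_pos hb).ne' h
  simp at this

lemma gam_tail_big (b : ℕ) : ∃ x : ℝ, 3 / 4 ≤ (gam b).real (Ici x) := by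
  have h := tendsto_measure_Ici_atBot (gam b)
  rw [measure_univ] at h
  have h2 := (ENNReal.tendsto_toReal (by simp : (1 : ℝ≥0∞) ≠ ⊤)).comp h
  obtain ⟨x, hx⟩ := (h2.eventually (lt_mem_nhds (show (3 / 4 : ℝ) < (1 : ℝ≥0∞).toReal by norm_num))).exists
  exact ⟨x, hx.le⟩

lemma int_lower {b : ℕ} {f : ℝ → ℝ} (hi : Integrable f (gam b)) (h0 : ∀ y, 0 ≤ f y) {x c : ℝ}
    (hx : ∀ y, x ≤ y → c ≤ f y) : (gam b).real (Ici x) * c ≤ ∫ y, f y ∂gam b := by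
  calc _ = ∫ y in Ici x, c ∂gam b := by simp
    _ ≤ ∫ y in Ici x, f y ∂gam b := setIntegral_mono_on (by simp) hi.integrableOn measurableSet_Ici fun y hy => hx y hy
    _ ≤ _ := setIntegral_le_integral hi (Eventually.of_forall h0)

lemma mm_lower {b : ℕ} (hb : 2 ≤ b) : ∃ K₀ : ℝ, 0 ≤ K₀ ∧ ∀ K, K₀ ≤ K → ∀ (j : ℕ) (a : ℝ), -K ≤ a →
    (3 / 2 : ℝ) ^ j ≤ mm b (-K) j a := by
  obtain ⟨x, hx⟩ := gam_tail_big b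
  refine ⟨max 0 (-(2 * x)), le_max_left _ _, fun K hK j => ?_⟩
  have hK1 : 0 ≤ K := (le_max_left _ _).trans hK
  have hK2 : -(2 * x) ≤ K := (le_max_right _ _).trans hK
  have hb' : (2 : ℝ) ≤ b := by exact_mod_cast hb
  induction j with
  | zero => intro a ha; simp [mm, ha]
  | succ j ih =>
    intro a ha
    rw [mm_succ _ _ _ ha]
    have := int_lower (mm_int b (-K) j (a / b)) (fun y => mm_nonneg _ _ _ _) (x := x) (c := (3 / 2) ^ j)
      (fun y hy => ih _ (by
        have h1 : -K / 2 ≤ a / b := by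
          rw [div_le_div_iff₀ (by norm_num) (by linarith)]; nlinarith
        linarith))
    calc (3 / 2 : ℝ) ^ (j + 1) = 2 * (3 / 4 * (3 / 2) ^ j) := by ring
      _ ≤ b * ((gam b).real (Ici x) * (3 / 2) ^ j) := by gcongr
      _ ≤ _ := by gcongr

lemma mm_decay {b : ℕ} (hb : 2 ≤ b) {h' h'' : ℝ} (hlt : h' < h'') (np : ∀ R, mm b h' R h' ≤ 1) :
    ∃ l : ℝ, 0 < l ∧ l < 1 ∧ ∀ R, mm b h'' R h'' ≤ l ^ R := by
  obtain ⟨K₀, hK0, hK⟩ := mm_lower hb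
  set K := max K₀ (1 - h')
  have hK1 : K₀ ≤ K := le_max_left _ _
  have hK2 : 1 - h' ≤ K := le_max_right _ _
  set s := (h' + K) / (h'' + K)
  have hd : 0 < h'' + K := by linarith
  have hs : 0 < s := div_pos (by linarith) hd
  have hs1 : s < 1 := (div_lt_one hd).2 (by linarith)
  have hsd : s * (h'' + K) = h' + K := div_mul_cancel₀ _ hd.ne'
  have e : s * h'' + (1 - s) * (-K) = h' := by linarith
  refine ⟨(2 / 3) ^ ((1 - s) / s), by positivity, Real.rpow_lt_one (by norm_num) (by norm_num)
    (div_pos (by linarith) hs), fun R => ?_⟩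
  have h1 := mm_lc hb hs (by linarith : 0 < 1 - s) (by ring) h'' (-K) R h'' (-K)
  rw [e] at h1
  have h2 : mm b h'' R h'' ^ s * ((3 / 2 : ℝ) ^ R) ^ (1 - s) ≤ 1 := by
    refine le_trans ?_ (h1.trans (np R))
    refine mul_le_mul_of_nonneg_left ?_ (Real.rpow_nonneg (mm_nonneg _ _ _ _) _)
    exact Real.rpow_le_rpow (by positivity) (hK K hK1 R _ le_rfl) (by linarith)
  have h3 : mm b h'' R h'' ^ s ≤ ((2 / 3 : ℝ) ^ R) ^ (1 - s) := by
    rw [← le_div_iff₀ (by positivity)] at h2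
    refine h2.trans_eq ?_
    rw [show (2 / 3 : ℝ) = (3 / 2)⁻¹ by norm_num, inv_pow, Real.inv_rpow (by positivity), one_div]
  calc mm b h'' R h'' = (mm b h'' R h'' ^ s) ^ (1 / s) := by
        rw [← Real.rpow_mul (mm_nonneg _ _ _ _), mul_one_div_cancel hs.ne', Real.rpow_one]
    _ ≤ (((2 / 3 : ℝ) ^ R) ^ (1 - s)) ^ (1 / s) :=
        Real.rpow_le_rpow (Real.rpow_nonneg (mm_nonneg _ _ _ _) _) h3 (by positivity)
    _ = _ := by
        rw [← Real.rpow_natCast, ← Real.rpow_natCast, ← Real.rpow_mul (by norm_num),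
          ← Real.rpow_mul (by norm_num), ← Real.rpow_mul (by norm_num)]
        congr 1; ring

lemma gauss_sq (v : ℝ≥0) (c : ℝ) : Integrable (fun y => 1 + (c + y) ^ 2) (gaussianReal 0 v) ∧
    ∫ y, (1 + (c + y) ^ 2) ∂gaussianReal 0 v = 1 + c ^ 2 + v := by
  have h2 : MemLp id 2 (gaussianReal 0 v) := memLp_id_gaussianReal' 2 (by simp)
  have i2 : Integrable (fun y : ℝ => y ^ 2) (gaussianReal 0 v) := h2.integrable_sq
  have i1 : Integrable (fun y : ℝ => y) (gaussianReal 0 v) := h2.integrable (by norm_num)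
  have e2 : ∫ y, y ^ 2 ∂gaussianReal 0 v = v := by
    have := variance_of_integral_eq_zero (X := id) (μ := gaussianReal 0 v) aemeasurable_id (by simp)
    rw [variance_id_gaussianReal] at this
    simpa using this.symm
  have e : (fun y : ℝ => 1 + (c + y) ^ 2) = fun y => (1 + c ^ 2) + ((2 * c) * y + y ^ 2) := by ext; ring
  rw [e]
  have i3 : Integrable (fun y : ℝ => 2 * c * y + y ^ 2) (gaussianReal 0 v) := (i1.const_mul _).add i2
  refine ⟨(integrable_const _).add i3, ?_⟩
  rw [integral_add (integrable_const _) i3, integral_add (i1.const_mul _) i2,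
    integral_const_mul, e2]
  simp

lemma mm_poly {b : ℕ} (hb : 2 ≤ b) {h' h'' : ℝ} (hlt : h' < h'') (np : ∀ R, mm b h' R h' ≤ 1) :
    ∃ l C : ℝ, 0 < l ∧ l < 1 ∧ 0 < C ∧ ∀ R a, mm b h'' R a ≤ C * l ^ R * (1 + a ^ 2) := by
  obtain ⟨l₀, hl0, hl1, hl⟩ := mm_decay hb hlt np
  set l := max l₀ (3 / 4)
  have hl34 : 3 / 4 ≤ l := le_max_right _ _
  have hl1 : l < 1 := max_lt hl1 (by norm_num)
  have hlR : ∀ R, mm b h'' R h'' ≤ l ^ R := fun R => (hl R).trans (by gcongr; exact le_max_left _ _)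
  have hb' : (2 : ℝ) ≤ b := by exact_mod_cast hb
  set Q : ℝ := 4 * (b + b * gv b)
  have hQ : 0 ≤ Q := by positivity
  set A := max h'' (1 + Q)
  have hA1 : h'' ≤ A := le_max_left _ _
  have hA2 : 1 + Q ≤ A := le_max_right _ _
  set p := (gam b).real (Ici (A - h'' / b))
  have hp : 0 < p := gam_tail_pos hb _
  have hp1 : p ≤ 1 := measureReal_le_one
  have hA : ∀ R, mm b h'' R A ≤ 1 / p * l ^ R := fun R => by
    have h1 := hlR (R + 1)
    rw [mm_succ _ _ _ le_rfl] at h1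
    have := int_lower (mm_int b h'' R (h'' / b)) (fun y => mm_nonneg _ _ _ _) (x := A - h'' / b)
      (c := mm b h'' R A) (fun y hy => mm_mono _ _ _ (by linarith))
    have h3 : 0 ≤ p * mm b h'' R A := mul_nonneg hp.le (mm_nonneg _ _ _ _)
    have h4 : p * mm b h'' R A ≤ l ^ R := by
      have : l ^ (R + 1) ≤ l ^ R := pow_le_pow_of_le_one (by linarith) hl1.le (by omega)
      nlinarith
    rw [div_mul_eq_mul_div, one_mul, le_div_iff₀ hp]; linarith
  refine ⟨l, 1 / p, by linarith, hl1, by positivity, fun R => ?_⟩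
  have small : ∀ R a, a ≤ A → mm b h'' R a ≤ 1 / p * l ^ R * (1 + a ^ 2) := fun R a ha =>
    (mm_mono _ _ _ ha).trans ((hA R).trans (le_mul_of_one_le_right (by positivity) (by nlinarith)))
  induction R with
  | zero =>
    intro a
    refine (mm_le _ _ _ _).trans ?_
    have : 1 ≤ 1 / p := by rw [le_div_iff₀ hp]; linarith
    simp only [pow_zero, mul_one]; nlinarith [sq_nonneg a]
  | succ R ih =>
    intro a
    rcases le_or_gt a A with ha | ha
    · exact small _ a ha
    rw [mm_succ _ _ _ (hA1.trans ha.le)]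
    have h1 : ∫ y, mm b h'' R (a / b + y) ∂gam b ≤ 1 / p * l ^ R * (1 + (a / b) ^ 2 + gv b) := by
      rw [← (gauss_sq _ _).2, ← integral_const_mul]
      exact integral_mono (mm_int _ _ _ _) ((gauss_sq _ _).1.const_mul _) fun y => ih _
    calc _ ≤ b * (1 / p * l ^ R * (1 + (a / b) ^ 2 + gv b)) := by gcongr
      _ = 1 / p * l ^ R * (b * (1 + (a / b) ^ 2 + gv b)) := by ring
      _ ≤ 1 / p * l ^ R * (l * (1 + a ^ 2)) := by
        refine mul_le_mul_of_nonneg_left ?_ (by positivity)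
        have h2 : (b : ℝ) * (1 + (a / b) ^ 2 + gv b) = b + b * gv b + a ^ 2 / b := by field_simp; ring
        have h3 : a ^ 2 / b ≤ a ^ 2 / 2 := by gcongr
        have h4 : Q ≤ a ^ 2 := by nlinarith
        rw [h2]
        nlinarith [sq_nonneg a]
      _ = _ := by ring

lemma mm_survive {b : ℕ} (hb : 2 ≤ b) {h : ℝ} {R : ℕ} (hM : 1 < mm b h R h) :
    ∃ (g : ℝ → ℝ) (c : ℝ), 0 < c ∧ Measurable g ∧ (∀ a, 0 ≤ g a) ∧ (∀ a, g a ≤ 1) ∧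
      (∀ a < h, g a = 1) ∧ (∀ a, h ≤ a → g a ≤ 1 - c) ∧
      ∀ a, h ≤ a → (∫ y, g (a / b + y) ∂gam b) ^ b ≤ g a := by
  have hb' : (2 : ℝ) ≤ b := by exact_mod_cast hb
  have hR : R ≠ 0 := by rintro rfl; simp [mm] at hM
  set M := mm b h R h
  set s := M ^ ((R : ℝ)⁻¹)
  have hs : 1 < s := Real.one_lt_rpow hM (by positivity)
  have hs0 : 0 < s := by linarith
  have hsR : s ^ R = M := Real.rpow_inv_natCast_pow (by linarith) hR
  set F : ℝ → ℝ := fun a => ∑ j ∈ Finset.range R, s⁻¹ ^ j * mm b h j a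
  have Fm : Measurable F := Finset.measurable_sum _ fun j _ => (mm_meas b h j).const_mul _
  have F0 : ∀ a, 0 ≤ F a := fun a => Finset.sum_nonneg fun j _ => mul_nonneg (by positivity) (mm_nonneg _ _ _ _)
  set B : ℝ := ∑ j ∈ Finset.range R, s⁻¹ ^ j * (b : ℝ) ^ j
  have FB : ∀ a, F a ≤ B := fun a => Finset.sum_le_sum fun j _ => by
    gcongr; exact mm_le _ _ _ _
  have F1 : ∀ a, h ≤ a → 1 ≤ F a := fun a ha => by
    refine le_trans ?_ (Finset.single_le_sum (f := fun j => s⁻¹ ^ j * mm b h j a)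
      (fun j _ => mul_nonneg (by positivity) (mm_nonneg _ _ _ _)) (Finset.mem_range.2 (Nat.pos_of_ne_zero hR)))
    simp [mm, ha]
  have hB : 0 < B := by linarith [F1 h le_rfl, FB h]
  have Fi : ∀ a, Integrable (fun y => F (a + y)) (gam b) := fun a =>
    integrable_bdd (Fm.comp (by fun_prop)) (fun y => F0 _) (fun y => FB _)
  have FU : ∀ a, h ≤ a → s * F a ≤ b * ∫ y, F (a / b + y) ∂gam b := fun a ha => by
    have e : b * ∫ y, F (a / b + y) ∂gam b = ∑ j ∈ Finset.range R, s⁻¹ ^ j * mm b h (j + 1) a := by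
      rw [integral_finsetSum _ fun j _ => (mm_int b h j (a / b)).const_mul _, Finset.mul_sum]
      refine Finset.sum_congr rfl fun j _ => ?_
      rw [integral_const_mul, mm_succ _ _ _ ha]; ring
    have e2 : ∑ j ∈ Finset.range R, s⁻¹ ^ j * mm b h (j + 1) a =
        s * ∑ j ∈ Finset.range R, s⁻¹ ^ (j + 1) * mm b h (j + 1) a := by
      rw [Finset.mul_sum]
      refine Finset.sum_congr rfl fun j _ => ?_
      rw [pow_succ]; field_simp
    have e3 := Finset.sum_range_succ' (fun j => s⁻¹ ^ j * mm b h j a) R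
    rw [Finset.sum_range_succ] at e3
    rw [e, e2]
    have h1 : 1 ≤ s⁻¹ ^ R * mm b h R a := by
      rw [inv_pow, hsR, inv_mul_eq_div, one_le_div (by linarith)]
      exact mm_mono _ _ _ ha
    have h2 : s⁻¹ ^ 0 * mm b h 0 a = 1 := by simp [mm, ha]
    gcongr
    change ∑ j ∈ Finset.range R, s⁻¹ ^ j * mm b h j a ≤ _
    linarith
  set c := (s - 1) / (s * B)
  have hc : 0 < c := div_pos (by linarith) (by positivity)
  have hcB : s * (c * B) = s - 1 := by simp only [c]; field_simp
  have hcF : ∀ a, s * (c * F a) ≤ s - 1 := fun a => by rw [← hcB]; gcongr; exact FB a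
  have hcF1 : ∀ a, c * F a ≤ 1 := fun a => by nlinarith [hcF a, F0 a]
  refine ⟨fun a => 1 - c * F a, c, hc, by fun_prop, fun a => by linarith [hcF1 a], fun a => by
    nlinarith [F0 a], fun a ha => ?_, fun a ha => by nlinarith [F1 a ha], fun a ha => ?_⟩
  · have : F a = 0 := Finset.sum_eq_zero fun j _ => by rw [mm_zero _ _ _ ha, mul_zero]
    simp [this]
  · rw [integral_sub (integrable_const _) ((Fi _).const_mul _), integral_const_mul]
    simp only [integral_const, probReal_univ, smul_eq_mul, mul_one]
    set I := ∫ y, F (a / b + y) ∂gam b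
    have hI : c * I ≤ 1 := by
      simp only [I]
      rw [← integral_const_mul]
      calc _ ≤ ∫ y, (1 : ℝ) ∂gam b := integral_mono ((Fi _).const_mul _) (integrable_const _) fun y => hcF1 _
        _ = 1 := by simp
    have hIF := FU a ha
    set f := c * F a
    have hf0 : 0 ≤ f := mul_nonneg hc.le (F0 a)
    have h1 : s * f / b ≤ c * I := by
      rw [div_le_iff₀ (by linarith)]; simp only [f]; nlinarith
    calc (1 - c * I) ^ b ≤ (1 - s * f / b) ^ b := by gcongr
      _ ≤ Real.exp (-(s * f)) := Real.one_sub_div_pow_le_exp_neg (by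
          have : s * f / b * b = s * f := div_mul_cancel₀ _ (by linarith)
          nlinarith)
      _ ≤ 1 / (1 + s * f) := by
          rw [Real.exp_neg, one_div]
          gcongr
          linarith [Real.add_one_le_exp (s * f)]
      _ ≤ 1 - f := by
          rw [div_le_iff₀ (by positivity)]
          nlinarith [hcF a]
end GFF

namespace GFF

variable {I : Type*}
noncomputable def lin (c : I →₀ ℝ) (ω : I → ℝ) : ℝ := Finsupp.linearCombination ℝ ω c
noncomputable def E2 (μ : Measure (I → ℝ)) (c c' : I →₀ ℝ) : ℝ := ∫ ω, lin c ω * lin c' ω ∂μ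

lemma lin_eq (c : I →₀ ℝ) : lin c = fun ω => ∑ i ∈ c.support, c i * ω i := by
  ext ω; simp [lin, Finsupp.linearCombination_apply, Finsupp.sum]
lemma lin_add (c c' : I →₀ ℝ) (ω) : lin (c + c') ω = lin c ω + lin c' ω := by simp [lin]
lemma lin_sub (c c' : I →₀ ℝ) (ω) : lin (c - c') ω = lin c ω - lin c' ω := by simp [lin]
lemma lin_smul (a : ℝ) (c : I →₀ ℝ) (ω) : lin (a • c) ω = a * lin c ω := by simp [lin]
lemma lin_sum {ι : Type*} (s : Finset ι) (c : ι → I →₀ ℝ) (ω) : lin (∑ i ∈ s, c i) ω = ∑ i ∈ s, lin (c i) ω := by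
  simp [lin]
lemma lin_single (i : I) (a : ℝ) (ω) : lin (Finsupp.single i a) ω = a * ω i := by simp [lin]
lemma lin_meas (c : I →₀ ℝ) : Measurable (lin c) := by rw [lin_eq]; fun_prop

variable {μ : Measure (I → ℝ)} {K : I → I → ℝ}

lemma lin_law (hμ : IsGaussianField μ K) (c : I →₀ ℝ) : ∃ v, μ.map (lin c) = gaussianReal 0 v :=
  ⟨_, by rw [lin_eq]; exact hμ.2 c⟩

lemma lin_memLp (hμ : IsGaussianField μ K) (c : I →₀ ℝ) : MemLp (lin c) 2 μ := by
  obtain ⟨v, hv⟩ := lin_law hμ c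
  have : MemLp id 2 (μ.map (lin c)) := by rw [hv]; exact memLp_id_gaussianReal' 2 (by simp)
  exact (memLp_map_measure_iff aestronglyMeasurable_id (lin_meas c).aemeasurable).1 this

lemma lin_mean (hμ : IsGaussianField μ K) (c : I →₀ ℝ) : ∫ ω, lin c ω ∂μ = 0 := by
  obtain ⟨v, hv⟩ := lin_law hμ c
  rw [← integral_map (f := fun x : ℝ => x) (lin_meas c).aemeasurable aestronglyMeasurable_id, hv]; simp

lemma lin_int2 (hμ : IsGaussianField μ K) (c c' : I →₀ ℝ) : Integrable (fun ω => lin c ω * lin c' ω) μ :=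
  (lin_memLp hμ c).integrable_mul (lin_memLp hμ c')

lemma E2_add (hμ : IsGaussianField μ K) (a b c) : E2 μ (a + b) c = E2 μ a c + E2 μ b c := by
  simp only [E2, lin_add, add_mul]; exact integral_add (lin_int2 hμ _ _) (lin_int2 hμ _ _)
lemma E2_sub (hμ : IsGaussianField μ K) (a b c) : E2 μ (a - b) c = E2 μ a c - E2 μ b c := by
  simp only [E2, lin_sub, sub_mul]; exact integral_sub (lin_int2 hμ _ _) (lin_int2 hμ _ _)
lemma E2_smul (r : ℝ) (a c) : E2 μ (r • a) c = r * E2 μ a c := by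
  simp only [E2, lin_smul, mul_assoc]; exact integral_const_mul _ _
lemma E2_comm (a c) : E2 μ a c = E2 μ c a := by simp only [E2, mul_comm]
lemma E2_sum (hμ : IsGaussianField μ K) {ι : Type*} (s : Finset ι) (f : ι → I →₀ ℝ) (c) :
    E2 μ (∑ i ∈ s, f i) c = ∑ i ∈ s, E2 μ (f i) c := by
  simp only [E2, lin_sum, Finset.sum_mul]; exact integral_finsetSum _ fun i _ => lin_int2 hμ _ _
lemma E2_nonneg (c) : 0 ≤ E2 μ c c := integral_nonneg fun ω => mul_self_nonneg _

lemma lin_law' (hμ : IsGaussianField μ K) (c : I →₀ ℝ) :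
    μ.map (lin c) = gaussianReal 0 (E2 μ c c).toNNReal := by
  obtain ⟨v, hv⟩ := lin_law hμ c
  rw [hv]; congr 1
  have h : ∫ x, x * x ∂(μ.map (lin c)) = E2 μ c c :=
    integral_map (lin_meas c).aemeasurable (by fun_prop)
  rw [hv] at h
  have := variance_of_integral_eq_zero (X := id) (μ := gaussianReal 0 v) aemeasurable_id (by simp)
  rw [variance_id_gaussianReal] at this
  rw [← h]
  simp only [id, sq] at this
  rw [← this]; simp

lemma E2_single (hμ : IsGaussianField μ K) (hs : ∀ i j, K i j = K j i)
    (hK : ∀ i j, 2 * |K i j| ≤ K i i + K j j) (i j : I) :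
    E2 μ (Finsupp.single i 1) (Finsupp.single j 1) = K i j := by
  have hE : ∀ c : I →₀ ℝ, 0 ≤ (∑ i ∈ c.support, ∑ j ∈ c.support, c i * c j * K i j) →
      E2 μ c c = ∑ i ∈ c.support, ∑ j ∈ c.support, c i * c j * K i j := fun c hc => by
    have h1 := lin_law' hμ c
    rw [lin_eq, hμ.2 c, gaussianReal_ext_iff] at h1
    exact ((Real.toNNReal_eq_toNNReal_iff hc (E2_nonneg c)).1 h1.2).symm
  have hii : ∀ i, E2 μ (Finsupp.single i 1) (Finsupp.single i 1) = K i i := fun i => by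
    have h0 : 0 ≤ K i i := by have := hK i i; have := abs_nonneg (K i i); linarith
    have := hE (Finsupp.single i 1)
    rw [Finsupp.support_single_ne_zero _ one_ne_zero] at this
    simpa using this (by simpa using h0)
  by_cases hij : i = j
  · subst hij; exact hii i
  have := hE (Finsupp.single i 1 + Finsupp.single j 1)
  rw [Finsupp.support_add_eq (by
    rw [Finsupp.support_single_ne_zero _ one_ne_zero, Finsupp.support_single_ne_zero _ one_ne_zero]
    simpa using hij), Finsupp.support_single_ne_zero _ one_ne_zero, Finsupp.support_single_ne_zero _ one_ne_zero] at this
  have hu : ({i} : Finset I) ∪ {j} = {i, j} := rfl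
  rw [hu] at this
  simp only [Finset.sum_pair hij] at this
  simp [hij, Ne.symm hij, Finsupp.single_apply] at this
  rw [E2_add hμ, E2_comm, E2_comm (Finsupp.single j 1), E2_add hμ, E2_add hμ, hii, hii,
    E2_comm (Finsupp.single j 1), hs j i] at this
  have h1 := this (by have := hK i j; have := neg_abs_le (K i j); linarith)
  linarith

lemma lin_gauss (hμ : IsGaussianField μ K) {ι : Type*} [Fintype ι] (c : ι → I →₀ ℝ) :
    HasGaussianLaw (fun ω i => lin (c i) ω) μ := by
  haveI := hμ.1
  have hm : Measurable fun (ω : I → ℝ) i => lin (c i) ω := measurable_pi_lambda _ fun i => lin_meas _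
  refine ⟨isGaussian_of_map_eq_gaussianReal fun L => ?_⟩
  rw [Measure.map_map (by fun_prop) hm]
  have e : (L ∘ fun ω i => lin (c i) ω) = lin (∑ i, L (Pi.single i 1) • c i) := by
    ext ω
    rw [lin_sum]
    simp only [lin_smul, Function.comp]
    conv_lhs => rw [pi_eq_sum_univ' (fun i => lin (c i) ω)]
    simp [mul_comm]
  obtain ⟨v, hv⟩ := lin_law hμ (∑ i, L (Pi.single i 1) • c i)
  exact ⟨0, v, by rw [e, hv]⟩

lemma lin_cov (hμ : IsGaussianField μ K) (c c') : cov[lin c, lin c'; μ] = E2 μ c c' := by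
  simp [covariance, lin_mean hμ, E2]

lemma lin_tail (hμ : IsGaussianField μ K) (c) {s t : ℝ} (hs : 0 < s) (ht : 0 ≤ t) (h : E2 μ c c ≤ s) :
    μ.real {ω | t ≤ lin c ω} ≤ Real.exp (-(t ^ 2 / (2 * s))) := by
  haveI := hμ.1
  have hl := lin_law' hμ c
  have hmgf : mgf (lin c) μ (t / s) = Real.exp (E2 μ c c * (t / s) ^ 2 / 2) := by
    rw [mgf_gaussianReal hl]; simp [E2_nonneg]
  have hint : Integrable (fun ω => Real.exp (t / s * lin c ω)) μ := by
    have := integrable_exp_mul_gaussianReal (μ := 0) (v := (E2 μ c c).toNNReal) (t / s)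
    rw [← hl] at this
    exact (integrable_map_measure (by fun_prop) (lin_meas c).aemeasurable).1 this
  refine (measure_ge_le_exp_mul_mgf t (by positivity) hint).trans ?_
  rw [hmgf, ← Real.exp_add]
  gcongr
  have : E2 μ c c * (t / s) ^ 2 / 2 ≤ s * (t / s) ^ 2 / 2 := by gcongr
  have e : s * (t / s) ^ 2 / 2 = t ^ 2 / (2 * s) := by field_simp
  have e2 : -(t / s) * t = -(2 * (t ^ 2 / (2 * s))) := by field_simp
  linarith

lemma lin_map_dual (hμ : IsGaussianField μ K) {ι : Type*} [Fintype ι] (a : ι → I →₀ ℝ)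
    (D : StrongDual ℝ (ι → ℝ)) : (μ.map (fun ω i => lin (a i) ω)).map D = gaussianReal 0
      (∑ i, ∑ j, D (Pi.single i 1) * (D (Pi.single j 1) * E2 μ (a j) (a i))).toNNReal := by
  rw [Measure.map_map (by fun_prop) (measurable_pi_lambda _ fun i => lin_meas _)]
  have e : (D ∘ fun ω i => lin (a i) ω) = lin (∑ i, D (Pi.single i 1) • a i) := by
    ext ω
    rw [lin_sum]
    simp only [lin_smul, Function.comp]
    conv_lhs => rw [pi_eq_sum_univ' (fun i => lin (a i) ω)]
    simp [mul_comm]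
  rw [e, lin_law' hμ]
  congr 2
  rw [E2_sum hμ]
  refine Finset.sum_congr rfl fun i _ => ?_
  rw [E2_smul, E2_comm, E2_sum hμ, Finset.mul_sum]
  refine Finset.sum_congr rfl fun j _ => ?_
  rw [E2_smul]

lemma lin_law_eq {J : Type*} {ν : Measure (J → ℝ)} {K' : J → J → ℝ} (hμ : IsGaussianField μ K)
    (hν : IsGaussianField ν K') {ι : Type*} [Fintype ι] (c : ι → I →₀ ℝ) (c' : ι → J →₀ ℝ)
    (h : ∀ i j, E2 μ (c i) (c j) = E2 ν (c' i) (c' j)) :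
    μ.map (fun ω i => lin (c i) ω) = ν.map (fun ω i => lin (c' i) ω) := by
  have := hμ.1
  have := hν.1
  have hG1 := (lin_gauss hμ c).isGaussian_map
  have hG2 := (lin_gauss hν c').isGaussian_map
  refine Measure.ext_of_charFunDual ?_
  ext D
  rw [charFunDual_eq_charFun_map_one, charFunDual_eq_charFun_map_one, lin_map_dual hμ, lin_map_dual hν]
  simp only [h]
end GFF

namespace GFF
variable {V : Type*} {G : SimpleGraph V} {b : ℕ}

noncomputable def nb (G : SimpleGraph V) (x : V) : Finset V :=
  if h : (G.neighborSet x).Finite then h.toFinset else ∅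

lemma nb_fin (hr : IsReg G (b + 1)) (x : V) : (G.neighborSet x).Finite := by
  have h := hr x
  have : Finite (G.neighborSet x) := Nat.finite_of_card_ne_zero (by omega)
  exact Set.toFinite _

lemma mem_nb (hr : IsReg G (b + 1)) {x y : V} : y ∈ nb G x ↔ G.Adj x y := by
  simp [nb, nb_fin hr x]

lemma card_nb (hr : IsReg G (b + 1)) (x : V) : (nb G x).card = b + 1 := by
  rw [← hr x, nb, dif_pos (nb_fin hr x), ← Set.ncard_eq_toFinset_card _ (nb_fin hr x)]; rfl

noncomputable abbrev sg (x : V) : V →₀ ℝ := Finsupp.single x 1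

noncomputable def Q (G : SimpleGraph V) (b : ℕ) : Module.End ℝ (V →₀ ℝ) :=
  Finsupp.linearCombination ℝ (fun x => (1 / 2 : ℝ) • sg x + (1 / (2 * (b + 1)) : ℝ) • ∑ z ∈ nb G x, sg z)

lemma Q_sg (x : V) : Q G b (sg x) = (1 / 2 : ℝ) • sg x + (1 / (2 * (b + 1)) : ℝ) • ∑ z ∈ nb G x, sg z := by
  simp [Q]

noncomputable def tot : (V →₀ ℝ) →ₗ[ℝ] ℝ := Finsupp.linearCombination ℝ (fun _ => (1 : ℝ))

lemma tot_Q (hr : IsReg G (b + 1)) (c : V →₀ ℝ) : tot (Q G b c) = tot c := by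
  suffices h : tot ∘ₗ Q G b = tot from LinearMap.congr_fun h c
  refine Finsupp.lhom_ext' fun x => LinearMap.ext_ring ?_
  change tot (Q G b (sg x)) = tot (sg x)
  rw [Q_sg]
  simp [tot, card_nb hr]
  field_simp
  norm_num

lemma tot_Qpow (hr : IsReg G (b + 1)) (c : V →₀ ℝ) (L : ℕ) : tot ((Q G b ^ L) c) = tot c := by
  induction L with
  | zero => simp
  | succ n ih => rw [pow_succ', Module.End.mul_apply, tot_Q hr, ih]

lemma Q_apply (hr : IsReg G (b + 1)) (c : V →₀ ℝ) (y : V) :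
    Q G b c y = (1 / 2 : ℝ) * c y + (1 / (2 * (b + 1)) : ℝ) * ∑ z ∈ nb G y, c z := by
  induction c using Finsupp.induction_linear with
  | zero => simp
  | add f g hf hg => simp [hf, hg, Finset.sum_add_distrib]; ring
  | single x a =>
    have : Finsupp.single x a = a • sg x := by simp
    rw [this, map_smul, Q_sg]
    have h : ∑ z ∈ nb G x, (sg z) y = ∑ z ∈ nb G y, (sg x) z := by
      simp [Finsupp.single_apply, Finset.sum_ite_eq, mem_nb hr, G.adj_comm]
    simp only [Finsupp.smul_apply, Finsupp.add_apply, Finsupp.finsetSum_apply, h, smul_eq_mul, ← Finset.mul_sum]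
    ring

/-- radial walk -/
noncomputable def qr (b : ℕ) (f : ℕ → ℝ) : ℕ → ℝ
  | 0 => f 0 / 2 + f 1 / 2
  | (n + 1) => f (n + 1) / 2 + f n / (2 * (b + 1)) + b * f (n + 2) / (2 * (b + 1))

def LT (G : SimpleGraph V) (x : V) (M : ℕ) : Prop :=
  ∀ y, G.dist x y ≤ M → (∀ z, G.Adj y z → G.dist x z = G.dist x y + 1 ∨ G.dist x z + 1 = G.dist x y) ∧
    (y ≠ x → ∃! z, G.Adj y z ∧ G.dist x z + 1 = G.dist x y)

lemma LT_step (hc : G.Connected) (hr : IsReg G (b + 1)) {x y : V} {M : ℕ} (h : LT G x M) (hy : G.dist x y ≤ M)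
    (f : ℕ → ℝ) :
    (1 / 2 : ℝ) * f (G.dist x y) + (1 / (2 * (b + 1)) : ℝ) * ∑ z ∈ nb G y, f (G.dist x z) = qr b f (G.dist x y) := by
  obtain ⟨h1, h2⟩ := h y hy
  have hb : (b : ℝ) + 1 ≠ 0 := by positivity
  by_cases e : y = x
  · subst e
    have : ∀ z ∈ nb G y, f (G.dist y z) = f 1 := fun z hz => by
      rw [SimpleGraph.dist_eq_one_iff_adj.2 ((mem_nb hr).1 hz)]
    rw [Finset.sum_congr rfl this]
    simp [card_nb hr, qr]
    field_simp
  · obtain ⟨z0, ⟨hz0, hd0⟩, hu⟩ := h2 e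
    obtain ⟨n, hn⟩ : ∃ n, G.dist x y = n + 1 := ⟨G.dist x z0, hd0.symm⟩
    rw [← Finset.add_sum_erase _ _ ((mem_nb hr).2 hz0)]
    have : ∀ z ∈ (nb G y).erase z0, f (G.dist x z) = f (n + 2) := fun z hz => by
      rw [Finset.mem_erase, mem_nb hr] at hz
      rcases h1 z hz.2 with h | h
      · rw [h, hn]
      · exact absurd (hu z ⟨hz.2, h⟩) hz.1
    rw [Finset.sum_congr rfl this, Finset.sum_const, Finset.card_erase_of_mem ((mem_nb hr).2 hz0), card_nb hr]
    have : G.dist x z0 = n := by omega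
    rw [this, hn]
    simp [qr]
    field_simp
    ring

noncomputable def del0 : ℕ → ℝ := fun n => if n = 0 then 1 else 0

lemma Qpow_LT (hc : G.Connected) (hr : IsReg G (b + 1)) {x : V} {M : ℕ} (h : LT G x M) (k : ℕ) :
    ∀ y, G.dist x y + k ≤ M → (Q G b ^ k) (sg x) y = (qr b)^[k] del0 (G.dist x y) := by
  induction k with
  | zero =>
    intro y _
    simp [del0, Finsupp.single_apply, (hc x y).dist_eq_zero_iff]
  | succ k ih =>
    intro y hy
    rw [pow_succ', Module.End.mul_apply, Q_apply hr, ih y (by omega), Function.iterate_succ_apply',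
      ← LT_step hc hr h (by omega)]
    congr 2
    refine Finset.sum_congr rfl fun z hz => ih z ?_
    have := hc.dist_triangle (u := x) (v := y) (w := z)
    rw [SimpleGraph.dist_eq_one_iff_adj.2 ((mem_nb hr).1 hz)] at this
    omega

lemma Qpow_far (hc : G.Connected) (hr : IsReg G (b + 1)) {x : V} (k : ℕ) :
    ∀ y, k < G.dist x y → (Q G b ^ k) (sg x) y = 0 := by
  induction k with
  | zero =>
    intro y hy
    have : x ≠ y := by rintro rfl; simp at hy
    simp [Finsupp.single_apply, this]
  | succ k ih =>
    intro y hy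
    rw [pow_succ', Module.End.mul_apply, Q_apply hr, ih y (by omega), Finset.sum_eq_zero]
    · simp
    intro z hz
    refine ih z ?_
    have := hc.dist_triangle (u := x) (v := z) (w := y)
    rw [SimpleGraph.dist_eq_one_iff_adj.2 ((mem_nb hr).1 hz).symm] at this
    omega

noncomputable def E2L {μ : Measure (V → ℝ)} {K : V → V → ℝ} (hμ : IsGaussianField μ K) (c' : V →₀ ℝ) :
    (V →₀ ℝ) →ₗ[ℝ] ℝ where
  toFun c := E2 μ c c'
  map_add' a b := E2_add hμ a b c'
  map_smul' r a := E2_smul r a c'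

variable {μ : Measure (V → ℝ)} {K : V → V → ℝ}

/-- discrete Poisson equation for the covariance -/
def Harm (μ : Measure (V → ℝ)) (G : SimpleGraph V) (b : ℕ) (ν : ℝ) : Prop :=
  ∀ x y, E2 μ (sg x - Q G b (sg x)) (sg y) = (1 / 2 : ℝ) * (sg x y - ν)

lemma harm_gen (hμ : IsGaussianField μ K) {ν : ℝ} (hh : Harm μ G b ν) (c : V →₀ ℝ) (y : V) :
    E2 μ (c - Q G b c) (sg y) = (1 / 2 : ℝ) * (c y - ν * tot c) := by
  suffices h : E2L hμ (sg y) ∘ₗ (LinearMap.id - Q G b) = (1 / 2 : ℝ) • (Finsupp.lapply y - ν • tot) by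
    have := LinearMap.congr_fun h c
    simpa [E2L] using this
  refine Finsupp.lhom_ext' fun x => LinearMap.ext_ring ?_
  have := hh x y
  simpa [E2L, tot] using this

lemma harm_adj (hμ : IsGaussianField μ K) {ν : ℝ} (hh : Harm μ G b ν) (c c' : V →₀ ℝ) :
    E2 μ (Q G b c) c' = E2 μ c (Q G b c') := by
  have h0 : ∀ x y, E2 μ (Q G b (sg x)) (sg y) = E2 μ (sg x) (Q G b (sg y)) := fun x y => by
    have h1 := hh x y
    have h2 := hh y x
    rw [E2_sub hμ] at h1 h2
    rw [E2_comm (sg x) (Q G b (sg y))]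
    have : sg x y = sg y x := by simp [Finsupp.single_apply, eq_comm]
    rw [E2_comm (sg y)] at h2
    linarith
  have h1 : ∀ x c', E2 μ (Q G b (sg x)) c' = E2 μ (sg x) (Q G b c') := fun x c' => by
    have : E2L hμ (Q G b (sg x)) = E2L hμ (sg x) ∘ₗ Q G b := by
      refine Finsupp.lhom_ext' fun y => LinearMap.ext_ring ?_
      have := h0 x y
      rw [E2_comm, E2_comm (sg x)] at this
      simpa [E2L] using this
    have := LinearMap.congr_fun this c'
    rw [E2_comm, E2_comm (sg x)]
    simpa [E2L] using this
  have : E2L hμ c' ∘ₗ Q G b = E2L hμ (Q G b c') := by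
    refine Finsupp.lhom_ext' fun y => LinearMap.ext_ring ?_
    have := h1 y c'
    simpa [E2L] using this
  have := LinearMap.congr_fun this c
  simpa [E2L] using this

lemma harm_adj_pow (hμ : IsGaussianField μ K) {ν : ℝ} (hh : Harm μ G b ν) (L : ℕ) : ∀ (c c' : V →₀ ℝ),
    E2 μ ((Q G b ^ L) c) c' = E2 μ c ((Q G b ^ L) c') := by
  induction L with
  | zero => simp
  | succ n ih =>
    intro c c'
    rw [pow_succ', Module.End.mul_apply, harm_adj hμ hh, ih, ← Module.End.mul_apply, ← pow_succ, pow_succ']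

noncomputable def sL (G : SimpleGraph V) (b L : ℕ) (x : V) : V →₀ ℝ := sg x - (Q G b ^ L) (sg x)

lemma sL_cov (hμ : IsGaussianField μ K) {ν : ℝ} (hh : Harm μ G b ν) (hr : IsReg G (b + 1)) (L : ℕ) (x y : V) :
    E2 μ (sL G b L x) (sL G b L y) =
      (1 / 2 : ℝ) * ∑ k ∈ Finset.range L, ((Q G b ^ k) (sg x) y - (Q G b ^ (k + L)) (sg x) y) := by
  have h1 : E2 μ (sL G b L x) (sL G b L y) = E2 μ (sL G b L x - (Q G b ^ L) (sL G b L x)) (sg y) := by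
    rw [E2_sub hμ, harm_adj_pow hμ hh]
    conv_lhs => rw [E2_comm]; arg 2; rw [sL]
    rw [E2_sub hμ, E2_comm, E2_comm (sL G b L x) ((Q G b ^ L) (sg y))]
  rw [h1]
  set w := (∑ k ∈ Finset.range L, Q G b ^ k) (sL G b L x) with hw
  have h2 : sL G b L x - (Q G b ^ L) (sL G b L x) = w - Q G b w := by
    have := mul_neg_geom_sum (Q G b) L
    have := LinearMap.congr_fun this (sL G b L x)
    simp only [Module.End.mul_apply, LinearMap.sub_apply, Module.End.one_apply] at this
    rw [← this]
  rw [h2, harm_gen hμ hh]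
  have h3 : tot w = 0 := by
    rw [hw, LinearMap.sum_apply, map_sum]
    refine Finset.sum_eq_zero fun k _ => ?_
    rw [tot_Qpow hr, sL, map_sub, tot_Qpow hr, sub_self]
  rw [h3, mul_zero, sub_zero, hw, LinearMap.sum_apply, Finsupp.finsetSum_apply]
  congr 1
  refine Finset.sum_congr rfl fun k _ => ?_
  rw [sL, map_sub, Finsupp.sub_apply, ← Module.End.mul_apply, ← pow_add]

lemma sL_far (hμ : IsGaussianField μ K) {ν : ℝ} (hh : Harm μ G b ν) (hr : IsReg G (b + 1)) (hc : G.Connected)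
    {L : ℕ} {x y : V} (hd : 2 * L ≤ G.dist x y) : E2 μ (sL G b L x) (sL G b L y) = 0 := by
  rw [sL_cov hμ hh hr, Finset.sum_eq_zero, mul_zero]
  intro k hk
  rw [Finset.mem_range] at hk
  rw [Qpow_far hc hr _ _ (by omega), Qpow_far hc hr _ _ (by omega), sub_zero]

noncomputable def kap (b L n : ℕ) : ℝ :=
  (1 / 2 : ℝ) * ∑ k ∈ Finset.range L, ((qr b)^[k] del0 n - (qr b)^[k + L] del0 n)

lemma sL_LT (hμ : IsGaussianField μ K) {ν : ℝ} (hh : Harm μ G b ν) (hr : IsReg G (b + 1)) (hc : G.Connected)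
    {L M : ℕ} {x y : V} (ht : LT G x M) (hd : G.dist x y + 2 * L ≤ M) :
    E2 μ (sL G b L x) (sL G b L y) = kap b L (G.dist x y) := by
  rw [sL_cov hμ hh hr, kap]
  congr 1
  refine Finset.sum_congr rfl fun k hk => ?_
  rw [Finset.mem_range] at hk
  rw [Qpow_LT hc hr ht _ _ (by omega), Qpow_LT hc hr ht _ _ (by omega)]
end GFF

namespace GFF
section spectral
variable {V : Type*} [Fintype V] {G : SimpleGraph V} {b : ℕ}

lemma spec0 {A : Matrix V V ℝ} (hA : A.IsHermitian) : ∃ (u : V → V → ℝ) (lam : V → ℝ),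
    (∀ x y, ∑ i, u i x * u i y = if x = y then 1 else 0) ∧ (∀ i, u i ≠ 0) ∧
    ∀ i x, ∑ z, A x z * u i z = lam i * u i x := by
  refine ⟨fun i x => hA.eigenvectorBasis i x, hA.eigenvalues, fun x y => ?_, fun i h => ?_, fun i x => ?_⟩
  · have h : (hA.eigenvectorUnitary : Matrix V V ℝ) * star (hA.eigenvectorUnitary : Matrix V V ℝ) = 1 :=
      (Matrix.mem_unitaryGroup_iff).1 hA.eigenvectorUnitary.2
    have := congrFun (congrFun h x) y
    simpa [Matrix.mul_apply, Matrix.one_apply, Matrix.star_apply] using this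
  · have h1 := hA.eigenvectorBasis.orthonormal.1 i
    have : hA.eigenvectorBasis i = 0 := by ext x; exact congrFun h x
    rw [this] at h1; simp at h1
  · have := congrFun (hA.mulVec_eigenvectorBasis i) x
    simpa [Matrix.mulVec, dotProduct] using this

lemma transP_sum (hr : IsReg G (b + 1)) (x : V) (f : V → ℝ) :
    ∑ z, transP G (b + 1) x z * f z = (1 / (b + 1) : ℝ) * ∑ z ∈ nb G x, f z := by
  have : nb G x = Finset.univ.filter (fun z => G.Adj x z) := by ext z; simp [mem_nb hr]
  rw [this, Finset.sum_filter, Finset.mul_sum]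
  refine Finset.sum_congr rfl fun z _ => ?_
  by_cases h : G.Adj x z <;> simp [transP, h]

lemma transP_symm (x y : V) : transP G (b + 1) x y = transP G (b + 1) y x := by
  simp [transP, G.adj_comm]

lemma transP_one (hr : IsReg G (b + 1)) (x : V) : ∑ z, transP G (b + 1) x z = 1 := by
  have := transP_sum hr x (fun _ => 1)
  simp only [mul_one] at this
  rw [this]; simp [card_nb hr]; field_simp

lemma dirichlet (hr : IsReg G (b + 1)) {f : V → ℝ} {l : ℝ} (s : ℝ) (hs : s * s = 1)
    (hf : ∀ x, ∑ z, transP G (b + 1) x z * f z = l * f x) :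
    ∑ x, ∑ y, transP G (b + 1) x y * (f x - s * f y) ^ 2 = 2 * (1 - s * l) * ∑ x, f x ^ 2 := by
  have h1 : ∀ x y, transP G (b + 1) x y * (f x - s * f y) ^ 2 =
      transP G (b + 1) x y * f x ^ 2 + (transP G (b + 1) x y * f y ^ 2) -
        2 * s * (f x * (transP G (b + 1) x y * f y)) := fun x y => by
    linear_combination (transP G (b + 1) x y * f y ^ 2) * hs
  simp only [h1, Finset.sum_sub_distrib, Finset.sum_add_distrib, ← Finset.mul_sum, hf, ← Finset.sum_mul, transP_one hr]
  rw [Finset.sum_comm (f := fun x y => transP G (b + 1) x y * f y ^ 2)]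
  have h2 : ∀ y, ∑ x, transP G (b + 1) x y = 1 := fun y => by
    simp only [transP_symm _ y]; exact transP_one hr y
  have h3 : ∀ y, ∑ i, transP G (b + 1) i y * f y ^ 2 = f y ^ 2 := fun y => by
    rw [← Finset.sum_mul, h2, one_mul]
  simp only [one_mul, h3]
  have : ∑ x, f x * (l * f x) = l * ∑ x, f x ^ 2 := by
    rw [Finset.mul_sum]; exact Finset.sum_congr rfl fun x _ => by ring
  rw [this]; ring

lemma transP_nonneg (x y : V) : 0 ≤ transP G (b + 1) x y := by
  simp only [transP, Matrix.of_apply]; split_ifs <;> positivity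

lemma eig_bd (hr : IsReg G (b + 1)) {f : V → ℝ} {l : ℝ} (h0 : f ≠ 0)
    (hf : ∀ x, ∑ z, transP G (b + 1) x z * f z = l * f x) : -1 ≤ l ∧ l ≤ 1 := by
  have hp : 0 < ∑ x, f x ^ 2 := by
    obtain ⟨x, hx⟩ := Function.ne_iff.1 h0
    exact Finset.sum_pos' (fun x _ => sq_nonneg _) ⟨x, Finset.mem_univ _, by simp at hx; positivity⟩
  have key : ∀ s : ℝ, s * s = 1 → 0 ≤ 1 - s * l := fun s hs => by
    have h := dirichlet hr s hs hf
    have h2 : 0 ≤ ∑ x, ∑ y, transP G (b + 1) x y * (f x - s * f y) ^ 2 :=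
      Finset.sum_nonneg fun x _ => Finset.sum_nonneg fun y _ => mul_nonneg (transP_nonneg _ _) (sq_nonneg _)
    rw [h] at h2
    by_contra hc
    push Not at hc
    nlinarith
  have h1 := key 1 (by norm_num)
  have h2 := key (-1) (by norm_num)
  constructor <;> linarith

lemma eig_const (hc : G.Connected) (hr : IsReg G (b + 1)) {f : V → ℝ}
    (hf : ∀ x, ∑ z, transP G (b + 1) x z * f z = 1 * f x) (x y : V) : f x = f y := by
  have h := dirichlet hr 1 (by norm_num) hf
  have h1 : ∀ x y, G.Adj x y → f x = f y := fun x y hxy => by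
    have h2 : ∀ x ∈ Finset.univ, 0 ≤ ∑ y, transP G (b + 1) x y * (f x - 1 * f y) ^ 2 :=
      fun x _ => Finset.sum_nonneg fun y _ => mul_nonneg (transP_nonneg _ _) (sq_nonneg _)
    have h3 := (Finset.sum_eq_zero_iff_of_nonneg h2).1 (by rw [h]; norm_num) x (Finset.mem_univ _)
    have h4 := (Finset.sum_eq_zero_iff_of_nonneg (fun y _ => mul_nonneg (transP_nonneg _ _) (sq_nonneg _))).1 h3 y (Finset.mem_univ _)
    have : transP G (b + 1) x y ≠ 0 := by simp [transP, hxy]; positivity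
    have := (mul_eq_zero.1 h4).resolve_left this
    rw [sq_eq_zero_iff] at this; linarith
  obtain ⟨p⟩ := hc x y
  induction p with
  | nil => rfl
  | cons ha _ ih => exact (h1 _ _ ha).trans ih

/-- spectral representation of the zero-average Green function -/
lemma spec (hc : G.Connected) (hr : IsReg G (b + 1)) {β : ℝ} (hβ : 0 < β)
    (hg : SpectralGapLB G (b + 1) β) {N : ℕ} (hN : Nat.card V = N) :
    ∃ (u : V → V → ℝ) (lam w : V → ℝ), (∀ x y, ∑ i, u i x * u i y = if x = y then 1 else 0) ∧
    (∀ i x, (1 / (b + 1) : ℝ) * ∑ z ∈ nb G x, u i z = lam i * u i x) ∧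
    (∀ i, 0 ≤ w i ∧ (w i ≠ 0 → w i ≤ 1 / β ∧ -1 ≤ lam i ∧ lam i ≤ 1 - β)) ∧
    (∀ x y, ∑ i, w i * (1 - lam i) * (u i x * u i y) = (if x = y then 1 else 0) - 1 / (N : ℝ)) ∧
    ∀ x y, zGreen G (b + 1) N x y = ∑ i, w i * (u i x * u i y) := by
  have hA : (transP G (b + 1)).IsHermitian := by
    ext x y; simp [Matrix.conjTranspose_apply, transP_symm]
  obtain ⟨u, lam, ho, h0, he⟩ := spec0 hA
  have hN0 : 0 < N := by
    have := hc.nonempty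
    rw [← hN]; exact Nat.card_pos
  set w : V → ℝ := fun i => if lam i = 1 then 0 else 1 / (1 - lam i) with hw
  have hgap : ∀ i, lam i ≠ 1 → β ≤ 1 - lam i := fun i hi => by
    have := hg (u i) (1 - lam i) (by
      ext x
      have := he i x
      rw [Matrix.sub_mulVec]
      simp only [Matrix.one_mulVec, Pi.sub_apply, Matrix.mulVec, dotProduct, this, Pi.smul_apply, smul_eq_mul]
      ring) (h0 i)
    refine this.resolve_left fun h => hi (by linarith)
  have hconst : ∀ i, lam i = 1 → ∀ x y, u i x = u i y := fun i hi x y =>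
    eig_const hc hr (fun x => by rw [he i x, hi]) x y
  have hsum0 : ∀ i, lam i ≠ 1 → ∑ y, u i y = 0 := fun i hi => by
    have h1 : ∑ x, ∑ z, transP G (b + 1) x z * u i z = ∑ z, u i z := by
      rw [Finset.sum_comm]
      refine Finset.sum_congr rfl fun z _ => ?_
      rw [← Finset.sum_mul]
      simp only [transP_symm _ z]
      rw [transP_one hr, one_mul]
    simp only [he, ← Finset.mul_sum] at h1
    by_contra hne
    exact hi (mul_right_cancel₀ hne (by rw [h1, one_mul]))
  have hproj : ∀ x y, ∑ i, (if lam i = 1 then u i x * u i y else 0) = 1 / (N : ℝ) := fun x y => by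
    have h1 : ∑ i, ∑ y, u i x * u i y = 1 := by
      rw [Finset.sum_comm]; simp [ho]
    have h2 : ∀ i, ∑ y, u i x * u i y = N * (if lam i = 1 then u i x * u i y else 0) := fun i => by
      split_ifs with hi
      · rw [Finset.sum_congr rfl (fun z _ => by rw [hconst i hi z y])]
        simp [← hN]
      · rw [← Finset.mul_sum, hsum0 i hi]; simp
    simp only [h2, ← Finset.mul_sum] at h1
    field_simp
    linarith
  refine ⟨u, lam, w, ho, fun i x => by rw [← transP_sum hr, he], fun i => ⟨?_, fun hi => ?_⟩, fun x y => ?_, fun x y => ?_⟩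
  · simp only [hw]; split_ifs with h
    · rfl
    · have := hgap i h
      have : 0 < 1 - lam i := by linarith
      positivity
  · simp only [hw] at hi ⊢
    split_ifs at hi ⊢ with h
    · simp at hi
    · have := hgap i h
      exact ⟨one_div_le_one_div_of_le hβ this, (eig_bd hr (h0 i) (he i)).1, by linarith⟩
  · rw [← hproj x y, ← ho x y, ← Finset.sum_sub_distrib]
    refine Finset.sum_congr rfl fun i _ => ?_
    simp only [hw]; split_ifs with h
    · simp
    · have := hgap i h
      have : 1 - lam i ≠ 0 := by linarith
      field_simp; ring
  · have hpow : ∀ k x y, (transP G (b + 1) ^ k) x y = ∑ i, lam i ^ k * (u i x * u i y) := fun k => by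
      induction k with
      | zero => intro x y; simp [Matrix.one_apply, ho]
      | succ k ih =>
        intro x y
        rw [pow_succ', Matrix.mul_apply]
        simp only [ih, Finset.mul_sum]
        rw [Finset.sum_comm]
        refine Finset.sum_congr rfl fun i _ => ?_
        have := he i x
        calc _ = ∑ z, (transP G (b + 1) x z * u i z) * (lam i ^ k * u i y) := by
              refine Finset.sum_congr rfl fun z _ => by ring
          _ = _ := by rw [← Finset.sum_mul, this]; ring
    have hheat : ∀ t, heatK G (b + 1) t x y = ∑ i, Real.exp (-(1 - lam i) * t) * (u i x * u i y) := fun t => by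
      refine HasSum.tsum_eq ?_
      have h1 : ∀ i ∈ Finset.univ, HasSum (fun k : ℕ => Real.exp (-t) * (u i x * u i y) * ((t * lam i) ^ k / (Nat.factorial k)))
          (Real.exp (-t) * (u i x * u i y) * Real.exp (t * lam i)) := fun i _ => by
        have := (NormedSpace.expSeries_div_hasSum_exp (t * lam i)).mul_left (Real.exp (-t) * (u i x * u i y))
        rwa [← Real.exp_eq_exp_ℝ] at this
      convert hasSum_sum h1 using 1
      · ext k
        rw [hpow, Finset.mul_sum]
        refine Finset.sum_congr rfl fun i _ => ?_
        rw [mul_pow]; ring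
      · refine Finset.sum_congr rfl fun i _ => ?_
        rw [mul_right_comm, ← Real.exp_add]; congr 2; ring
    rw [zGreen]
    have h1 : ∀ t, heatK G (b + 1) t x y - 1 / (N : ℝ) =
        ∑ i, (if lam i = 1 then 0 else Real.exp (-(1 - lam i) * t) * (u i x * u i y)) := fun t => by
      rw [hheat, ← hproj x y, ← Finset.sum_sub_distrib]
      refine Finset.sum_congr rfl fun i _ => ?_
      split_ifs with h
      · simp [h]
      · simp
    simp only [h1]
    rw [integral_finsetSum]
    · refine Finset.sum_congr rfl fun i _ => ?_
      simp only [hw]; split_ifs with h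
      · simp
      · have := hgap i h
        rw [integral_mul_const, integral_exp_mul_Ioi (by linarith)]
        have : 1 - lam i ≠ 0 := by linarith
        simp
        have h' : lam i - 1 ≠ 0 := fun h => this (by linarith)
        left
        field_simp; ring
    · intro i _
      split_ifs with h
      · simp
      · have := hgap i h
        exact (integrableOn_exp_mul_Ioi (by linarith) 0).mul_const _

variable {μ : Measure (V → ℝ)}

lemma gside (hc : G.Connected) (hr : IsReg G (b + 1)) {β : ℝ} (hβ : 0 < β)
    (hg : SpectralGapLB G (b + 1) β) {N : ℕ} (hN : Nat.card V = N) (hμ : IsGaussianField μ (zGreen G (b + 1) N)) :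
    Harm μ G b (1 / (N : ℝ)) ∧ ∀ (L : ℕ) (I : Finset V),
      E2 μ ((Q G b ^ L) (∑ x ∈ I, sg x)) ((Q G b ^ L) (∑ x ∈ I, sg x)) ≤ I.card * ((1 - β / 2) ^ (2 * L) / β) := by
  obtain ⟨u, lam, w, ho, he, hw, hp, hz⟩ := spec hc hr hβ hg hN
  have hs : ∀ x y, E2 μ (sg x) (sg y) = ∑ i, w i * (u i x * u i y) := fun x y => by
    rw [← hz]
    refine E2_single hμ (fun i j => ?_) (fun i j => ?_) x y
    · simp only [hz]; exact Finset.sum_congr rfl fun _ _ => by ring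
    · simp only [hz]
      rw [← Finset.sum_add_distrib]
      calc _ ≤ 2 * ∑ k, |w k * (u k i * u k j)| := by gcongr; exact Finset.abs_sum_le_sum_abs _ _
        _ ≤ _ := by
          rw [Finset.mul_sum]
          refine Finset.sum_le_sum fun k _ => ?_
          rw [abs_mul, abs_of_nonneg (hw k).1]
          have h1 : 2 * |u k i * u k j| ≤ u k i * u k i + u k j * u k j := by
            rw [abs_mul]; nlinarith [sq_nonneg (|u k i| - |u k j|), abs_mul_abs_self (u k i), abs_mul_abs_self (u k j)]
          nlinarith [(hw k).1]
  have hgen : ∀ c c', E2 μ c c' = ∑ i, w i * (lin c (u i) * lin c' (u i)) := by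
    have h1 : ∀ x c', E2 μ c' (sg x) = ∑ i, w i * (lin c' (u i) * u i x) := fun x c' => by
      induction c' using Finsupp.induction_linear with
      | zero => simp [E2, lin]
      | add f g hf hg => rw [E2_add hμ, hf, hg, ← Finset.sum_add_distrib]; simp only [lin_add]; exact Finset.sum_congr rfl fun _ _ => by ring
      | single z a =>
        have : Finsupp.single z a = a • sg z := by simp
        rw [this, E2_smul, hs, Finset.mul_sum]; simp only [lin_smul, lin_single]; exact Finset.sum_congr rfl fun _ _ => by ring
    intro c c'
    induction c using Finsupp.induction_linear with
    | zero => simp [E2, lin]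
    | add f g hf hg => rw [E2_add hμ, hf, hg, ← Finset.sum_add_distrib]; simp only [lin_add]; exact Finset.sum_congr rfl fun _ _ => by ring
    | single z a =>
      have : Finsupp.single z a = a • sg z := by simp
      rw [this, E2_smul, E2_comm, h1, Finset.mul_sum]; simp only [lin_smul, lin_single]; exact Finset.sum_congr rfl fun _ _ => by ring
  have hQ : ∀ i c, lin (Q G b c) (u i) = ((1 + lam i) / 2) * lin c (u i) := fun i c => by
    induction c using Finsupp.induction_linear with
    | zero => simp [lin]
    | add f g hf hg => rw [map_add, lin_add, hf, hg, lin_add]; ring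
    | single z a =>
      have : Finsupp.single z a = a • sg z := by simp
      rw [this, map_smul, lin_smul, lin_smul, Q_sg, lin_add, lin_smul, lin_smul, lin_sum]
      simp only [lin_single, one_mul]
      have := he i z
      have h2 : (1 / (2 * (b + 1)) : ℝ) * ∑ z ∈ nb G z, u i z = (1 / 2) * ((1 / (b + 1) : ℝ) * ∑ z ∈ nb G z, u i z) := by
        field_simp
      rw [h2, this]; ring
  have hQL : ∀ i c (L : ℕ), lin ((Q G b ^ L) c) (u i) = ((1 + lam i) / 2) ^ L * lin c (u i) := fun i c L => by
    induction L with
    | zero => simp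
    | succ n ih => rw [pow_succ', Module.End.mul_apply, hQ, ih]; ring
  refine ⟨fun x y => ?_, fun L I => ?_⟩
  · have h := hp x y
    rw [hgen]
    simp only [lin_sub, hQ, lin_single, one_mul]
    rw [Finsupp.single_apply, ← h, Finset.mul_sum]
    exact Finset.sum_congr rfl fun _ _ => by ring
  · rw [hgen]
    have h2 : ∑ i, lin (∑ x ∈ I, sg x) (u i) * lin (∑ x ∈ I, sg x) (u i) = I.card := by
      simp only [lin_sum, lin_single, one_mul, Finset.sum_mul_sum]
      rw [Finset.sum_comm]
      simp_rw [Finset.sum_comm (s := Finset.univ), ho]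
      simp
    rw [← h2, Finset.sum_mul]
    refine Finset.sum_le_sum fun i _ => ?_
    rw [hQL]
    by_cases h0 : w i = 0
    · rw [h0]
      have : 0 ≤ (1 - β / 2) ^ (2 * L) := by rw [pow_mul]; positivity
      have := mul_self_nonneg (lin (∑ x ∈ I, sg x) (u i))
      simp only [zero_mul]; positivity
    · obtain ⟨h3, h4, h5⟩ := (hw i).2 h0
      have e1 : ((1 + lam i) / 2) ^ (2 * L) ≤ (1 - β / 2) ^ (2 * L) := pow_le_pow_left₀ (by linarith) (by linarith) _
      have e2 : w i * ((1 + lam i) / 2) ^ (2 * L) ≤ 1 / β * (1 - β / 2) ^ (2 * L) :=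
        mul_le_mul h3 e1 (by rw [pow_mul]; positivity) (by positivity)
      have e3 := mul_self_nonneg (lin (∑ x ∈ I, sg x) (u i))
      calc _ = (w i * ((1 + lam i) / 2) ^ (2 * L)) * (lin (∑ x ∈ I, sg x) (u i) * lin (∑ x ∈ I, sg x) (u i)) := by
            rw [two_mul, pow_add]; ring
        _ ≤ (1 / β * (1 - β / 2) ^ (2 * L)) * (lin (∑ x ∈ I, sg x) (u i) * lin (∑ x ∈ I, sg x) (u i)) :=
            mul_le_mul_of_nonneg_right e2 e3
        _ = _ := by ring
end spectral
end GFF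

namespace GFF
section graph
variable {V : Type*} {G : SimpleGraph V} {b : ℕ}

lemma dist_adj_le (hc : G.Connected) {x y z : V} (h : G.Adj y z) : G.dist x z ≤ G.dist x y + 1 := by
  have := hc.dist_triangle (u := x) (v := y) (w := z)
  rwa [SimpleGraph.dist_eq_one_iff_adj.2 h] at this

lemma exists_closer (hc : G.Connected) {x y : V} (h : y ≠ x) : ∃ z, G.Adj y z ∧ G.dist x z + 1 = G.dist x y := by
  obtain ⟨p, hp⟩ := hc.exists_walk_length_eq_dist y x
  cases p with
  | nil => exact absurd rfl h
  | @cons _ z _ ha q =>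
    refine ⟨z, ha, ?_⟩
    rw [SimpleGraph.Walk.length_cons] at hp
    have h1 := SimpleGraph.dist_le q
    have h2 := dist_adj_le hc (x := x) ha.symm
    rw [SimpleGraph.dist_comm (u := x) (v := z), SimpleGraph.dist_comm (u := x) (v := y)] at *
    omega

lemma forest_path (hc : G.Connected) {F : SimpleGraph V} {x : V} {M : ℕ}
    (hF : ∀ y z, G.dist x y ≤ M → G.Adj y z → F.Adj y z) (n : ℕ) : ∀ y, G.dist x y = n → n ≤ M →
    ∃ p : F.Walk x y, p.IsPath ∧ p.length = n ∧ ∀ w ∈ p.support, w ≠ y → G.dist x w < n := by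
  induction n with
  | zero =>
    intro y hy _
    obtain rfl := (hc.dist_eq_zero_iff).1 hy
    exact ⟨.nil, by simp, rfl, by simp⟩
  | succ n ih =>
    intro y hy hM
    have hne : y ≠ x := by rintro rfl; simp at hy
    obtain ⟨z, hz, hd⟩ := exists_closer hc hne
    obtain ⟨p, h1, h2, h3⟩ := ih z (by omega) (by omega)
    have h4 : ∀ w ∈ p.support, G.dist x w < n + 1 := fun w hw => by
      by_cases e : w = z
      · subst e; omega
      · exact (h3 w hw e).trans (by omega)
    refine ⟨p.concat (hF y z (by omega) hz).symm, h1.concat (fun h => ?_) _, by simp [h2], fun w hw hne => ?_⟩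
    · have := h4 _ h; omega
    · rw [SimpleGraph.Walk.support_concat] at hw
      simp [hne] at hw
      exact h4 w hw

lemma LT_of_forest (hc : G.Connected) {F : SimpleGraph V} (ha : F.IsAcyclic) {x : V} {M : ℕ}
    (hF : ∀ y z, G.dist x y ≤ M → G.Adj y z → F.Adj y z) : LT G x M := by
  have key : ∀ y z, G.dist x y ≤ M → G.Adj y z → G.dist x z ≤ G.dist x y → ∃ p : F.Walk x z, ∃ h : F.Adj z y,
      (p.concat h).IsPath ∧ p.length = G.dist x z := fun y z hy hyz hz => by
    obtain ⟨p, h1, h2, h3⟩ := forest_path hc hF _ z rfl (hz.trans hy)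
    refine ⟨p, (hF y z hy hyz).symm, h1.concat (fun h => ?_) _, h2⟩
    have := h3 y h hyz.ne
    omega
  intro y hy
  refine ⟨fun z hz => ?_, fun hne => ?_⟩
  · have h1 := dist_adj_le hc (x := x) hz
    have h2 := dist_adj_le hc (x := x) hz.symm
    by_contra hcon
    have h3 : G.dist x z = G.dist x y := by omega
    obtain ⟨p, h, hp, hl⟩ := key y z hy hz h3.le
    obtain ⟨r, hr, hrl, -⟩ := forest_path hc hF _ y rfl hy
    have := congrArg (fun q : F.Path x y => q.1.length) (ha.path_unique ⟨_, hp⟩ ⟨_, hr⟩)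
    simp at this
    omega
  · obtain ⟨z, hz, hd⟩ := exists_closer hc hne
    refine ⟨z, ⟨hz, hd⟩, fun z' hz' => ?_⟩
    obtain ⟨p, h, hp, -⟩ := key y z hy hz (by omega)
    obtain ⟨p', h', hp', -⟩ := key y z' hy hz'.1 (by omega)
    have := congrArg (fun q : F.Path x y => q.1.penultimate) (ha.path_unique ⟨_, hp'⟩ ⟨_, hp⟩)
    simpa using this

lemma tree_LT (ht : G.Connected) (ha : G.IsAcyclic) (x : V) (M : ℕ) : LT G x M :=
  LT_of_forest ht ha fun _ _ _ h => h

lemma tree_away (hc : G.Connected) (ha : G.IsAcyclic) {o u : V} (n : ℕ) : ∀ p w, G.dist u w = n → G.Adj p w →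
    G.dist o w = G.dist o p + 1 → G.dist u p = G.dist u w + 1 → G.dist o u = G.dist o w + n := by
  induction n with
  | zero =>
    intro p w h _ _ _
    rw [hc.dist_eq_zero_iff] at h; subst h; simp
  | succ n ih =>
    intro p w hn hpw ho hu
    have hne : w ≠ u := by rintro rfl; simp at hn
    obtain ⟨w', hw, hd⟩ := exists_closer hc hne
    have hne' : w' ≠ p := by rintro rfl; omega
    obtain ⟨h1, h2⟩ := tree_LT hc ha o (G.dist o w) w le_rfl
    have hwo : w ≠ o := by rintro rfl; simp at ho
    have h3 : G.dist o w' = G.dist o w + 1 := by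
      refine (h1 w' hw).resolve_right fun h => hne' ?_
      exact (h2 hwo).unique ⟨hw, h⟩ ⟨hpw.symm, ho.symm⟩
    have := ih w w' (by omega) hw h3 (by omega)
    omega

lemma tree_dist_parent (hc : G.Connected) (ha : G.IsAcyclic) {o u p w : V} (hpw : G.Adj p w)
    (ho : G.dist o w = G.dist o p + 1) (hu : G.dist o u ≤ G.dist o w) (hne : u ≠ w) :
    G.dist u w = G.dist u p + 1 := by
  rcases (tree_LT hc ha u (G.dist u p) p le_rfl).1 w hpw with h | h
  · exact h
  · have := tree_away hc ha (o := o) _ p w rfl hpw ho h.symm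
    have := hc.pos_dist_of_ne hne
    omega

/-- parent towards the root -/
noncomputable def par (G : SimpleGraph V) (o w : V) : V :=
  if h : ∃ z, G.Adj w z ∧ G.dist o z + 1 = G.dist o w then h.choose else o

lemma par_root (hc : G.Connected) (o : V) : par G o o = o := by
  simp [par]

lemma par_spec (hc : G.Connected) {o w : V} (h : w ≠ o) : G.Adj w (par G o w) ∧ G.dist o (par G o w) + 1 = G.dist o w := by
  have := exists_closer hc h
  rw [par, dif_pos this]; exact this.choose_spec

lemma par_eq (hc : G.Connected) (ha : G.IsAcyclic) {o w z : V} (h : G.Adj w z) (hz : G.dist o z + 1 = G.dist o w) :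
    par G o w = z := by
  have hne : w ≠ o := by rintro rfl; simp at hz
  exact ((tree_LT hc ha o _ w le_rfl).2 hne).unique (par_spec hc hne) ⟨h, hz⟩

noncomputable def ch (G : SimpleGraph V) (o v : V) : Finset V := (nb G v).filter fun z => G.dist o z = G.dist o v + 1
noncomputable def Sph (G : SimpleGraph V) (o : V) : ℕ → Finset V
  | 0 => {o}
  | (k + 1) => (Sph G o k).biUnion (ch G o)

lemma mem_ch (hr : IsReg G (b + 1)) {o v w : V} : w ∈ ch G o v ↔ G.Adj v w ∧ G.dist o w = G.dist o v + 1 := by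
  simp [ch, mem_nb hr]

lemma mem_ch' (hc : G.Connected) (ha : G.IsAcyclic) (hr : IsReg G (b + 1)) {o v w : V} :
    w ∈ ch G o v ↔ w ≠ o ∧ par G o w = v := by
  rw [mem_ch hr]
  refine ⟨fun ⟨h, h2⟩ => ⟨by rintro rfl; simp at h2, par_eq hc ha h.symm h2.symm⟩, ?_⟩
  rintro ⟨h1, rfl⟩
  have := par_spec hc h1
  exact ⟨this.1.symm, this.2.symm⟩

lemma mem_Sph (hc : G.Connected) (hr : IsReg G (b + 1)) (o : V) (k : ℕ) : ∀ w, w ∈ Sph G o k ↔ G.dist o w = k := by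
  induction k with
  | zero => intro w; simp [Sph, hc.dist_eq_zero_iff, eq_comm]
  | succ k ih =>
    intro w
    simp only [Sph, Finset.mem_biUnion, mem_ch hr, ih]
    constructor
    · rintro ⟨v, h1, h2, h3⟩; omega
    · intro h
      have hne : w ≠ o := by rintro rfl; simp at h
      have := par_spec hc hne
      exact ⟨_, by omega, this.1.symm, by omega⟩

lemma card_ch (hc : G.Connected) (ha : G.IsAcyclic) (hr : IsReg G (b + 1)) (o v : V) :
    b ≤ (ch G o v).card ∧ (ch G o v).card ≤ b + 1 := by
  refine ⟨?_, (Finset.card_filter_le _ _).trans (card_nb hr v).le⟩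
  have h : nb G v ⊆ insert (par G o v) (ch G o v) := fun z hz => by
    rw [mem_nb hr] at hz
    rw [Finset.mem_insert, mem_ch hr]
    rcases (tree_LT hc ha o _ v le_rfl).1 z hz with h | h
    · exact Or.inr ⟨hz, h⟩
    · exact Or.inl (par_eq hc ha hz h).symm
  have := (Finset.card_le_card h).trans (Finset.card_insert_le _ _)
  rw [card_nb hr] at this; omega

lemma card_Sph (hc : G.Connected) (ha : G.IsAcyclic) (hr : IsReg G (b + 1)) (o : V) (k : ℕ) :
    (Sph G o k).card ≤ (b + 1) ^ k := by
  induction k with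
  | zero => simp [Sph]
  | succ k ih =>
    rw [Sph, pow_succ]
    exact Finset.card_biUnion_le_card_mul _ _ _ (fun v _ => (card_ch hc ha hr o v).2) |>.trans (Nat.mul_le_mul_right _ ih)

lemma Sph_nonempty (hc : G.Connected) (ha : G.IsAcyclic) (hr : IsReg G (b + 1)) (hb : 1 ≤ b) (o : V) (k : ℕ) :
    (Sph G o k).Nonempty := by
  induction k with
  | zero => simp [Sph]
  | succ k ih =>
    obtain ⟨v, hv⟩ := ih
    obtain ⟨w, hw⟩ := Finset.card_pos.1 (lt_of_lt_of_le (by omega) (card_ch hc ha hr o v).1)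
    exact ⟨w, Finset.mem_biUnion.2 ⟨v, hv, hw⟩⟩

end graph
end GFF

namespace GFF
section indep
variable {I : Type*} {μ : Measure (I → ℝ)} {K : I → I → ℝ}

lemma lin_indep_blocks (hμ : IsGaussianField μ K) {ι : Type*} [Fintype ι] {κ : ι → Type*} [∀ i, Fintype (κ i)]
    (c : ∀ i, κ i → I →₀ ℝ) (h : ∀ i j, i ≠ j → ∀ k l, E2 μ (c i k) (c j l) = 0) :
    iIndepFun (fun i ω k => lin (c i k) ω) μ := by
  have := hμ.1
  have h1 := lin_gauss hμ (fun s : Σ i, κ i => c s.1 s.2)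
  have h2 := h1.map_fun (ContinuousLinearMap.pi fun i => ContinuousLinearMap.pi fun k : κ i =>
    ContinuousLinearMap.proj (R := ℝ) (φ := fun _ : Σ i, κ i => ℝ) ⟨i, k⟩)
  exact HasGaussianLaw.iIndepFun_of_covariance_eval (X := fun i k ω => lin (c i k) ω) h2
    fun i j hij k l => by rw [lin_cov hμ]; exact h i j hij k l

lemma lin_indep_two (hμ : IsGaussianField μ K) {A B : Type*} [Fintype A] [Fintype B]
    (c : A → I →₀ ℝ) (c' : B → I →₀ ℝ) (h : ∀ k l, E2 μ (c k) (c' l) = 0) :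
    IndepFun (fun ω k => lin (c k) ω) (fun ω k => lin (c' k) ω) μ := by
  have := hμ.1
  have h1 := lin_gauss hμ (Sum.elim c c')
  have h2 := h1.map_fun ((ContinuousLinearMap.pi fun k : A =>
    ContinuousLinearMap.proj (R := ℝ) (φ := fun _ : A ⊕ B => ℝ) (Sum.inl k)).prod (ContinuousLinearMap.pi fun k : B =>
    ContinuousLinearMap.proj (R := ℝ) (φ := fun _ : A ⊕ B => ℝ) (Sum.inr k)))
  exact HasGaussianLaw.indepFun_of_covariance_eval (X := fun k ω => lin (c k) ω) (Y := fun k ω => lin (c' k) ω) h2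
    fun i j => by rw [lin_cov hμ]; exact h i j
end indep

section tree
variable {T : Type*} {G : SimpleGraph T} {b : ℕ} {μ : Measure (T → ℝ)}

noncomputable def gg (b n : ℕ) : ℝ := (b / (b - 1) : ℝ) * ((b : ℝ)⁻¹) ^ n

lemma tree_E2 (hb : 2 ≤ b) (hμ : IsGaussianField μ (treeGreen G (b + 1))) (x y : T) :
    E2 μ (sg x) (sg y) = gg b (G.dist x y) := by
  have e : ∀ x y, treeGreen G (b + 1) x y = gg b (G.dist x y) := fun x y => by
    simp [treeGreen, gg]; left; congr 1; ring
  have hb' : (2 : ℝ) ≤ b := by exact_mod_cast hb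
  have h1 : (0 : ℝ) < b / (b - 1) := div_pos (by linarith) (by linarith)
  rw [← e]
  refine E2_single hμ (fun i j => ?_) (fun i j => ?_) x y
  · simp only [e, G.dist_comm]
  · simp only [e, SimpleGraph.dist_self]
    have : gg b (G.dist i j) ≤ gg b 0 := by
      simp only [gg, pow_zero]
      refine mul_le_mul_of_nonneg_left (pow_le_one₀ (by positivity) ?_) h1.le
      rw [inv_le_one_iff₀]; right; linarith
    have h0 : 0 ≤ gg b (G.dist i j) := by unfold gg; positivity
    rw [abs_of_nonneg h0]; linarith

lemma qr_gg (hb : 2 ≤ b) (n : ℕ) : gg b n - qr b (gg b) n = 1 / 2 * del0 n := by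
  have hb' : (2 : ℝ) ≤ b := by exact_mod_cast hb
  have h1 : (b : ℝ) - 1 ≠ 0 := by linarith
  have h2 : (b : ℝ) ≠ 0 := by linarith
  have h3 : (b : ℝ) + 1 ≠ 0 := by linarith
  cases n with
  | zero => simp [gg, qr, del0]; field_simp; ring
  | succ n => simp [gg, qr, del0, pow_succ]; field_simp; ring

lemma tree_QE (hb : 2 ≤ b) (hc : G.Connected) (ha : G.IsAcyclic) (hr : IsReg G (b + 1))
    (hμ : IsGaussianField μ (treeGreen G (b + 1))) (k : ℕ) :
    ∀ x y, E2 μ ((Q G b ^ k) (sg x)) (sg y) = (qr b)^[k] (gg b) (G.dist y x) := by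
  induction k with
  | zero => intro x y; simp [tree_E2 hb hμ, G.dist_comm]
  | succ k ih =>
    intro x y
    rw [pow_succ, Module.End.mul_apply, Q_sg, map_add, map_smul, map_smul, map_sum, E2_add hμ, E2_smul, E2_smul, E2_sum hμ,
      Function.iterate_succ_apply', ← LT_step hc hr (tree_LT hc ha y _) le_rfl]
    simp only [ih]

lemma tree_harm (hb : 2 ≤ b) (hc : G.Connected) (ha : G.IsAcyclic) (hr : IsReg G (b + 1))
    (hμ : IsGaussianField μ (treeGreen G (b + 1))) : Harm μ G b 0 := by
  intro x y
  have := tree_QE hb hc ha hr hμ 1 x y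
  rw [pow_one] at this
  rw [E2_sub hμ, this, tree_E2 hb hμ, Function.iterate_one, G.dist_comm, qr_gg hb]
  simp only [del0, hc.dist_eq_zero_iff, Finsupp.single_apply, eq_comm, sub_zero]

noncomputable def thet (b : ℕ) : ℝ := (1 + 2 * √(b : ℝ) / (b + 1)) / 2

lemma thet_lt (hb : 2 ≤ b) : 0 < thet b ∧ thet b < 1 := by
  have hb' : (2 : ℝ) ≤ b := by exact_mod_cast hb
  have h1 : (√(b : ℝ)) ^ 2 = b := Real.sq_sqrt (by positivity)
  have h2 : 1 < √(b : ℝ) := by rw [Real.lt_sqrt] <;> linarith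
  refine ⟨by unfold thet; positivity, ?_⟩
  have : 2 * √(b : ℝ) / (b + 1) < 1 := by rw [div_lt_one (by positivity)]; nlinarith
  unfold thet; linarith

lemma qr_bound (hb : 2 ≤ b) (k : ℕ) : ∀ n, (qr b)^[k] (gg b) n ≤ (b / (b - 1) : ℝ) * thet b ^ k * ((√(b : ℝ))⁻¹) ^ n := by
  have hb' : (2 : ℝ) ≤ b := by exact_mod_cast hb
  set s := √(b : ℝ) with hs
  have h1 : s ^ 2 = b := Real.sq_sqrt (by positivity)
  have h2 : 1 < s := by rw [hs, Real.lt_sqrt] <;> linarith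
  have hp : (0 : ℝ) < b / (b - 1) := div_pos (by linarith) (by linarith)
  have ht := (thet_lt hb).1
  induction k with
  | zero =>
    intro n
    simp only [Function.iterate_zero, id, pow_zero, mul_one, gg]
    refine mul_le_mul_of_nonneg_left (pow_le_pow_left₀ (by positivity) ?_ _) hp.le
    exact inv_anti₀ (by linarith) (by nlinarith)
  | succ k ih =>
    intro n
    rw [Function.iterate_succ_apply']
    set f := (qr b)^[k] (gg b)
    set C := (b / (b - 1) : ℝ) * thet b ^ k with hC
    have hCp : 0 < C := by positivity
    have e : (b / (b - 1) : ℝ) * thet b ^ (k + 1) = C * thet b := by rw [hC, pow_succ]; ring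
    rw [e]
    have e2 : thet b = (1 + 2 * s / (s ^ 2 + 1)) / 2 := by rw [thet, h1]
    cases n with
    | zero =>
      have i0 := ih 0
      have i1 := ih 1
      simp only [qr, pow_zero, pow_one, mul_one] at *
      have : s⁻¹ ≤ 2 * s / (s ^ 2 + 1) := by
        rw [inv_eq_one_div, div_le_div_iff₀ (by linarith) (by positivity)]; nlinarith
      rw [e2]
      nlinarith
    | succ n =>
      have i0 := ih n
      have i1 := ih (n + 1)
      have i2 := ih (n + 2)
      simp only [qr]
      calc _ ≤ (C * s⁻¹ ^ (n + 1)) / 2 + (C * s⁻¹ ^ n) / (2 * (b + 1)) + b * (C * s⁻¹ ^ (n + 2)) / (2 * (b + 1)) := by gcongr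
        _ = _ := by
          rw [e2, ← h1]
          have : s ≠ 0 := by linarith
          have : s ^ 2 + 1 ≠ 0 := by positivity
          simp only [pow_succ]
          field_simp
          ring

lemma tree_QL_var (hb : 2 ≤ b) (hc : G.Connected) (ha : G.IsAcyclic) (hr : IsReg G (b + 1))
    (hμ : IsGaussianField μ (treeGreen G (b + 1))) (L : ℕ) (x : T) :
    E2 μ ((Q G b ^ L) (sg x)) ((Q G b ^ L) (sg x)) ≤ (b / (b - 1) : ℝ) * thet b ^ (2 * L) := by
  rw [harm_adj_pow hμ (tree_harm hb hc ha hr hμ), E2_comm, ← Module.End.mul_apply, ← pow_add, tree_QE hb hc ha hr hμ]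
  have := qr_bound hb (L + L) (G.dist x x)
  rw [two_mul]
  simpa using this

noncomputable def xi (G : SimpleGraph T) (b : ℕ) (o w : T) : T →₀ ℝ := sg w - (1 / b : ℝ) • sg (par G o w)

lemma gg_succ (hb : 2 ≤ b) (n : ℕ) : gg b (n + 1) = 1 / b * gg b n := by
  simp [gg, pow_succ]; ring

lemma xi_orth (hb : 2 ≤ b) (hc : G.Connected) (ha : G.IsAcyclic)
    (hμ : IsGaussianField μ (treeGreen G (b + 1))) {o w u : T} (hw : w ≠ o) (hu : G.dist o u ≤ G.dist o w) (hne : u ≠ w) :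
    E2 μ (xi G b o w) (sg u) = 0 := by
  have hp := par_spec hc hw
  rw [xi, E2_sub hμ, E2_smul, tree_E2 hb hμ, tree_E2 hb hμ, G.dist_comm, tree_dist_parent hc ha hp.1.symm hp.2.symm hu hne, gg_succ hb,
    G.dist_comm, sub_self]

lemma xi_var (hb : 2 ≤ b) (hc : G.Connected) (ha : G.IsAcyclic)
    (hμ : IsGaussianField μ (treeGreen G (b + 1))) {o w : T} (hw : w ≠ o) :
    E2 μ (xi G b o w) (xi G b o w) = (gv b : ℝ) := by
  have hp := par_spec hc hw
  have hb' : (2 : ℝ) ≤ b := by exact_mod_cast hb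
  have h1 : (b : ℝ) - 1 ≠ 0 := by linarith
  have h2 : (b : ℝ) ≠ 0 := by linarith
  nth_rw 2 [xi]
  rw [E2_comm, E2_sub hμ, E2_smul, E2_comm _ (xi G b o w), E2_comm _ (xi G b o w),
    xi_orth hb hc ha hμ hw (by omega) hp.1.ne', xi, E2_sub hμ, E2_smul, tree_E2 hb hμ, tree_E2 hb hμ,
    SimpleGraph.dist_self, SimpleGraph.dist_eq_one_iff_adj.2 hp.1.symm]
  simp [gg, gv]
  field_simp
  ring

lemma xi_orth2 (hb : 2 ≤ b) (hc : G.Connected) (ha : G.IsAcyclic)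
    (hμ : IsGaussianField μ (treeGreen G (b + 1))) {o w u : T} (hw : w ≠ o) (hu : G.dist o u = G.dist o w) (hne : u ≠ w) :
    E2 μ (xi G b o w) (xi G b o u) = 0 := by
  have hu0 : u ≠ o := by
    rintro rfl
    rw [SimpleGraph.dist_self, eq_comm, hc.dist_eq_zero_iff] at hu
    exact hne hu
  have hp := par_spec hc hu0
  nth_rw 2 [xi]
  rw [E2_comm, E2_sub hμ, E2_smul, E2_comm _ (xi G b o w), E2_comm _ (xi G b o w),
    xi_orth hb hc ha hμ hw hu.le hne, xi_orth hb hc ha hμ hw (by omega) (by rintro h; rw [h] at hp; omega)]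
  simp

/-- resampling one generation -/
lemma resample (hb : 2 ≤ b) (hc : G.Connected) (ha : G.IsAcyclic) (hr : IsReg G (b + 1))
    (hμ : IsGaussianField μ (treeGreen G (b + 1))) (o : T) (k : ℕ) (W : Finset T) (hW : ∀ w ∈ W, G.dist o w = k + 1)
    (f : T → (T → ℝ) → ℝ → ℝ) (B : ℝ) (hB : ∀ w ω y, |f w ω y| ≤ B) (hB0 : 0 ≤ B)
    (hf : ∀ w, Measurable (fun p : (T → ℝ) × ℝ => f w p.1 p.2))
    (hdep : ∀ w ∈ W, ∀ ω ω' : T → ℝ, (∀ u, G.dist o u ≤ k → ω u = ω' u) → f w ω = f w ω') :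
    ∫ ω, ∏ w ∈ W, f w ω (ω w) ∂μ = ∫ ω, ∏ w ∈ W, (∫ y, f w ω (ω (par G o w) / b + y) ∂gam b) ∂μ := by
  have := hμ.1
  set A : Finset T := (Finset.range (k + 1)).biUnion (Sph G o) with hA
  have hmem : ∀ u, u ∈ A ↔ G.dist o u ≤ k := fun u => by
    simp [hA, mem_Sph hc hr]
  have hw0 : ∀ w ∈ W, w ≠ o := fun w hw => by rintro rfl; have := hW _ hw; simp at this
  have hpar : ∀ w ∈ W, par G o w ∈ A := fun w hw => by
    have := par_spec hc (hw0 w hw); have := hW w hw; rw [hmem]; omega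
  let ext : (A → ℝ) → T → ℝ := fun a u => if h : u ∈ A then a ⟨u, h⟩ else 0
  have hext : Measurable ext := by
    refine measurable_pi_lambda _ fun u => ?_
    by_cases h : u ∈ A <;> simp [ext, h] <;> fun_prop
  let X : (T → ℝ) → A → ℝ := fun ω a => lin (sg a.1) ω
  let Y : (T → ℝ) → W → ℝ := fun ω w => lin (xi G b o w.1) ω
  have hXm : Measurable X := measurable_pi_lambda _ fun a => lin_meas _
  have hYm : Measurable Y := measurable_pi_lambda _ fun a => lin_meas _
  have hXv : ∀ ω (a : A), X ω a = ω a := fun ω a => by simp [X, lin_single]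
  have hXY : IndepFun X Y μ := lin_indep_two hμ _ _ fun a w => by
    rw [E2_comm]
    have h1 := (hmem a).1 a.2
    have h2 := hW w w.2
    refine xi_orth hb hc ha hμ (hw0 w w.2) (by omega) ?_
    intro h; rw [h] at h1; omega
  have hYi : iIndepFun (fun (w : W) ω => Y ω w) μ := by
    have h := lin_indep_blocks hμ (κ := fun _ : W => Unit) (fun w _ => xi G b o w.1) (fun w w' hne _ _ => by
      refine xi_orth2 hb hc ha hμ (hw0 w w.2) (by rw [hW w w.2, hW w' w'.2]) ?_
      intro h; exact hne (Subtype.ext h.symm))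
    exact h.comp (fun _ a => a ()) (fun _ => measurable_pi_apply _)
  have hYlaw : μ.map Y = Measure.pi (fun _ : W => gam b) := by
    rw [(iIndepFun_iff_map_fun_eq_pi_map (fun w => (lin_meas _).aemeasurable)).1 hYi]
    congr 1; ext1 w
    change μ.map (lin _) = _
    rw [lin_law' hμ, xi_var hb hc ha hμ (hw0 w w.2)]; simp
  have hlaw : μ.map (fun ω => (X ω, Y ω)) = (μ.map X).prod (Measure.pi (fun _ : W => gam b)) := by
    rw [(indepFun_iff_map_prod_eq_prod_map_map hXm.aemeasurable hYm.aemeasurable).1 hXY, hYlaw]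
  have hfe : ∀ w ∈ W, ∀ ω, f w ω = f w (ext (X ω)) := fun w hw ω => hdep w hw _ _ fun u hu => by
    simp only [ext, dif_pos ((hmem u).2 hu)]; exact (hXv ω ⟨u, _⟩).symm
  let H : (A → ℝ) × (W → ℝ) → ℝ := fun p => ∏ w : W, f w (ext p.1) (ext p.1 (par G o w) / b + p.2 w)
  have hHm : Measurable H := by
    refine Finset.measurable_prod _ fun w _ => (hf w).comp (Measurable.prodMk (hext.comp measurable_fst) ?_)
    refine Measurable.add (Measurable.div_const ((measurable_pi_apply _).comp (hext.comp measurable_fst)) _) ?_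
    exact (measurable_pi_apply _).comp measurable_snd
  have hHb : ∀ p, ‖H p‖ ≤ B ^ W.card := fun p => by
    rw [Real.norm_eq_abs, Finset.abs_prod]
    calc _ ≤ ∏ w : W, B := Finset.prod_le_prod (fun _ _ => abs_nonneg _) fun w _ => hB _ _ _
      _ = _ := by simp
  have hextp : ∀ ω w, w ∈ W → ext (X ω) (par G o w) = ω (par G o w) := fun ω w hw => by
    simp only [ext, dif_pos (hpar w hw)]; exact hXv ω ⟨_, _⟩
  have hb0 : (b : ℝ) ≠ 0 := by positivity
  have e1 : ∀ ω, ∏ w ∈ W, f w ω (ω w) = H (X ω, Y ω) := fun ω => by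
    rw [← Finset.prod_coe_sort]
    refine Finset.prod_congr rfl fun w _ => ?_
    simp only [hextp ω w w.2, hfe w w.2 ω]
    congr 1
    simp only [Y, xi, lin_sub, lin_smul, lin_single]; field_simp; ring
  have e2 : ∀ ω, ∏ w ∈ W, (∫ y, f w ω (ω (par G o w) / b + y) ∂gam b) = ∫ y, H (X ω, y) ∂(Measure.pi (fun _ : W => gam b)) := fun ω => by
    rw [← Finset.prod_coe_sort]
    rw [integral_fintype_prod_eq_prod (fun (w : W) (y : ℝ) => f w (ext (X ω)) (ext (X ω) (par G o w) / b + y))]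
    refine Finset.prod_congr rfl fun w _ => ?_
    simp only [hextp ω w w.2, hfe w w.2 ω]
  simp only [e1, e2]
  rw [← integral_map (φ := fun ω => (X ω, Y ω)) (hXm.prodMk hYm).aemeasurable hHm.aestronglyMeasurable, hlaw]
  have hprob : IsProbabilityMeasure (μ.map X) := Measure.isProbabilityMeasure_map hXm.aemeasurable
  rw [integral_prod _ (Integrable.of_bound hHm.aestronglyMeasurable _ (Eventually.of_forall hHb))]
  rw [integral_map hXm.aemeasurable]
  exact (hHm.stronglyMeasurable.integral_prod_right' (ν := Measure.pi (fun _ : W => gam b))).aestronglyMeasurable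
end tree
end GFF

namespace GFF
section tree
variable {T : Type*} {G : SimpleGraph T} {b : ℕ} {μ : Measure (T → ℝ)}

def An (G : SimpleGraph T) (o : T) (h : ℝ) (ω : T → ℝ) (w : T) : Prop := ∀ j, h ≤ ω ((par G o)^[j] w)

lemma An_step (o : T) (h : ℝ) (ω : T → ℝ) (w : T) : An G o h ω w ↔ h ≤ ω w ∧ An G o h ω (par G o w) := by
  refine ⟨fun H => ⟨H 0, fun j => H (j + 1)⟩, fun ⟨h0, H⟩ j => ?_⟩
  cases j with
  | zero => exact h0
  | succ j => exact H j

lemma iter_o (hc : G.Connected) (o : T) (j : ℕ) : (par G o)^[j] o = o := by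
  induction j with
  | zero => rfl
  | succ j ih => rw [Function.iterate_succ_apply, par_root hc, ih]

lemma An_o (hc : G.Connected) (o : T) (h : ℝ) (ω : T → ℝ) : An G o h ω o ↔ h ≤ ω o := by
  simp [An, iter_o hc]

lemma dist_par (hc : G.Connected) (o w : T) : G.dist o (par G o w) = G.dist o w - 1 := by
  by_cases h : w = o
  · subst h; rw [par_root hc]; simp
  · have := par_spec hc h; omega

lemma dist_iter (hc : G.Connected) (o : T) (j : ℕ) : ∀ w, G.dist o ((par G o)^[j] w) = G.dist o w - j := by
  induction j with
  | zero => intro w; simp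
  | succ j ih => intro w; rw [Function.iterate_succ_apply, ih, dist_par hc]; omega

lemma An_meas (o : T) (h : ℝ) (w : T) : MeasurableSet {ω : T → ℝ | An G o h ω w} := by
  simp only [An, Set.ofPred_forall]
  exact MeasurableSet.iInter fun j => measurableSet_le measurable_const (measurable_pi_apply _)

lemma An_dep (hc : G.Connected) (o : T) (h : ℝ) (w : T) {k : ℕ} (hk : G.dist o w ≤ k) {ω ω' : T → ℝ}
    (he : ∀ u, G.dist o u ≤ k → ω u = ω' u) : An G o h ω w ↔ An G o h ω' w := by
  simp only [An]
  refine forall_congr' fun j => ?_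
  rw [he _ (by rw [dist_iter hc]; omega)]

lemma An_comp (hc : G.Connected) (o : T) (h : ℝ) (ω : T → ℝ) (k : ℕ) : ∀ w, G.dist o w = k → An G o h ω w →
    w ∈ levelComp G h ω o := by
  induction k with
  | zero =>
    intro w hw hA
    obtain rfl := (hc.dist_eq_zero_iff).1 hw
    exact ⟨.nil, by simpa using hA 0⟩
  | succ k ih =>
    intro w hw hA
    have hne : w ≠ o := by rintro rfl; simp at hw
    have hp := par_spec hc hne
    obtain ⟨h0, h1⟩ := (An_step o h ω w).1 hA
    obtain ⟨p, hp2⟩ := ih _ (by omega) h1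
    refine ⟨p.concat hp.1.symm, fun v hv => ?_⟩
    rw [SimpleGraph.Walk.support_concat] at hv
    simp at hv
    rcases hv with hv | rfl
    · exact hp2 v hv
    · exact h0

lemma comp_An (hc : G.Connected) (ha : G.IsAcyclic) (o : T) (h : ℝ) (ω : T → ℝ) {w : T} (hw : w ∈ levelComp G h ω o) :
    An G o h ω w := by
  obtain ⟨p, hp⟩ := hw
  have key : ∀ {u v : T} (p : G.Walk u v), An G o h ω u → (∀ x ∈ p.support, h ≤ ω x) → An G o h ω v := by
    intro u v p
    induction p with
    | nil => intro h _; exact h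
    | @cons u u' v hadj q ih =>
      intro hu hs
      refine ih ?_ fun x hx => hs x (by simp [hx])
      rcases (tree_LT hc ha o _ u le_rfl).1 u' hadj with h1 | h1
      · rw [An_step, par_eq hc ha hadj.symm h1.symm]
        exact ⟨hs u' (by simp), hu⟩
      · rw [← par_eq hc ha hadj h1]; exact ((An_step o h ω u).1 hu).2
  exact key p ((An_o hc o h ω).2 (hp o (by simp))) hp

lemma gauss_pos {v : ℝ≥0} (hv : v ≠ 0) (x : ℝ) : 0 < (gaussianReal 0 v).real (Ici x) := by
  rw [measureReal_def, ENNReal.toReal_pos_iff]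
  refine ⟨pos_iff_ne_zero.2 fun h => ?_, measure_lt_top _ _⟩
  have := gaussianReal_absolutelyContinuous' 0 hv h
  simp at this

lemma phi_law (hb : 2 ≤ b) (hμ : IsGaussianField μ (treeGreen G (b + 1))) (o : T) :
    μ.map (fun ω => ω o) = gaussianReal 0 (b / (b - 1) : ℝ).toNNReal := by
  have := lin_law' hμ (sg o)
  rw [tree_E2 hb hμ] at this
  convert this using 2
  · ext ω; simp [lin_single]
  · simp [gg]

/-- survival -/
lemma survive (hb : 2 ≤ b) (hc : G.Connected) (ha : G.IsAcyclic) (hr : IsReg G (b + 1))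
    (hμ : IsGaussianField μ (treeGreen G (b + 1))) (o : T) {h : ℝ} {R : ℕ} (hM : 1 < mm b h R h) :
    μ {ω | (levelComp G h ω o).Infinite} ≠ 0 := by
  have := hμ.1
  obtain ⟨g, c, hc0, gm, g0, g1, glow, gup, hU⟩ := mm_survive hb hM
  have hb' : (2 : ℝ) ≤ b := by exact_mod_cast hb
  set F : T → (T → ℝ) → ℝ := fun v ω => if An G o h ω v then g (ω v) else 1 with hF
  have F0 : ∀ v ω, 0 ≤ F v ω := fun v ω => by simp only [hF]; split_ifs <;> first | exact g0 _ | norm_num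
  have F1 : ∀ v ω, F v ω ≤ 1 := fun v ω => by simp only [hF]; split_ifs <;> first | exact g1 _ | norm_num
  have Fm : ∀ v, Measurable (F v) := fun v =>
    Measurable.ite (An_meas o h v) (gm.comp (measurable_pi_apply _)) measurable_const
  set Nk : ℕ → (T → ℝ) → ℝ := fun k ω => ∏ v ∈ Sph G o k, F v ω with hNk
  have N0 : ∀ k ω, 0 ≤ Nk k ω := fun k ω => Finset.prod_nonneg fun v _ => F0 v ω
  have N1 : ∀ k ω, Nk k ω ≤ 1 := fun k ω => Finset.prod_le_one (fun v _ => F0 v ω) fun v _ => F1 v ω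
  have Nm : ∀ k, Measurable (Nk k) := fun k => Finset.measurable_prod _ fun v _ => Fm v
  have hN : ∀ k, ∫ ω, Nk (k + 1) ω ∂μ ≤ ∫ ω, Nk k ω ∂μ := fun k => by
    set f : T → (T → ℝ) → ℝ → ℝ := fun w ω y => if An G o h ω (par G o w) then g y else 1 with hf
    have e1 : ∀ ω, Nk (k + 1) ω = ∏ w ∈ Sph G o (k + 1), f w ω (ω w) := fun ω => by
      refine Finset.prod_congr rfl fun w _ => ?_
      simp only [hF, hf]
      by_cases h1 : An G o h ω (par G o w)
      · by_cases h2 : h ≤ ω w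
        · simp [An_step o h ω w, h1, h2]
        · simp [An_step o h ω w, h1, h2, glow _ (not_le.1 h2)]
      · simp [An_step o h ω w, h1]
    simp only [e1]
    rw [resample hb hc ha hr hμ o k _ (fun w hw => (mem_Sph hc hr o _ w).1 hw) f 1 (fun w ω y => ?_) zero_le_one
      (fun w => ?_) (fun w hw ω ω' he => ?_)]
    · refine integral_mono_of_nonneg (Eventually.of_forall fun ω => ?_) (integrable_bdd (Nm k) (N0 k) (N1 k)) (Eventually.of_forall fun ω => ?_)
      · refine Finset.prod_nonneg fun w _ => integral_nonneg fun y => ?_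
        simp only [hf, Pi.zero_apply]; split_ifs <;> first | exact g0 _ | norm_num
      · simp only [Sph]
        rw [Finset.prod_biUnion (fun v _ v' _ hne => ?_)]
        · refine Finset.prod_le_prod (fun v _ => Finset.prod_nonneg fun w _ => integral_nonneg fun y => ?_) fun v _ => ?_
          · simp only [hf, Pi.zero_apply]; split_ifs <;> first | exact g0 _ | norm_num
          · rw [Finset.prod_congr rfl (g := fun _ => if An G o h ω v then ∫ y, g (ω v / b + y) ∂gam b else 1)
              (fun w hw => ?_)]
            · simp only [Finset.prod_const, hF]
              by_cases hA : An G o h ω v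
              · simp only [hA, if_true]
                have i0 : 0 ≤ ∫ y, g (ω v / b + y) ∂gam b := integral_nonneg fun y => g0 _
                have i1 : ∫ y, g (ω v / b + y) ∂gam b ≤ 1 := by
                  calc _ ≤ ∫ y, (1 : ℝ) ∂gam b := integral_mono (integrable_bdd (gm.comp (by fun_prop)) (fun y => g0 _) (fun y => g1 _))
                        (integrable_const _) fun y => g1 _
                    _ = 1 := by simp
                exact (pow_le_pow_of_le_one i0 i1 (card_ch hc ha hr o v).1).trans (hU _ (hA 0))
              · simp [hA]
            · have := ((mem_ch' hc ha hr).1 hw).2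
              simp only [hf, this]
              split_ifs <;> simp
        · refine Finset.disjoint_left.2 fun w hw hw' => hne ?_
          rw [← ((mem_ch' hc ha hr).1 hw).2, ← ((mem_ch' hc ha hr).1 hw').2]
    · simp only [hf]; split_ifs
      · rw [abs_of_nonneg (g0 _)]; exact g1 _
      · simp
    · exact Measurable.ite (measurable_fst (An_meas o h _)) (gm.comp measurable_snd) measurable_const
    · have hw' := (mem_Sph hc hr o _ w).1 hw
      ext y
      simp only [hf, An_dep hc o h (par G o w) (k := k) (by rw [dist_par hc]; omega) he]
  set P := (gaussianReal 0 (b / (b - 1) : ℝ).toNNReal).real (Ici h) with hP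
  have hσ : (0 : ℝ) < b / (b - 1) := div_pos (by linarith) (by linarith)
  have hPp : 0 < P := gauss_pos (by simpa using hσ) h
  have hPe : μ.real {ω | h ≤ ω o} = P := by
    rw [hP, ← phi_law hb hμ o, map_measureReal_apply (measurable_pi_apply o) measurableSet_Ici]; rfl
  have hN0 : ∫ ω, Nk 0 ω ∂μ ≤ 1 - c * P := by
    have hm : MeasurableSet {ω : T → ℝ | h ≤ ω o} := measurableSet_le measurable_const (measurable_pi_apply _)
    calc _ ≤ ∫ ω, (1 - c * ({ω | h ≤ ω o}.indicator (fun _ => (1 : ℝ)) ω)) ∂μ := by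
          refine integral_mono (integrable_bdd (Nm 0) (N0 0) (N1 0)) ((integrable_const _).sub (((integrable_const (1 : ℝ)).indicator hm).const_mul c)) fun ω => ?_
          simp only [hNk, Sph, Finset.prod_singleton, hF, An_o hc]
          by_cases h1 : h ≤ ω o
          · simpa [h1, Set.indicator] using gup _ h1
          · simp [h1, Set.indicator]
      _ = 1 - c * P := by
          rw [integral_sub (integrable_const _) (((integrable_const (1 : ℝ)).indicator hm).const_mul c), integral_const_mul, integral_indicator hm]
          simp [hPe]
  have hNk' : ∀ k, ∫ ω, Nk k ω ∂μ ≤ 1 - c * P := fun k => by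
    induction k with
    | zero => exact hN0
    | succ k ih => exact (hN k).trans ih
  set E : ℕ → Set (T → ℝ) := fun k => ⋃ v ∈ Sph G o k, {ω | An G o h ω v} with hE
  have Em : ∀ k, MeasurableSet (E k) := fun k => Finset.measurableSet_biUnion _ fun v _ => An_meas o h v
  have hEP : ∀ k, c * P ≤ μ.real (E k) := fun k => by
    have h1 : μ.real (E k)ᶜ ≤ ∫ ω, Nk k ω ∂μ := by
      rw [← integral_indicator_one (Em k).compl]
      refine integral_mono ((integrable_const (1 : ℝ)).indicator (Em k).compl) (integrable_bdd (Nm k) (N0 k) (N1 k)) fun ω => ?_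
      by_cases hω : ω ∈ E k
      · simp [hω, N0]
      · have : Nk k ω = 1 := by
          refine Finset.prod_eq_one fun v hv => ?_
          simp only [hF]; rw [if_neg]
          intro hA; exact hω (Set.mem_biUnion hv hA)
        simp [hω, this]
    rw [probReal_compl_eq_one_sub (Em k)] at h1
    have := hNk' k; linarith
  have hanti : Antitone E := antitone_nat_of_succ_le fun k ω hω => by
    simp only [hE, Set.mem_iUnion] at hω ⊢
    obtain ⟨w, hw, hA⟩ := hω
    refine ⟨par G o w, ?_, ((An_step o h ω w).1 hA).2⟩
    rw [mem_Sph hc hr] at hw ⊢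
    rw [dist_par hc]; omega
  have hlim := tendsto_measure_iInter_atTop (μ := μ) (fun k => (Em k).nullMeasurableSet) hanti ⟨0, measure_ne_top _ _⟩
  have hge : ENNReal.ofReal (c * P) ≤ μ (⋂ k, E k) := by
    refine ge_of_tendsto' hlim fun k => ?_
    exact (ENNReal.ofReal_le_iff_le_toReal (measure_ne_top μ (E k))).2 (hEP k)
  have hsub : (⋂ k, E k) ⊆ {ω | (levelComp G h ω o).Infinite} := fun ω hω => by
    have h1 : ∀ k, ∃ w, G.dist o w = k ∧ w ∈ levelComp G h ω o := fun k => by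
      have := Set.mem_iInter.1 hω k
      simp only [hE, Set.mem_iUnion] at this
      obtain ⟨w, hw, hA⟩ := this
      rw [mem_Sph hc hr] at hw
      exact ⟨w, hw, An_comp hc o h ω k w hw hA⟩
    intro hfin
    obtain ⟨M, hM⟩ := (hfin.image (G.dist o)).bddAbove
    obtain ⟨w, hw, hw2⟩ := h1 (M + 1)
    have := hM (Set.mem_image_of_mem _ hw2)
    omega
  intro hz
  have := hge.trans (measure_mono hsub)
  rw [hz] at this
  simp at this
  have : 0 < c * P := by positivity
  linarith

/-- one-arm along a fixed line -/
lemma path_prob (hb : 2 ≤ b) (hc : G.Connected) (ha : G.IsAcyclic) (hr : IsReg G (b + 1))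
    (hμ : IsGaussianField μ (treeGreen G (b + 1))) (o : T) {h l C : ℝ} (hC : 0 < C) (hl : 0 < l)
    (hm : ∀ R a, mm b h R a ≤ C * l ^ R * (1 + a ^ 2)) {w : T} {R : ℕ} (hw : G.dist o w = R) :
    μ.real {ω | An G o h ω w} ≤ C * (1 + b / (b - 1)) * (l / b) ^ R := by
  have := hμ.1
  have hb' : (2 : ℝ) ≤ b := by exact_mod_cast hb
  have hσ : (0 : ℝ) < b / (b - 1) := div_pos (by linarith) (by linarith)
  have key : ∀ R j w, G.dist o w = R → (b : ℝ) ^ R * ∫ ω, (if An G o h ω w then mm b h j (ω w) else 0) ∂μ =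
      ∫ ω, mm b h (R + j) (ω o) ∂μ := fun R => by
    induction R with
    | zero =>
      intro j w hw
      obtain rfl := (hc.dist_eq_zero_iff).1 hw
      simp only [pow_zero, one_mul, zero_add, An_o hc]
      congr 1; ext ω
      split_ifs with h1
      · rfl
      · rw [mm_zero _ _ _ (not_le.1 h1)]
    | succ k ih =>
      intro j w hw
      have hne : w ≠ o := by rintro rfl; simp at hw
      have hp := par_spec hc hne
      have h1 := ih (j + 1) (par G o w) (by omega)
      rw [show k + 1 + j = k + (j + 1) by ring, ← h1, pow_succ, mul_assoc]
      congr 1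
      have h2 := resample hb hc ha hr hμ o k {w} (by simpa using hw)
        (fun w ω y => if An G o h ω (par G o w) then mm b h j y else 0) (b ^ j) (fun w ω y => by
          split_ifs
          · rw [abs_of_nonneg (mm_nonneg _ _ _ _)]; exact mm_le _ _ _ _
          · simp) (by positivity)
        (fun w => Measurable.ite (measurable_fst (An_meas o h _)) ((mm_meas b h j).comp measurable_snd) measurable_const)
        (fun w' hw' ω ω' he => by
          rw [Finset.mem_singleton] at hw'; subst hw'
          ext y
          simp only [An_dep hc o h (par G o w') (k := k) (by omega) he])
      simp only [Finset.prod_singleton] at h2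
      have e : ∀ ω : T → ℝ, (if An G o h ω w then mm b h j (ω w) else 0) = if An G o h ω (par G o w) then mm b h j (ω w) else 0 := fun ω => by
        by_cases h1 : An G o h ω (par G o w)
        · by_cases h2 : h ≤ ω w
          · simp [An_step o h ω w, h1, h2]
          · simp [h1, mm_zero _ _ _ (not_le.1 h2)]
        · simp [An_step o h ω w, h1]
      simp only [e]
      rw [h2, ← integral_const_mul]
      congr 1; ext ω
      split_ifs with h3
      · rw [mm_succ _ _ _ (show h ≤ ω (par G o w) from h3 0)]
      · simp
  have h1 := key R 0 w hw
  have e : ∀ ω : T → ℝ, (if An G o h ω w then mm b h 0 (ω w) else 0) = {ω | An G o h ω w}.indicator 1 ω := fun ω => by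
    by_cases h1 : An G o h ω w
    · simpa [h1, mm] using h1 0
    · simp [h1]
  simp only [e] at h1
  rw [integral_indicator_one (An_meas o h w), add_zero] at h1
  have h2 : ∫ ω, mm b h R (ω o) ∂μ ≤ C * l ^ R * (1 + b / (b - 1)) := by
    have hs := gauss_sq (b / (b - 1) : ℝ).toNNReal 0
    simp only [zero_add] at hs
    rw [← integral_map (φ := fun ω : T → ℝ => ω o) (measurable_pi_apply o).aemeasurable (mm_meas b h R).aestronglyMeasurable, phi_law hb hμ]
    calc _ ≤ ∫ y, C * l ^ R * (1 + y ^ 2) ∂(gaussianReal 0 (b / (b - 1) : ℝ).toNNReal) :=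
          integral_mono (integrable_bdd (mm_meas b h R) (fun y => mm_nonneg _ _ _ _) (fun y => mm_le _ _ _ _)) (hs.1.const_mul _) fun y => hm R y
      _ = _ := by rw [integral_const_mul, hs.2, Real.coe_toNNReal _ hσ.le]; ring
  rw [← h1] at h2
  rw [div_pow, mul_div_assoc', le_div_iff₀ (by positivity)]
  linarith
end tree
end GFF

namespace GFF
section tree
variable {T : Type*} {G : SimpleGraph T} {b : ℕ} {μ : Measure (T → ℝ)}

lemma mm_high {b : ℕ} (hb : 2 ≤ b) : ∃ h : ℝ, ∀ R a, mm b h R a ≤ 1 * (3 / 5) ^ R * (1 + a ^ 2) := by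
  have hb' : (2 : ℝ) ≤ b := by exact_mod_cast hb
  refine ⟨10 * (2 * b + 1), fun R => ?_⟩
  induction R with
  | zero => intro a; have := mm_le b (10 * (2 * b + 1)) 0 a; simp at this ⊢; nlinarith
  | succ R ih =>
    intro a
    by_cases ha : a < 10 * (2 * b + 1)
    · rw [mm_zero _ _ _ ha]; positivity
    push Not at ha
    rw [mm_succ _ _ _ ha]
    obtain ⟨hi, he⟩ := gauss_sq (gv b) (a / b)
    have h1 : ∫ y, mm b (10 * (2 * b + 1)) R (a / b + y) ∂gam b ≤ (3 / 5) ^ R * (1 + (a / b) ^ 2 + gv b) := by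
      rw [← he, ← integral_const_mul]
      refine integral_mono (mm_int _ _ _ _) (hi.const_mul _) fun y => ?_
      simpa using ih (a / b + y)
    have hv : (gv b : ℝ) = (b + 1) / b := by simp [gv]
    have hP : (0 : ℝ) < (3 / 5) ^ R := by positivity
    calc _ ≤ (b : ℝ) * ((3 / 5) ^ R * (1 + (a / b) ^ 2 + gv b)) := by gcongr
      _ = (3 / 5) ^ R * (a ^ 2 / b + (2 * b + 1)) := by rw [hv]; field_simp; ring
      _ ≤ (3 / 5) ^ R * (3 / 5 * (1 + a ^ 2)) := by
        gcongr
        have : a ^ 2 / b ≤ a ^ 2 / 2 := by gcongr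
        nlinarith
      _ = _ := by rw [pow_succ]; ring

lemma hstar_ne (hb : 2 ≤ b) (hc : G.Connected) (ha : G.IsAcyclic) (hr : IsReg G (b + 1))
    (hμ : IsGaussianField μ (treeGreen G (b + 1))) (o : T) :
    ∃ h, μ {ω | (levelComp G h ω o).Infinite} = 0 := by
  have := hμ.1
  have hb' : (2 : ℝ) ≤ b := by exact_mod_cast hb
  obtain ⟨h, hm⟩ := mm_high hb
  refine ⟨h, ?_⟩
  have key : ∀ R, μ.real {ω | (levelComp G h ω o).Infinite} ≤ (1 + b / (b - 1)) * (9 / 10 : ℝ) ^ R := fun R => by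
    have hs : {ω | (levelComp G h ω o).Infinite} ⊆ ⋃ w ∈ Sph G o R, {ω | An G o h ω w} := fun ω hω => by
      by_contra hcon
      apply hω
      have hsub : levelComp G h ω o ⊆ ⋃ k ∈ Finset.range R, (Sph G o k : Set T) := fun w hw => by
        have hA := comp_An hc ha o h ω hw
        simp only [Set.mem_iUnion, Finset.mem_range, Finset.mem_coe, mem_Sph hc hr]
        refine ⟨_, ?_, rfl⟩
        by_contra hR
        push Not at hR
        apply hcon
        simp only [Set.mem_iUnion, mem_Sph hc hr]
        refine ⟨(par G o)^[G.dist o w - R] w, by rw [dist_iter hc]; omega, fun j => ?_⟩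
        rw [← Function.iterate_add_apply]; exact hA _
      exact Set.Finite.subset (Set.Finite.biUnion (Finset.finite_toSet _) fun k _ => Finset.finite_toSet _) hsub
    calc _ ≤ μ.real (⋃ w ∈ Sph G o R, {ω | An G o h ω w}) := measureReal_mono hs (measure_ne_top _ _)
      _ ≤ ∑ w ∈ Sph G o R, μ.real {ω | An G o h ω w} := measureReal_biUnion_finset_le _ _
      _ ≤ ∑ w ∈ Sph G o R, 1 * (1 + b / (b - 1)) * ((3 / 5 : ℝ) / b) ^ R := by
        refine Finset.sum_le_sum fun w hw => ?_
        exact path_prob hb hc ha hr hμ o one_pos (by norm_num) hm ((mem_Sph hc hr o R w).1 hw)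
      _ ≤ (b + 1) ^ R * ((1 + b / (b - 1)) * ((3 / 5 : ℝ) / b) ^ R) := by
        rw [Finset.sum_const, nsmul_eq_mul, one_mul]
        have h1 : (0 : ℝ) ≤ b / (b - 1) := div_nonneg (by linarith) (by linarith)
        gcongr
        exact_mod_cast card_Sph hc ha hr o R
      _ = (1 + b / (b - 1)) * ((b + 1) * ((3 / 5 : ℝ) / b)) ^ R := by rw [mul_pow]; ring
      _ ≤ _ := by
        have h1 : (0 : ℝ) ≤ b / (b - 1) := div_nonneg (by linarith) (by linarith)
        gcongr
        rw [mul_div_assoc', div_le_iff₀ (by linarith)]; linarith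
  have hl : Tendsto (fun R : ℕ => (1 + b / (b - 1)) * (9 / 10 : ℝ) ^ R) atTop (nhds 0) := by
    simpa using (tendsto_pow_atTop_nhds_zero_of_lt_one (by norm_num) (by norm_num : (9 / 10 : ℝ) < 1)).const_mul (1 + (b : ℝ) / (b - 1))
  have h0 := ge_of_tendsto' hl key
  exact (measureReal_eq_zero_iff).1 (le_antisymm h0 measureReal_nonneg)

lemma par_path (hc : G.Connected) {o w : T} {R : ℕ} (hw : G.dist o w = R) {i j : ℕ} (hij : i ≤ j) (hj : j ≤ R) :
    G.dist ((par G o)^[i] w) ((par G o)^[j] w) = j - i := by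
  apply le_antisymm
  · obtain ⟨k, rfl⟩ := Nat.exists_eq_add_of_le hij
    clear hij
    induction k with
    | zero => simp
    | succ k ih =>
      have h1 := ih (by omega)
      have hd := dist_iter hc o (i + k) w
      have hne : (par G o)^[i + k] w ≠ o := by intro h; rw [h] at hd; simp at hd; omega
      have h2 := dist_adj_le hc (x := (par G o)^[i] w) (par_spec hc hne).1
      rw [← Function.iterate_succ_apply' (par G o)] at h2
      simp only [Nat.succ_eq_add_one] at h2
      rw [← add_assoc]; omega
  · have h1 := hc.dist_triangle (u := o) (v := (par G o)^[j] w) (w := (par G o)^[i] w)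
    rw [dist_iter hc, dist_iter hc, G.dist_comm (u := (par G o)^[j] w)] at h1
    omega

theorem tree_out (hb : 2 ≤ b) (hc : G.Connected) (ha : G.IsAcyclic) (hr : IsReg G (b + 1))
    (hμ : IsGaussianField μ (treeGreen G (b + 1))) (o : T) {h : ℝ} (hh : hstar G o μ < h) :
    ∃ ε l C : ℝ, 0 < ε ∧ 0 < l ∧ l < 1 ∧ 0 < C ∧ ∀ L R : ℕ, ∃ t : ℕ → T,
      (∀ i j, i ≤ j → j ≤ R → G.dist (t i) (t j) = j - i) ∧
      μ.real {ω | ∀ i ≤ R, h - ε ≤ lin (sL G b L (t i)) ω} ≤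
        C * (l / b) ^ R + (R + 1) * Real.exp (-(ε ^ 2 / (2 * ((b / (b - 1)) * thet b ^ (2 * L))))) := by
  have := hμ.1
  have hb' : (2 : ℝ) ≤ b := by exact_mod_cast hb
  obtain ⟨h0, hh0⟩ := hstar_ne hb hc ha hr hμ o
  obtain ⟨h', hp', hlt⟩ := exists_lt_of_csInf_lt (⟨h0, hh0⟩ : Set.Nonempty {h : ℝ | μ {ω | (levelComp G h ω o).Infinite} = 0}) hh
  have np : ∀ R, mm b h' R h' ≤ 1 := fun R => by
    by_contra hcon
    push Not at hcon
    exact survive hb hc ha hr hμ o hcon hp'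
  set ε := (h - h') / 3 with hε
  have hε0 : 0 < ε := by simp only [hε]; linarith
  obtain ⟨l, C, hl, hl1, hC, hm⟩ := mm_poly hb (show h' < h - 2 * ε by simp only [hε]; linarith) np
  have hσ : (0 : ℝ) < b / (b - 1) := div_pos (by linarith) (by linarith)
  refine ⟨ε, l, C * (1 + b / (b - 1)), hε0, hl, hl1, by positivity, fun L R => ?_⟩
  obtain ⟨w, hw⟩ := Sph_nonempty hc ha hr (by omega) o R
  rw [mem_Sph hc hr] at hw
  refine ⟨fun i => (par G o)^[i] w, fun i j hij hj => par_path hc hw hij hj, ?_⟩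
  have hs : {ω : T → ℝ | ∀ i ≤ R, h - ε ≤ lin (sL G b L ((par G o)^[i] w)) ω} ⊆
      {ω | An G o (h - 2 * ε) ω w} ∪ ⋃ i ∈ Finset.range (R + 1), {ω | ε ≤ lin (-((Q G b ^ L) (sg ((par G o)^[i] w)))) ω} := fun ω hω => by
    by_cases hA : An G o (h - 2 * ε) ω w
    · exact Or.inl hA
    right
    simp only [An] at hA
    push Not at hA
    obtain ⟨j, hj⟩ := hA
    have : ∃ i ≤ R, (par G o)^[j] w = (par G o)^[i] w := by
      by_cases hjR : j ≤ R
      · exact ⟨j, hjR, rfl⟩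
      · refine ⟨R, le_rfl, ?_⟩
        have e1 : (par G o)^[R] w = o := by
          have := dist_iter hc o R w
          rw [hw, Nat.sub_self] at this
          exact ((hc.dist_eq_zero_iff).1 this).symm
        rw [show j = (j - R) + R by omega, Function.iterate_add_apply, e1, iter_o hc]
    obtain ⟨i, hi, e⟩ := this
    simp only [Set.mem_iUnion, Finset.mem_range]
    refine ⟨i, by omega, ?_⟩
    have h1 := hω i hi
    rw [sL, lin_sub, lin_single] at h1
    rw [e] at hj
    show ε ≤ lin _ ω
    rw [← neg_one_smul ℝ, lin_smul]
    linarith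
  calc _ ≤ _ := measureReal_mono hs (measure_ne_top _ _)
    _ ≤ _ := measureReal_union_le _ _
    _ ≤ _ := by
      gcongr
      · exact path_prob hb hc ha hr hμ o hC hl hm hw
      · refine (measureReal_biUnion_finset_le _ _).trans ?_
        refine (Finset.sum_le_card_nsmul _ _ _ fun i _ => lin_tail hμ _ (s := (b / (b - 1)) * thet b ^ (2 * L)) ?_ hε0.le ?_).trans ?_
        · have := (thet_lt hb).1; positivity
        · rw [← neg_one_smul ℝ, E2_smul, E2_comm, E2_smul]
          have := tree_QL_var hb hc ha hr hμ L ((par G o)^[i] w)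
          linarith
        · simp
end tree
end GFF

namespace GFF
section extract
variable {W : Type*} [Finite W] {H : SimpleGraph W} {b : ℕ}

lemma ball_card (hc : H.Connected) (hd : ∀ v, (H.neighborSet v).ncard ≤ b + 1) (x : W) (r : ℕ) :
    {y | H.dist x y ≤ r}.ncard ≤ (b + 2) ^ r := by
  induction r with
  | zero =>
    have : {y | H.dist x y ≤ 0} = {x} := by
      ext y; simp [hc.dist_eq_zero_iff, eq_comm]
    rw [this]; simp
  | succ r ih =>
    have hs : {y | H.dist x y ≤ r + 1} ⊆ ⋃ y ∈ (Set.toFinite {y | H.dist x y ≤ r}).toFinset, insert y (H.neighborSet y) := by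
      intro y hy
      simp only [Set.mem_iUnion, Set.Finite.mem_toFinset, Set.mem_ofPred_eq, exists_prop] at hy ⊢
      by_cases h : H.dist x y ≤ r
      · exact ⟨y, h, Set.mem_insert _ _⟩
      · have hne : y ≠ x := by rintro rfl; simp at h
        obtain ⟨z, hz, hz2⟩ := exists_closer hc hne
        exact ⟨z, by omega, Set.mem_insert_of_mem _ hz.symm⟩
    refine (Set.ncard_le_ncard hs (Set.toFinite _)).trans ?_
    refine (Finset.set_ncard_biUnion_le _ _).trans ?_
    refine (Finset.sum_le_card_nsmul _ _ (b + 2) fun y _ => ?_).trans ?_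
    · exact (Set.ncard_insert_le _ _).trans (by have := hd y; omega)
    · rw [← Set.ncard_eq_toFinset_card _ (Set.toFinite _), smul_eq_mul, pow_succ]
      gcongr

lemma geo_path (hc : H.Connected) (n : ℕ) : ∀ x y : W, H.dist x y = n → ∃ P : ℕ → W, P 0 = x ∧ P n = y ∧
    ∀ t, t + 1 ≤ n → H.Adj (P t) (P (t + 1)) := by
  induction n with
  | zero =>
    intro x y h
    exact ⟨fun _ => x, rfl, (hc.dist_eq_zero_iff).1 h, fun t ht => by omega⟩
  | succ n ih =>
    intro x y h
    have hne : y ≠ x := by rintro rfl; simp at h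
    obtain ⟨z, hz, hz2⟩ := exists_closer hc hne
    obtain ⟨P, h0, hn, hP⟩ := ih x z (by omega)
    refine ⟨fun t => if t ≤ n then P t else y, by simp [h0], by simp, fun t ht => ?_⟩
    by_cases h1 : t + 1 ≤ n
    · simpa [h1, show t ≤ n by omega] using hP t h1
    · obtain rfl : t = n := by omega
      simpa [hn] using hz.symm

lemma walk_dist (hc : H.Connected) {P : ℕ → W} {n : ℕ} (hP : ∀ t, t + 1 ≤ n → H.Adj (P t) (P (t + 1))) {s t : ℕ}
    (hst : s ≤ t) (ht : t ≤ n) : H.dist (P s) (P t) ≤ t - s := by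
  obtain ⟨k, rfl⟩ := Nat.exists_eq_add_of_le hst
  clear hst
  induction k with
  | zero => simp
  | succ k ih =>
    have h1 := ih (by omega)
    have h2 := dist_adj_le hc (x := P s) (hP (s + k) (by omega))
    rw [← add_assoc]; omega

lemma geo_dist (hc : H.Connected) {P : ℕ → W} {n : ℕ} (hP : ∀ t, t + 1 ≤ n → H.Adj (P t) (P (t + 1)))
    (hn : H.dist (P 0) (P n) = n) {s t : ℕ} (hst : s ≤ t) (ht : t ≤ n) : H.dist (P s) (P t) = t - s := by
  have h1 := walk_dist hc hP hst ht
  have h2 := walk_dist hc hP (Nat.zero_le s) (hst.trans ht)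
  have h3 := walk_dist hc hP ht le_rfl
  have h4 := hc.dist_triangle (u := P 0) (v := P s) (w := P n)
  have h5 := hc.dist_triangle (u := P s) (v := P t) (w := P n)
  omega

/-- piece -/
def pc (ℓ : ℕ) (e : ℕ → W) (a : ℕ → ℕ) (i t : ℕ) : W := if t = 0 then e (a i) else e (i * ℓ + t)

def cand (H : SimpleGraph W) (ℓ : ℕ) (e : ℕ → W) (i c : ℕ) : Prop :=
  c ≤ i * ℓ ∧ ∃ z, H.dist z (e c) = ℓ ∧ ∀ j ≤ i * ℓ, ℓ ≤ H.dist z (e j)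

structure Stp (H : SimpleGraph W) (ℓ : ℕ) (e : ℕ → W) (a : ℕ → ℕ) (i : ℕ) : Prop where
  le : a i ≤ i * ℓ
  cd : cand H ℓ e i (a i)
  mn : ∀ c, cand H ℓ e i c → a i ≤ c
  geo : ∀ s t, s ≤ t → t ≤ ℓ → H.dist (pc ℓ e a i s) (pc ℓ e a i t) = t - s
  sep : ∀ t ≤ ℓ, ∀ j ≤ i * ℓ, t ≤ H.dist (pc ℓ e a i t) (e j)

lemma cand_congr {ℓ : ℕ} {e e' : ℕ → W} {i : ℕ} (h : ∀ j ≤ i * ℓ, e j = e' j) (c : ℕ) (hcd : cand H ℓ e i c) :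
    cand H ℓ e' i c := by
  obtain ⟨h1, z, h2, h3⟩ := hcd
  exact ⟨h1, z, by rw [← h c h1]; exact h2, fun j hj => by rw [← h j hj]; exact h3 j hj⟩

lemma Stp_congr {ℓ : ℕ} {e e' : ℕ → W} {a a' : ℕ → ℕ} {i : ℕ} (h : ∀ j ≤ (i + 1) * ℓ, e j = e' j) (ha : a i = a' i)
    (hs : Stp H ℓ e a i) : Stp H ℓ e' a' i := by
  have hle : i * ℓ ≤ (i + 1) * ℓ := Nat.mul_le_mul_right _ (by omega)
  have hp : ∀ t ≤ ℓ, pc ℓ e' a' i t = pc ℓ e a i t := fun t ht => by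
    simp only [pc]
    split_ifs
    · rw [← ha, h _ (hs.le.trans hle)]
    · rw [h _ (by rw [add_mul]; omega)]
  refine ⟨ha ▸ hs.le, ha ▸ cand_congr (fun j hj => h j (hj.trans hle)) _ hs.cd, fun c hcd => ?_, fun s t hst ht => ?_, fun t ht j hj => ?_⟩
  · rw [← ha]; exact hs.mn c (cand_congr (fun j hj => (h j (hj.trans hle)).symm) _ hcd)
  · rw [hp s (hst.trans ht), hp t ht]; exact hs.geo s t hst ht
  · rw [hp t ht, ← h j (hj.trans hle)]; exact hs.sep t ht j hj

lemma cand_exists (hc : H.Connected) (hd : ∀ v, (H.neighborSet v).ncard ≤ b + 1) {ℓ : ℕ} (e : ℕ → W) (i : ℕ)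
    (hm : (i * ℓ + 1) * (b + 2) ^ ℓ < Nat.card W) : ∃ c, cand H ℓ e i c := by
  have h1 : ∃ z, ∀ j ≤ i * ℓ, ℓ ≤ H.dist z (e j) := by
    by_contra hcon
    push Not at hcon
    have hs : (Set.univ : Set W) ⊆ ⋃ j ∈ Finset.range (i * ℓ + 1), {y | H.dist (e j) y ≤ ℓ} := fun z _ => by
      obtain ⟨j, hj, hz⟩ := hcon z
      simp only [Set.mem_iUnion, Finset.mem_range]
      refine ⟨j, by omega, ?_⟩
      show H.dist (e j) z ≤ ℓ
      rw [H.dist_comm]; exact hz.le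
    have h2 := (Set.ncard_le_ncard hs (Set.toFinite _)).trans ((Finset.set_ncard_biUnion_le _ _).trans
      (Finset.sum_le_card_nsmul _ _ _ fun j _ => ball_card hc hd (e j) ℓ))
    rw [Set.ncard_univ] at h2
    simp at h2
    omega
  obtain ⟨z0, hz0⟩ := h1
  have h2 : ∃ n, ∃ z c, c ≤ i * ℓ ∧ H.dist z (e c) = n ∧ ∀ j ≤ i * ℓ, ℓ ≤ H.dist z (e j) :=
    ⟨_, z0, 0, by omega, rfl, hz0⟩
  obtain ⟨z, c, hci, hzn, hz⟩ := Nat.find_spec h2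
  refine ⟨c, hci, z, ?_, hz⟩
  by_contra hne
  have hgt : ℓ < H.dist z (e c) := lt_of_le_of_ne (hz c hci) (Ne.symm hne)
  have hne' : z ≠ e c := by intro h; rw [h] at hgt; simp at hgt
  obtain ⟨y, hy, hy2⟩ := exists_closer hc hne'
  rw [H.dist_comm (u := e c), H.dist_comm (u := e c)] at hy2
  refine Nat.find_min h2 (m := H.dist y (e c)) (by omega) ⟨y, c, hci, rfl, fun j hj => ?_⟩
  have h3 : H.dist z (e c) ≤ H.dist z (e j) := by
    rw [hzn]; exact Nat.find_min' h2 ⟨z, j, hj, rfl, hz⟩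
  have h4 := dist_adj_le hc (x := e j) hy.symm
  rw [H.dist_comm (u := e j), H.dist_comm (u := e j)] at h4
  omega

lemma extract (hc : H.Connected) (hd : ∀ v, (H.neighborSet v).ncard ≤ b + 1) {ℓ : ℕ} (hℓ : 1 ≤ ℓ) (x : W) (k : ℕ)
    (hm : (k * ℓ + 1) * (b + 2) ^ ℓ < Nat.card W) : ∃ (e : ℕ → W) (a : ℕ → ℕ), e 0 = x ∧ ∀ i < k, Stp H ℓ e a i := by
  induction k with
  | zero => exact ⟨fun _ => x, fun _ => 0, rfl, fun i hi => by omega⟩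
  | succ k ih =>
    have hm' : (k * ℓ + 1) * (b + 2) ^ ℓ < Nat.card W := lt_of_le_of_lt (by gcongr; omega) hm
    obtain ⟨e, a, h0, hs⟩ := ih hm'
    have hex := cand_exists hc hd e k hm'
    set c := Nat.find hex with hcdef
    have hcd := Nat.find_spec hex
    obtain ⟨hck, z, hz1, hz2⟩ := hcd
    obtain ⟨P, hP0, hPn, hP⟩ := geo_path hc ℓ (e c) z (by rw [H.dist_comm]; exact hz1)
    have hgeo : H.dist (P 0) (P ℓ) = ℓ := by rw [hP0, hPn, H.dist_comm]; exact hz1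
    set e' : ℕ → W := fun j => if j ≤ k * ℓ then e j else P (j - k * ℓ) with he'
    set a' : ℕ → ℕ := fun i => if i < k then a i else c with ha'
    have hee : ∀ j ≤ k * ℓ, e j = e' j := fun j hj => by simp [he', hj]
    have hpc : ∀ t ≤ ℓ, pc ℓ e' a' k t = P t := fun t ht => by
      simp only [pc]
      split_ifs with h
      · subst h
        simp only [ha', lt_irrefl, if_false]
        rw [← hee _ hck, hP0]
      · have : ¬ (k * ℓ + t ≤ k * ℓ) := by omega
        simp only [he', this, if_false]
        congr 1; omega
    have hac : a' k = c := by simp [ha']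
    refine ⟨e', a', by simp [he', h0], fun i hi => ?_⟩
    rcases Nat.lt_succ_iff_lt_or_eq.1 hi with hi | rfl
    · refine Stp_congr (fun j hj => hee j (hj.trans (Nat.mul_le_mul_right _ hi))) ?_ (hs i hi)
      simp [ha', hi]
    · refine ⟨by rw [hac]; exact hck, by rw [hac]; exact cand_congr hee _ (Nat.find_spec hex), fun c' hc' => ?_, fun s t hst ht => ?_, fun t ht j hj => ?_⟩
      · rw [hac]; exact Nat.find_min' hex (cand_congr (fun j hj => (hee j hj).symm) _ hc')
      · rw [hpc s (hst.trans ht), hpc t ht]; exact geo_dist hc hP hgeo hst ht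
      · rw [hpc t ht, ← hee j hj]
        have h1 := geo_dist hc hP hgeo ht le_rfl
        have h2 := hc.dist_triangle (u := P ℓ) (v := P t) (w := e j)
        have h3 := hz2 j hj
        rw [hPn] at h1 h2
        rw [H.dist_comm (u := z) (v := P t)] at h2
        omega

lemma Stp_mono {ℓ k : ℕ} {e : ℕ → W} {a : ℕ → ℕ} (hs : ∀ i < k, Stp H ℓ e a i) {i j : ℕ} (hij : i ≤ j) (hj : j < k) :
    a i ≤ a j := by
  by_contra hlt
  push Not at hlt
  have hi := hs i (by omega)
  have hjj := hs j hj
  obtain ⟨h1, z, h2, h3⟩ := hjj.cd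
  have := hi.mn (a j) ⟨hlt.le.trans hi.le, z, h2, fun j' hj' => h3 j' (hj'.trans (Nat.mul_le_mul_right _ hij))⟩
  omega
end extract
end GFF

namespace GFF
section pt
variable {V : Type*} {G : SimpleGraph V}

structure PT (G : SimpleGraph V) (S : Set V) (r : V) (p : V → V) (rk : V → ℕ) : Prop where
  root : p r = r
  rS : r ∈ S
  adj : ∀ v, v ≠ r → G.Adj v (p v)
  lt : ∀ v, v ≠ r → rk (p v) < rk v
  cl : ∀ v ∈ S, p v ∈ S
  out : ∀ n y, (∃ s ∈ S, G.dist s y ≤ n) → p^[n] y ∈ S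

def FF (p : V → V) : SimpleGraph V where
  Adj u v := u ≠ v ∧ (p u = v ∨ p v = u)
  symm := ⟨fun _ _ h => ⟨h.1.symm, h.2.symm⟩⟩
  loopless := ⟨fun _ h => h.1 rfl⟩

variable {S : Set V} {r : V} {p : V → V} {rk : V → ℕ}

lemma PT.acyclic (h : PT G S r p rk) : (FF p).IsAcyclic := by
  intro u c hcyc
  obtain ⟨w, hw, hmax⟩ := Finset.exists_max_image c.support.toFinset rk ⟨u, by simp⟩
  rw [List.mem_toFinset] at hw
  have hc' := hcyc.rotate hw
  have hn := hc'.not_nil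
  have key : ∀ y, y ∈ (c.rotate w hw).support → (FF p).Adj w y → p w = y := fun y hy hA => by
    rcases hA.2 with h1 | h1
    · exact h1
    · exfalso
      have hyr : y ≠ r := by rintro rfl; rw [h.root] at h1; exact hA.1 h1.symm
      have h2 := h.lt y hyr
      rw [h1] at h2
      have h3 := hmax y (by rw [List.mem_toFinset]; exact (SimpleGraph.Walk.mem_support_rotate_iff c w hw).1 hy)
      omega
  have h1 := key _ ((c.rotate w hw).getVert_mem_support 1) ((c.rotate w hw).adj_snd hn)
  have h2 := key _ ((c.rotate w hw).getVert_mem_support _) ((c.rotate w hw).adj_penultimate hn).symm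
  exact hc'.snd_ne_penultimate (h1.symm.trans h2)

lemma PT.dist_iter (h : PT G S r p rk) (hc : G.Connected) (j : ℕ) (y : V) : G.dist y (p^[j] y) ≤ j := by
  induction j with
  | zero => simp
  | succ j ih =>
    rw [Function.iterate_succ_apply']
    by_cases hr : p^[j] y = r
    · rw [hr, h.root, ← hr]; omega
    · have := dist_adj_le hc (x := y) (h.adj _ hr); omega

lemma PT.iter_r (h : PT G S r p rk) (j : ℕ) : p^[j] r = r := Function.iterate_fixed h.root j

/-- extra ordered pairs between two cells -/
lemma PT.extra_class [Fintype V] (h : PT G S r p rk) (hc : G.Connected) (z z' : V) {q' R0 : ℕ} (hR : 3 * q' + 1 ≤ R0)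
    (hcyc : adjPairs G (gball G z R0) ≤ 2 * (gball G z R0).ncard) :
    {x : V × V | G.Adj x.1 x.2 ∧ ¬ (FF p).Adj x.1 x.2 ∧ (∃ j ≤ q', p^[j] x.1 = z) ∧ ∃ j ≤ q', p^[j] x.2 = z'}.ncard ≤ 4 := by
  set Y := {x : V × V | G.Adj x.1 x.2 ∧ ¬ (FF p).Adj x.1 x.2 ∧ (∃ j ≤ q', p^[j] x.1 = z) ∧ ∃ j ≤ q', p^[j] x.2 = z'} with hY
  by_cases hne : Y = ∅
  · rw [hne]; simp
  obtain ⟨⟨u0, v0⟩, h0a, -, ⟨i0, hi0, hu0⟩, j0, hj0, hv0⟩ := Set.nonempty_iff_ne_empty.2 hne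
  simp only at h0a hu0 hv0
  have hzz : G.dist z z' ≤ 2 * q' + 1 := by
    have h1 := h.dist_iter hc i0 u0
    have h2 := h.dist_iter hc j0 v0
    rw [hu0, G.dist_comm] at h1; rw [hv0] at h2
    have h3 := dist_adj_le hc (x := z) h0a
    have h4 := hc.dist_triangle (u := z) (v := v0) (w := z')
    omega
  set B := gball G z R0 with hB
  set U : Set V := {y | ∃ j ≤ q', p^[j] y = z ∨ p^[j] y = z'} with hU
  have hUB : ∀ y ∈ U, y ∈ B := by
    rintro y ⟨j, hj, hy⟩
    have h1 := h.dist_iter hc j y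
    show G.dist z y ≤ R0
    rcases hy with hy | hy
    · rw [hy, G.dist_comm] at h1; omega
    · rw [hy] at h1
      have h4 := hc.dist_triangle (u := z) (v := z') (w := y)
      rw [G.dist_comm (u := z') (v := y)] at h4
      omega
  have hUp : ∀ y ∈ U, y ≠ z → y ≠ z' → p y ∈ U ∧ y ≠ r := by
    rintro y ⟨j, hj, hy⟩ h1 h2
    refine ⟨?_, ?_⟩
    · cases j with
      | zero => rcases hy with hy | hy <;> simp at hy <;> contradiction
      | succ j => exact ⟨j, by omega, by simpa only [Function.iterate_succ_apply] using hy⟩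
    · rintro rfl
      rw [h.iter_r] at hy
      tauto
  have hcl : ∀ y, ∃ w, y ≠ z → G.Adj y w ∧ G.dist z w + 1 = G.dist z y := fun y => by
    by_cases hy : y = z
    · exact ⟨y, fun h => absurd hy h⟩
    · obtain ⟨w, hw⟩ := exists_closer hc hy; exact ⟨w, fun _ => hw⟩
  choose cz hcz using hcl
  set pr : V → V := fun y => if y ∈ U then p y else cz y with hpr
  set A : Finset V := B.toFinset \ {z, z'} with hA
  have mA : ∀ y, y ∈ A ↔ y ∈ B ∧ y ≠ z ∧ y ≠ z' := fun y => by
    simp only [hA, Finset.mem_sdiff, Set.mem_toFinset, Finset.mem_insert, Finset.mem_singleton, not_or]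
  have prU : ∀ y ∈ U, pr y = p y := fun y hy => by simp [hpr, hy]
  have prN : ∀ y ∉ U, pr y = cz y := fun y hy => by simp [hpr, hy]
  have prA : ∀ y ∈ A, G.Adj y (pr y) ∧ pr y ∈ B := fun y hy => by
    obtain ⟨h1, h2, h3⟩ := (mA y).1 hy
    by_cases hyU : y ∈ U
    · rw [prU y hyU]
      obtain ⟨h4, h5⟩ := hUp y hyU h2 h3
      exact ⟨h.adj y h5, hUB _ h4⟩
    · rw [prN y hyU]
      obtain ⟨h4, h5⟩ := hcz y h2
      refine ⟨h4, ?_⟩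
      show G.dist z _ ≤ R0
      have : G.dist z y ≤ R0 := h1
      omega
  have no2 : ∀ y ∈ A, ∀ y' ∈ A, pr y = y' → pr y' = y → False := fun y hy y' hy' e1 e2 => by
    obtain ⟨-, h2, h3⟩ := (mA y).1 hy
    obtain ⟨-, h2', h3'⟩ := (mA y').1 hy'
    by_cases hyU : y ∈ U
    · obtain ⟨h4, h5⟩ := hUp y hyU h2 h3
      rw [prU y hyU] at e1
      rw [e1] at h4
      obtain ⟨h4', h5'⟩ := hUp y' h4 h2' h3'
      rw [prU y' h4] at e2
      have := h.lt y h5; have h9 := h.lt y' h5'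
      rw [e1] at this; rw [e2] at h9; omega
    · by_cases hyU' : y' ∈ U
      · obtain ⟨h4, h5⟩ := hUp y' hyU' h2' h3'
        rw [prU y' hyU'] at e2
        rw [e2] at h4; exact hyU h4
      · rw [prN y hyU] at e1; rw [prN y' hyU'] at e2
        have h6 := (hcz y h2).2; have h7 := (hcz y' h2').2
        rw [e1] at h6; rw [e2] at h7; omega
  have YU : ∀ x ∈ Y, x.1 ∈ U ∧ x.2 ∈ U := by
    rintro x ⟨-, -, ⟨i, hi, h1⟩, j, hj, h2⟩
    exact ⟨⟨i, hi, Or.inl h1⟩, ⟨j, hj, Or.inr h2⟩⟩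
  set P1 := A.image fun y => (y, pr y) with hP1
  set P2 := A.image fun y => (pr y, y) with hP2
  have c1 : P1.card = A.card := Finset.card_image_of_injective _ fun a b hab => (Prod.ext_iff.1 hab).1
  have c2 : P2.card = A.card := Finset.card_image_of_injective _ fun a b hab => (Prod.ext_iff.1 hab).2
  have d12 : Disjoint P1 P2 := by
    rw [Finset.disjoint_left]
    intro x hx hx'
    obtain ⟨y, hy, rfl⟩ := Finset.mem_image.1 hx
    obtain ⟨y', hy', e⟩ := Finset.mem_image.1 hx'
    simp only [Prod.mk.injEq] at e
    exact no2 y hy y' hy' e.2.symm e.1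
  have d3 : Disjoint (P1 ∪ P2) Y.toFinset := by
    rw [Finset.disjoint_left]
    intro x hx hx'
    rw [Set.mem_toFinset] at hx'
    have hYU := YU x hx'
    have hnf := hx'.2.1
    have hga := hx'.1
    rcases Finset.mem_union.1 hx with hx | hx
    · obtain ⟨y, hy, rfl⟩ := Finset.mem_image.1 hx
      simp only at hYU hnf hga
      rw [prU y hYU.1] at hnf hga
      exact hnf ⟨hga.ne, Or.inl rfl⟩
    · obtain ⟨y, hy, rfl⟩ := Finset.mem_image.1 hx
      simp only at hYU hnf hga
      rw [prU y hYU.2] at hnf hga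
      exact hnf ⟨hga.ne, Or.inr rfl⟩
  have hsub : (↑(P1 ∪ P2 ∪ Y.toFinset) : Set (V × V)) ⊆ {x : V × V | x.1 ∈ B ∧ x.2 ∈ B ∧ G.Adj x.1 x.2} := by
    intro x hx
    simp only [Finset.coe_union, Set.mem_union, Finset.mem_coe, Set.mem_toFinset] at hx
    rcases hx with (hx | hx) | hx
    · obtain ⟨y, hy, rfl⟩ := Finset.mem_image.1 hx
      exact ⟨((mA y).1 hy).1, (prA y hy).2, (prA y hy).1⟩
    · obtain ⟨y, hy, rfl⟩ := Finset.mem_image.1 hx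
      exact ⟨(prA y hy).2, ((mA y).1 hy).1, (prA y hy).1.symm⟩
    · exact ⟨hUB _ (YU x hx).1, hUB _ (YU x hx).2, hx.1⟩
  have h1 := Set.ncard_le_ncard hsub (Set.toFinite _)
  rw [Set.ncard_coe_finset, Finset.card_union_of_disjoint d3, Finset.card_union_of_disjoint d12, c1, c2] at h1
  have h2 : B.ncard ≤ A.card + 2 := by
    rw [Set.ncard_eq_toFinset_card']
    have := Finset.le_card_sdiff ({z, z'} : Finset V) B.toFinset
    have h3 := Finset.card_le_two (a := z) (b := z')
    simp only [hA]; omega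
  rw [Set.ncard_eq_toFinset_card' Y]
  have h3 : {x : V × V | x.1 ∈ B ∧ x.2 ∈ B ∧ G.Adj x.1 x.2}.ncard ≤ 2 * B.ncard := hcyc
  omega
end pt
end GFF

namespace GFF
section pt
variable {V : Type*} {G : SimpleGraph V} {S : Set V} {r : V} {p : V → V} {rk : V → ℕ}

lemma PT.retr (h : PT G S r p rk) : ∃ π : V → V, (∀ s ∈ S, π s = s) ∧ ∀ y, y ∉ S → π y = π (p y) := by
  have ex : ∀ y, ∃ n, p^[n] y ∈ S := fun y => ⟨G.dist r y, h.out _ y ⟨r, h.rS, le_rfl⟩⟩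
  refine ⟨fun y => p^[Nat.find (ex y)] y, fun s hs => ?_, fun y hy => ?_⟩
  · have : Nat.find (ex s) = 0 := by rw [Nat.find_eq_zero]; exact hs
    simp only [this]; rfl
  · have := Nat.find_comp_succ (ex y) (ex (p y)) hy
    simp only [this, Function.iterate_succ_apply]

lemma PT.depth (h : PT G S r p rk) : ∃ dp : V → ℕ, (∀ v, v ≠ r → dp v = dp (p v) + 1) ∧ dp r = 0 := by
  have ex : ∀ y, ∃ n, p^[n] y = r := fun y => by
    induction hn : rk y using Nat.strong_induction_on generalizing y with
    | _ n ih =>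
      by_cases hy : y = r
      · exact ⟨0, hy⟩
      · obtain ⟨m, hm⟩ := ih (rk (p y)) (hn ▸ h.lt y hy) (p y) rfl
        exact ⟨m + 1, hm⟩
  refine ⟨fun y => Nat.find (ex y), fun v hv => Nat.find_comp_succ (ex v) (ex (p v)) hv, ?_⟩
  simp only [Nat.find_eq_zero]; rfl

lemma PT.cells [Fintype V] (h : PT G S r p rk) {q : ℕ} (hq : 1 ≤ q) : ∃ Z : Finset V, Z.card ≤ S.ncard / q + 2 ∧
    ∀ s ∈ S, ∃ j ≤ q, p^[j] s ∈ Z := by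
  obtain ⟨dp, hdp, hdr⟩ := h.depth
  have hit : ∀ j s, j ≤ dp s → dp (p^[j] s) = dp s - j := fun j => by
    induction j with
    | zero => intro s _; simp
    | succ j ih =>
      intro s hs
      have hne : s ≠ r := by rintro rfl; omega
      have := hdp s hne
      rw [Function.iterate_succ_apply, ih _ (by omega)]; omega
  have hS : ∀ j s, s ∈ S → p^[j] s ∈ S := fun j => by
    induction j with
    | zero => intro s hs; exact hs
    | succ j ih => intro s hs; rw [Function.iterate_succ_apply]; exact ih _ (h.cl s hs)
  have dz : ∀ s, dp s = 0 → s = r := fun s hs => by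
    by_contra hne; have := hdp s hne; omega
  obtain ⟨c, hcq, hcard⟩ := Finset.exists_card_fiber_le_of_card_le_mul (s := S.toFinset) (t := Finset.range q)
    (f := fun s => dp s % q) (n := S.ncard / q + 1) ⟨0, by simp; omega⟩ (by
      rw [Finset.card_range, ← Set.ncard_eq_toFinset_card']
      exact (Nat.lt_mul_div_succ _ (by omega)).le)
  rw [Finset.mem_range] at hcq
  refine ⟨insert r (S.toFinset.filter fun s => dp s % q = c), (Finset.card_insert_le _ _).trans (by omega), fun s hs => ?_⟩
  by_cases hlt : dp s < c
  · refine ⟨dp s, by omega, ?_⟩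
    rw [dz (p^[dp s] s) (by rw [hit _ _ le_rfl]; omega)]; simp
  · push Not at hlt
    have h1 := Nat.mod_le (dp s - c) q
    have h2 := Nat.mod_lt (dp s - c) (show q > 0 by omega)
    refine ⟨(dp s - c) % q, h2.le, ?_⟩
    simp only [Finset.mem_insert, Finset.mem_filter, Set.mem_toFinset]
    refine Or.inr ⟨hS _ _ hs, ?_⟩
    rw [hit _ _ (by omega)]
    have h3 := Nat.div_add_mod (dp s - c) q
    have : dp s - (dp s - c) % q = c + q * ((dp s - c) / q) := by omega
    rw [this, Nat.add_mul_mod_self_left, Nat.mod_eq_of_lt hcq]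

def XX (G : SimpleGraph V) (S : Set V) (p : V → V) (M : ℕ) : Set (V × V) :=
  {x | G.Adj x.1 x.2 ∧ ¬ (FF p).Adj x.1 x.2 ∧ x.1 ∈ sball G S (M + 1) ∧ x.2 ∈ sball G S (M + 1)}

lemma PT.extra_count [Fintype V] (h : PT G S r p rk) (hc : G.Connected) {q M R0 : ℕ} (hq : 1 ≤ q) (hR : 3 * (q + M + 1) + 1 ≤ R0)
    (hcyc : ∀ z, adjPairs G (gball G z R0) ≤ 2 * (gball G z R0).ncard) :
    (XX G S p M).ncard ≤ 4 * (S.ncard / q + 2) ^ 2 := by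
  obtain ⟨Z, hZ, hcov⟩ := h.cells hq
  have hcov' : ∀ y ∈ sball G S (M + 1), ∃ z ∈ Z, ∃ j ≤ q + M + 1, p^[j] y = z := fun y hy => by
    obtain ⟨j, hj, hz⟩ := hcov _ (h.out (M + 1) y hy)
    exact ⟨_, hz, j + (M + 1), by omega, by rw [Function.iterate_add_apply]⟩
  have hsub : XX G S p M ⊆ ⋃ zz ∈ Z ×ˢ Z, {x : V × V | G.Adj x.1 x.2 ∧ ¬ (FF p).Adj x.1 x.2 ∧
      (∃ j ≤ q + M + 1, p^[j] x.1 = zz.1) ∧ ∃ j ≤ q + M + 1, p^[j] x.2 = zz.2} := by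
    rintro x ⟨h1, h2, h3, h4⟩
    obtain ⟨z, hz, hz'⟩ := hcov' _ h3
    obtain ⟨w, hw, hw'⟩ := hcov' _ h4
    simp only [Set.mem_iUnion]
    exact ⟨(z, w), Finset.mk_mem_product hz hw, h1, h2, hz', hw'⟩
  refine (Set.ncard_le_ncard hsub (Set.toFinite _)).trans ((Finset.set_ncard_biUnion_le _ _).trans ?_)
  refine (Finset.sum_le_card_nsmul _ _ 4 fun zz _ => h.extra_class hc zz.1 zz.2 hR (hcyc _)).trans ?_
  rw [Finset.card_product, smul_eq_mul, mul_comm, ← sq]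
  gcongr

def EE (G : SimpleGraph V) (S : Set V) (p : V → V) (M : ℕ) : Set V :=
  {v | ∃ x ∈ XX G S p M, G.dist x.1 v ≤ M}

lemma EE_card [Fintype V] (hc : G.Connected) {b : ℕ} (hr : IsReg G (b + 1)) (S : Set V) (p : V → V) (M : ℕ) :
    (EE G S p M).ncard ≤ (XX G S p M).ncard * (b + 2) ^ M := by
  have hsub : EE G S p M ⊆ ⋃ x ∈ (XX G S p M).toFinset, {y | G.dist x.1 y ≤ M} := by
    rintro v ⟨x, hx, hv⟩
    simp only [Set.mem_iUnion, Set.mem_toFinset]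
    exact ⟨x, hx, hv⟩
  refine (Set.ncard_le_ncard hsub (Set.toFinite _)).trans ((Finset.set_ncard_biUnion_le _ _).trans ?_)
  refine (Finset.sum_le_card_nsmul _ _ _ fun x _ => ball_card (b := b) hc (fun v => ?_) x.1 M).trans ?_
  · exact (hr v).le
  · rw [← Set.ncard_eq_toFinset_card', smul_eq_mul]

lemma good_FF (hc : G.Connected) {M : ℕ} {v : V} (hv : v ∈ S) (hE : v ∉ EE G S p M) {y z : V} (hy : G.dist v y ≤ M)
    (hA : G.Adj y z) : (FF p).Adj y z := by
  by_contra hF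
  refine hE ⟨(y, z), ⟨hA, hF, ⟨v, hv, by show G.dist v y ≤ _; omega⟩, ⟨v, hv, ?_⟩⟩, by rw [G.dist_comm]; exact hy⟩
  have := dist_adj_le hc (x := v) hA
  show G.dist v z ≤ _
  omega

lemma PT.good_LT (h : PT G S r p rk) (hc : G.Connected) {M : ℕ} {v : V} (hv : v ∈ S) (hE : v ∉ EE G S p M) : LT G v M :=
  LT_of_forest hc h.acyclic fun _ _ hy hA => good_FF hc hv hE hy hA

lemma PT.good_dist (h : PT G S r p rk) (hc : G.Connected) {M : ℕ} {v : V} (hv : v ∈ S) (hE : v ∉ EE G S p M)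
    (D : V → ℕ) (hD : D v = 0) (hDp : ∀ s ∈ S, D (p s) ≤ D s + 1 ∧ D s ≤ D (p s) + 1) {u : V} (hu : u ∈ S)
    (hM : G.dist v u ≤ M) : D u ≤ G.dist v u := by
  obtain ⟨π, hπ, hπ'⟩ := h.retr
  have key : ∀ n y, G.dist v y = n → n ≤ M → D (π y) ≤ n := fun n => by
    induction n with
    | zero =>
      intro y hy _
      obtain rfl := (hc.dist_eq_zero_iff).1 hy
      rw [hπ _ hv, hD]
    | succ n ih =>
      intro y hy hn
      have hne : y ≠ v := by rintro rfl; simp at hy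
      obtain ⟨z, hz, hz2⟩ := exists_closer hc hne
      have h1 := ih z (by omega) (by omega)
      have hst : ∀ s, D (π (p s)) ≤ D (π s) + 1 ∧ D (π s) ≤ D (π (p s)) + 1 := fun s => by
        by_cases hs : s ∈ S
        · rw [hπ s hs, hπ _ (h.cl s hs)]; exact hDp s hs
        · rw [hπ' s hs]; omega
      rcases (good_FF hc hv hE (y := z) (by omega) hz.symm).2 with h2 | h2
      · have := hst z; rw [h2] at this; omega
      · have := hst y; rw [h2] at this; omega
  have := key _ u rfl hM
  rwa [hπ u hu] at this
end pt
end GFF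

namespace GFF
section pt
variable {V : Type*} {G : SimpleGraph V}

lemma PT_exists (hc : G.Connected) (f : ℕ → V) (n : ℕ) (pj : ℕ → ℕ)
    (hp : ∀ j, 1 ≤ j → j ≤ n → pj j < j ∧ G.Adj (f j) (f (pj j))) :
    ∃ p rk, PT G (f '' Iic n) (f 0) p rk ∧ ∀ s ∈ f '' Iic n, s ≠ f 0 → ∃ j, 1 ≤ j ∧ j ≤ n ∧ s = f j ∧ p s = f (pj j) := by
  set S := f '' Iic n with hS
  have h0S : f 0 ∈ S := ⟨0, by simp, rfl⟩
  have ei : ∀ v, v ∈ S → ∃ j, j ≤ n ∧ f j = v := fun v ⟨j, hj, h⟩ => ⟨j, hj, h⟩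
  have es : ∀ v, ∃ m, ∃ s ∈ S, G.dist s v ≤ m := fun v => ⟨_, f 0, h0S, le_rfl⟩
  set sd : V → ℕ := fun v => Nat.find (es v) with hsd
  have ec : ∀ v, ∃ w, v ∉ S → G.Adj v w ∧ sd w < sd v := fun v => by
    by_cases hv : v ∈ S
    · exact ⟨v, fun h => absurd hv h⟩
    obtain ⟨s, hs, hd⟩ := Nat.find_spec (es v)
    have hne : v ≠ s := by rintro rfl; exact hv hs
    obtain ⟨w, hw, hw2⟩ := exists_closer hc hne
    refine ⟨w, fun _ => ⟨hw, ?_⟩⟩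
    have : sd w ≤ G.dist s w := Nat.find_min' (es w) ⟨s, hs, le_rfl⟩
    have h2 : G.dist s v ≤ sd v := hd
    omega
  choose cl hcl using ec
  set idx : V → ℕ := fun v => if h : v ∈ S then Nat.find (ei v h) else 0 with hidx
  have idx_spec : ∀ v ∈ S, idx v ≤ n ∧ f (idx v) = v := fun v hv => by
    simp only [hidx, hv, dif_pos]; exact Nat.find_spec (ei v hv)
  have idx_le : ∀ j ≤ n, idx (f j) ≤ j := fun j hj => by
    have : f j ∈ S := ⟨j, hj, rfl⟩
    simp only [hidx, this, dif_pos]; exact Nat.find_min' (ei _ this) ⟨hj, rfl⟩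
  have idx_pos : ∀ v ∈ S, v ≠ f 0 → 1 ≤ idx v := fun v hv hne => by
    by_contra h
    have h0 : idx v = 0 := by omega
    have := (idx_spec v hv).2
    rw [h0] at this; exact hne this.symm
  set p : V → V := fun v => if v ∈ S then (if v = f 0 then f 0 else f (pj (idx v))) else cl v with hpdef
  have pS : ∀ v ∈ S, v ≠ f 0 → p v = f (pj (idx v)) := fun v hv hne => by simp [hpdef, hv, hne]
  have pN : ∀ v ∉ S, p v = cl v := fun v hv => by simp [hpdef, hv]
  have p0 : p (f 0) = f 0 := by simp [hpdef, h0S]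
  have pcl : ∀ v ∈ S, p v ∈ S := fun v hv => by
    by_cases hne : v = f 0
    · rw [hne, p0]; exact h0S
    · rw [pS v hv hne]
      have h1 := hp _ (idx_pos v hv hne) (idx_spec v hv).1
      have h2 := (idx_spec v hv).1
      exact ⟨_, by simp only [Set.mem_Iic]; omega, rfl⟩
  refine ⟨p, fun v => if v ∈ S then idx v else n + sd v, ⟨p0, h0S, fun v hv => ?_, fun v hv => ?_, pcl, ?_⟩, fun s hs hne => ?_⟩
  · by_cases hvS : v ∈ S
    · rw [pS v hvS hv]
      have h1 := (hp _ (idx_pos v hvS hv) (idx_spec v hvS).1).2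
      rwa [(idx_spec v hvS).2] at h1
    · rw [pN v hvS]; exact (hcl v hvS).1
  · by_cases hvS : v ∈ S
    · have h1 := (hp _ (idx_pos v hvS hv) (idx_spec v hvS).1).1
      have h2 := (idx_spec v hvS).1
      simp only [hvS, pcl v hvS, if_true]
      rw [pS v hvS hv]
      exact (idx_le _ (by omega)).trans_lt h1
    · have h1 := (hcl v hvS).2
      rw [pN v hvS]
      simp only [hvS, if_false]
      split_ifs with h2
      · have := (idx_spec _ h2).1; omega
      · omega
  · have key : ∀ m y, sd y ≤ m → p^[m] y ∈ S := fun m => by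
      induction m with
      | zero =>
        intro y hy
        obtain ⟨s, hs, hd⟩ := Nat.find_spec (es y)
        have h1 : G.dist s y ≤ sd y := hd
        have : G.dist s y = 0 := by omega
        obtain rfl := (hc.dist_eq_zero_iff).1 this
        exact hs
      | succ m ih =>
        intro y hy
        rw [Function.iterate_succ_apply]
        apply ih
        by_cases hyS : y ∈ S
        · have : sd (p y) ≤ 0 := Nat.find_min' (es _) ⟨p y, pcl y hyS, by simp⟩
          omega
        · rw [pN y hyS]; have := (hcl y hyS).2; omega
    intro m y hy
    exact key m y (Nat.find_min' (es y) hy)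
  · exact ⟨idx s, idx_pos s hs hne, (idx_spec s hs).1, (idx_spec s hs).2.symm, pS s hs hne⟩

/-- parent index -/
def pj (ℓ : ℕ) (a : ℕ → ℕ) (j : ℕ) : ℕ := if (j - 1) % ℓ = 0 then a ((j - 1) / ℓ) else j - 1

lemma pj_eq {ℓ : ℕ} (a : ℕ → ℕ) (i : ℕ) {t : ℕ} (ht : t < ℓ) : pj ℓ a (i * ℓ + t + 1) = if t = 0 then a i else i * ℓ + t := by
  have h1 : (i * ℓ + t) % ℓ = t := by rw [Nat.add_comm, Nat.add_mul_mod_self_right, Nat.mod_eq_of_lt ht]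
  have h2 : (i * ℓ + t) / ℓ = i := by
    rw [Nat.add_comm, Nat.add_mul_div_right _ _ (by omega), Nat.div_eq_of_lt ht, zero_add]
  simp only [pj, Nat.add_sub_cancel, h1, h2]

lemma decomp {ℓ k j : ℕ} (hℓ : 1 ≤ ℓ) (h1 : 1 ≤ j) (hj : j ≤ k * ℓ) : ∃ i t, i < k ∧ t < ℓ ∧ j = i * ℓ + t + 1 := by
  refine ⟨(j - 1) / ℓ, (j - 1) % ℓ, ?_, Nat.mod_lt _ (by omega), ?_⟩
  · rw [Nat.div_lt_iff_lt_mul (by omega)]; omega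
  · have := Nat.div_add_mod' (j - 1) ℓ; omega

def Val (G : SimpleGraph V) (L R k J : ℕ) (f : ℕ → V) : Prop := ∃ I0 : Finset (Fin k), k ≤ I0.card + J ∧
  (∀ i ∈ I0, ∀ t ≤ R, LT G (f (i * (R + 2 * L) + (2 * L + t))) (R + 2 * L)) ∧
  (∀ i ∈ I0, ∀ s t, s ≤ t → t ≤ R → G.dist (f (i * (R + 2 * L) + (2 * L + s))) (f (i * (R + 2 * L) + (2 * L + t))) = t - s) ∧
  (∀ i ∈ I0, ∀ i' ∈ I0, i ≠ i' → ∀ s ≤ R, ∀ t ≤ R,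
    2 * L ≤ G.dist (f (i * (R + 2 * L) + (2 * L + s))) (f (i' * (R + 2 * L) + (2 * L + t))))

structure Cod (G : SimpleGraph V) (ℓ n : ℕ) (a : ℕ → ℕ) (f : ℕ → V) : Prop where
  adj : ∀ j, 1 ≤ j → j ≤ n → pj ℓ a j < j ∧ G.Adj (f j) (f (pj ℓ a j))
  nb : ∀ j, 1 ≤ j → j ≤ n → (j - 1) % ℓ ≠ 0 → f j ≠ f (pj ℓ a (pj ℓ a j))

section
variable {C : Set V} {ℓ k : ℕ} {e : ℕ → C} {a : ℕ → ℕ}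

lemma Stp_adj (hH : (G.induce C).Connected) (hℓ : 1 ≤ ℓ) (hs : ∀ i < k, Stp (G.induce C) ℓ e a i) {j : ℕ}
    (h1 : 1 ≤ j) (hj : j ≤ k * ℓ) : pj ℓ a j < j ∧ (G.induce C).Adj (e j) (e (pj ℓ a j)) := by
  obtain ⟨i, t, hi, ht, rfl⟩ := decomp hℓ h1 hj
  have hS := hs i hi
  rw [pj_eq a i ht]
  refine ⟨?_, ?_⟩
  · split_ifs
    · have := hS.le; omega
    · omega
  · have h2 := hS.geo t (t + 1) (by omega) (by omega)
    rw [show t + 1 - t = 1 by omega, SimpleGraph.dist_eq_one_iff_adj] at h2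
    have h3 := h2.symm
    simp only [pc, Nat.succ_ne_zero, if_false] at h3
    split_ifs at h3 ⊢ <;> exact h3

lemma Stp_cod (hH : (G.induce C).Connected) (hℓ : 1 ≤ ℓ) (hs : ∀ i < k, Stp (G.induce C) ℓ e a i) :
    Cod G ℓ (k * ℓ) a (fun j => (e j : V)) := by
  refine ⟨fun j h1 hj => Stp_adj hH hℓ hs h1 hj, fun j h1 hj hm heq => ?_⟩
  obtain ⟨i, t, hi, ht, rfl⟩ := decomp hℓ h1 hj
  have hS := hs i hi
  have ht0 : t ≠ 0 := by
    rintro rfl; apply hm; simp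
  obtain ⟨t, rfl⟩ := Nat.exists_eq_succ_of_ne_zero ht0
  rw [pj_eq a i ht, if_neg ht0, show i * ℓ + t.succ = i * ℓ + t + 1 from rfl, pj_eq a i (by omega)] at heq
  have h2 := hS.geo t (t + 2) (by omega) (by omega)
  have h3 : pc ℓ e a i t = pc ℓ e a i (t + 2) := by
    simp only [pc]
    rw [if_neg (by omega : ¬ (t + 2 = 0))]
    refine Subtype.ext ?_
    rw [show i * ℓ + (t + 2) = i * ℓ + t + 1 + 1 by ring, heq]
    split_ifs <;> rfl
  rw [h3] at h2
  simp at h2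

lemma Stp_val [Fintype V] {b : ℕ} (hc : G.Connected) (hr : IsReg G (b + 1)) (hH : (G.induce C).Connected) {L R : ℕ}
    (hL : 1 ≤ L) (hℓ : ℓ = R + 2 * L) (hs : ∀ i < k, Stp (G.induce C) ℓ e a i) {q R0 : ℕ} (hq : 1 ≤ q)
    (hR : 3 * (q + ℓ + 1) + 1 ≤ R0)
    (hcyc : ∀ z, adjPairs G (gball G z R0) ≤ 2 * (gball G z R0).ncard) :
    Val G L R k (4 * ((k * ℓ + 1) / q + 2) ^ 2 * (b + 2) ^ ℓ) (fun j => (e j : V)) := by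
  have hℓ1 : 1 ≤ ℓ := by omega
  set f : ℕ → V := fun j => (e j : V) with hf
  obtain ⟨p, rk, hPT, hps⟩ := PT_exists hc f (k * ℓ) (pj ℓ a) (Stp_cod hH hℓ1 hs).adj
  set S := f '' Iic (k * ℓ) with hS
  have hSc : S.ncard ≤ k * ℓ + 1 := by
    refine (Set.ncard_image_le (Set.finite_Iic _)).trans ?_
    simp [Set.ncard_eq_toFinset_card']
  have hE : (EE G S p ℓ).ncard ≤ 4 * ((k * ℓ + 1) / q + 2) ^ 2 * (b + 2) ^ ℓ := by
    refine (EE_card hc hr S p ℓ).trans ?_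
    gcongr
    refine (hPT.extra_count hc hq hR hcyc).trans ?_
    gcongr
  have hle : ∀ u v : C, G.dist (u : V) v ≤ (G.induce C).dist u v := fun u v => by
    obtain ⟨w, hw⟩ := hH.exists_walk_length_eq_dist u v
    rw [← hw]
    have := SimpleGraph.dist_le (w.map (SimpleGraph.Embedding.induce C).toHom)
    rwa [SimpleGraph.Walk.length_map] at this
  have hmem : ∀ j ≤ k * ℓ, f j ∈ S := fun j hj => ⟨j, hj, rfl⟩
  have hgd : ∀ u v : C, (u : V) ∈ S → (v : V) ∈ S → (u : V) ∉ EE G S p ℓ → G.dist (u : V) v ≤ ℓ →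
      (G.induce C).dist u v ≤ G.dist (u : V) v := fun u v hu hv huE hd => by
    have := hPT.good_dist hc hu huE (fun y => if h : y ∈ C then (G.induce C).dist u ⟨y, h⟩ else 0) (by simp)
      (fun s hsS => ?_) hv hd
    · simpa using this
    · by_cases hne : s = f 0
      · rw [hne, hPT.root]; omega
      · obtain ⟨j, hj1, hj2, rfl, hj3⟩ := hps s hsS hne
        have hA := (Stp_adj hH hℓ1 hs hj1 hj2).2
        rw [hj3]
        simp only [hf, Subtype.coe_prop, dif_pos]
        exact ⟨dist_adj_le hH hA, dist_adj_le hH hA.symm⟩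
  have hidx : ∀ i < k, ∀ t ≤ R, i * ℓ + (2 * L + t) ≤ k * ℓ := fun i hi t ht => by
    have : (i + 1) * ℓ ≤ k * ℓ := Nat.mul_le_mul_right _ hi
    rw [add_mul] at this; omega
  have hpc : ∀ i t, pc ℓ e a i (2 * L + t) = e (i * ℓ + (2 * L + t)) := fun i t => by
    simp only [pc]; rw [if_neg (by omega)]
  have hsep : ∀ i i', i < i' → i' < k → ∀ s ≤ R, ∀ t ≤ R,
      2 * L ≤ (G.induce C).dist (e (i' * ℓ + (2 * L + t))) (e (i * ℓ + (2 * L + s))) := fun i i' hlt hi' s hs' t ht => by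
    have h1 := (hs i' hi').sep (2 * L + t) (by omega) (i * ℓ + (2 * L + s)) (by
      have : (i + 1) * ℓ ≤ i' * ℓ := Nat.mul_le_mul_right _ hlt
      rw [add_mul] at this; omega)
    rw [hpc] at h1; omega
  refine ⟨Finset.univ.filter fun i : Fin k => ∀ t ≤ R, f (i * ℓ + (2 * L + t)) ∉ EE G S p ℓ, ?_, ?_, ?_, ?_⟩
  · have h1 := Finset.card_filter_add_card_filter_not (s := (Finset.univ : Finset (Fin k))) (fun i : Fin k => ∀ t ≤ R, f (i * ℓ + (2 * L + t)) ∉ EE G S p ℓ)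
    rw [Finset.card_univ, Fintype.card_fin] at h1
    have h2 : (Finset.univ.filter fun i : Fin k => ¬ ∀ t ≤ R, f (i * ℓ + (2 * L + t)) ∉ EE G S p ℓ).card ≤ (EE G S p ℓ).ncard := by
      have hch : ∀ i : Fin k, ∃ t, t ≤ R ∧ ((¬ ∀ t ≤ R, f (i * ℓ + (2 * L + t)) ∉ EE G S p ℓ) → f (i * ℓ + (2 * L + t)) ∈ EE G S p ℓ) := fun i => by
        by_cases h : ∀ t ≤ R, f (i * ℓ + (2 * L + t)) ∉ EE G S p ℓ
        · exact ⟨0, by omega, fun h' => absurd h h'⟩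
        · push Not at h
          obtain ⟨t, ht, h⟩ := h
          exact ⟨t, ht, fun _ => h⟩
      choose τ hτ hτE using hch
      rw [Set.ncard_eq_toFinset_card']
      refine Finset.card_le_card_of_injOn (fun i => f (i * ℓ + (2 * L + τ i))) (fun i hi => ?_) fun i hi i' hi' heq => ?_
      · simp only [Finset.coe_filter, Finset.mem_univ, true_and, Set.mem_ofPred_eq] at hi
        simp only [Set.coe_toFinset]
        exact hτE i hi
      · by_contra hne
        have heq' : e (i * ℓ + (2 * L + τ i)) = e (i' * ℓ + (2 * L + τ i')) := Subtype.ext heq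
        rcases lt_or_gt_of_ne (fun h => hne (Fin.ext h) : (i : ℕ) ≠ i') with h | h
        · have := hsep i i' h i'.2 _ (hτ i) _ (hτ i')
          rw [heq'] at this; simp at this; omega
        · have := hsep i' i h i.2 _ (hτ i') _ (hτ i)
          rw [heq'] at this; simp at this; omega
    omega
  · intro i hi t ht
    rw [← hℓ]
    exact hPT.good_LT hc (hmem _ (hidx i i.2 t ht)) ((Finset.mem_filter.1 hi).2 t ht)
  · intro i hi s t hst ht
    rw [← hℓ]
    have h1 := (hs i i.2).geo (2 * L + s) (2 * L + t) (by omega) (by omega)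
    rw [hpc, hpc] at h1
    have h2 := hle (e (i * ℓ + (2 * L + s))) (e (i * ℓ + (2 * L + t)))
    have h3 := hgd (e (i * ℓ + (2 * L + s))) (e (i * ℓ + (2 * L + t))) (hmem _ (hidx i i.2 s (by omega))) (hmem _ (hidx i i.2 t ht))
      ((Finset.mem_filter.1 hi).2 s (by omega)) (by omega)
    show G.dist (e (i * ℓ + (2 * L + s)) : V) (e (i * ℓ + (2 * L + t)) : V) = _
    omega
  · intro i hi i' hi' hne s hs' t ht
    rw [← hℓ]
    show _ ≤ G.dist (e (i * ℓ + (2 * L + s)) : V) (e (i' * ℓ + (2 * L + t)) : V)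
    by_contra hcon
    push Not at hcon
    have h3 := hgd (e (i * ℓ + (2 * L + s))) (e (i' * ℓ + (2 * L + t))) (hmem _ (hidx i i.2 s hs')) (hmem _ (hidx i' i'.2 t ht))
      ((Finset.mem_filter.1 hi).2 s hs') (by omega)
    rcases lt_or_gt_of_ne (fun h => hne (Fin.ext h) : (i : ℕ) ≠ i') with h | h
    · have := hsep i i' h i'.2 s hs' t ht
      rw [SimpleGraph.dist_comm] at this; omega
    · have := hsep i' i h i.2 t ht s hs'
      omega
end
end pt
end GFF

namespace GFF

noncomputable def trc {W : Type*} (n : ℕ) (x : W) (f : ℕ → W) : ℕ → W := fun j => if j ≤ n then f j else x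

lemma mono_count (k : ℕ) : ∀ m : ℕ, ∃ F : Finset (ℕ → ℕ), F.card ≤ (m + k).choose k ∧
    ∀ a : ℕ → ℕ, (∀ i j, i ≤ j → j < k → a i ≤ a j) → (∀ i < k, a i ≤ m) → (fun i => if i < k then a i else 0) ∈ F := by
  induction k with
  | zero => exact fun m => ⟨{fun _ => 0}, by simp, by simp⟩
  | succ k ih =>
    intro m
    choose F hF hm using ih
    refine ⟨(Finset.range (m + 1)).biUnion fun v => (F v).image fun g => Function.update g k v, ?_, fun a ha hb => ?_⟩
    · refine Finset.card_biUnion_le.trans ?_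
      rw [← add_assoc, ← Nat.sum_range_add_choose]
      exact Finset.sum_le_sum fun v _ => Finset.card_image_le.trans (hF v)
    · rw [Finset.mem_biUnion]
      refine ⟨a k, Finset.mem_range.2 (Nat.lt_succ_of_le (hb k (by omega))), Finset.mem_image.2
        ⟨_, hm (a k) a (fun i j h1 h2 => ha i j h1 (by omega)) (fun i hi => ha i k (by omega) (by omega)), ?_⟩⟩
      funext i
      by_cases hi : i = k
      · subst hi; simp
      · rw [Function.update_of_ne hi]
        have : i < k + 1 ↔ i < k := by omega
        simp [this]

lemma choose_bd {ℓ : ℕ} (hℓ : 1 ≤ ℓ) (k : ℕ) : (((k * ℓ + k).choose k : ℕ) : ℝ) ≤ (8 * ℓ) ^ k := by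
  have hl : (1 : ℝ) ≤ ℓ := by exact_mod_cast hℓ
  have h1 : (((k * ℓ + k).choose k : ℕ) : ℝ) * (1 / (ℓ : ℝ)) ^ k ≤ (1 / (ℓ : ℝ) + 1) ^ (k * ℓ + k) := by
    rw [add_pow]
    refine le_trans (le_of_eq ?_) (Finset.single_le_sum (f := fun m => (1 / (ℓ : ℝ)) ^ m * 1 ^ (k * ℓ + k - m) * ((k * ℓ + k).choose m))
      (fun i _ => by positivity) (Finset.mem_range.2 (by omega : k < k * ℓ + k + 1)))
    simp [mul_comm]
  have h2 : (1 / (ℓ : ℝ) + 1) ^ (k * ℓ + k) ≤ 8 ^ k := by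
    have : k * ℓ + k = (ℓ + 1) * k := by ring
    rw [this, pow_mul]
    gcongr
    calc (1 / (ℓ : ℝ) + 1) ^ (ℓ + 1) ≤ (Real.exp (1 / ℓ)) ^ (ℓ + 1) := by
          gcongr; exact Real.add_one_le_exp _
      _ = Real.exp ((ℓ + 1 : ℕ) * (1 / ℓ)) := by rw [Real.exp_nat_mul]
      _ ≤ Real.exp 2 := by
          gcongr
          push_cast
          rw [mul_one_div, div_le_iff₀ (by linarith)]; linarith
      _ ≤ 8 := by
          have : (2 : ℝ) = 1 + 1 := by norm_num
          rw [this, Real.exp_add]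
          nlinarith [Real.exp_one_lt_d9, Real.exp_pos 1]
  have h3 := h1.trans h2
  rw [one_div, inv_pow, ← div_eq_mul_inv, div_le_iff₀ (by positivity)] at h3
  rwa [mul_pow]

section
variable {V : Type*} {G : SimpleGraph V} {b ℓ : ℕ}

lemma f_count (hr : IsReg G (b + 1)) (x : V) (a : ℕ → ℕ) (n : ℕ) :
    ∃ F : Finset (ℕ → V), F.card ≤ ∏ j ∈ Finset.range n, (if j % ℓ = 0 then b + 1 else b) ∧
      ∀ f : ℕ → V, f 0 = x → Cod G ℓ n a f → trc n x f ∈ F := by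
  induction n with
  | zero =>
    refine ⟨{fun _ => x}, by simp, fun f h0 _ => ?_⟩
    rw [Finset.mem_singleton]
    funext j
    rw [trc]
    split_ifs with h
    · rw [Nat.le_zero.1 h, h0]
    · rfl
  | succ n ih =>
    obtain ⟨F, hF, hm⟩ := ih
    set S : (ℕ → V) → Finset V := fun g => if n % ℓ = 0 then nb G (g (pj ℓ a (n + 1))) else
      (if G.Adj (g (pj ℓ a (n + 1))) (g (pj ℓ a (pj ℓ a (n + 1)))) then
        (nb G (g (pj ℓ a (n + 1)))).erase (g (pj ℓ a (pj ℓ a (n + 1)))) else ∅) with hS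
    have hSc : ∀ g, (S g).card ≤ if n % ℓ = 0 then b + 1 else b := fun g => by
      rw [hS]
      dsimp only
      split_ifs with h1 h2
      · rw [card_nb hr]
      · rw [Finset.card_erase_of_mem ((mem_nb hr).2 h2), card_nb hr]; omega
      · simp
    refine ⟨F.biUnion fun g => (S g).image fun z => Function.update g (n + 1) z, ?_, fun f h0 hf => ?_⟩
    · refine Finset.card_biUnion_le.trans ?_
      rw [Finset.prod_range_succ]
      calc _ ≤ ∑ g ∈ F, (if n % ℓ = 0 then b + 1 else b) :=
            Finset.sum_le_sum fun g _ => Finset.card_image_le.trans (hSc g)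
        _ = F.card * (if n % ℓ = 0 then b + 1 else b) := by rw [Finset.sum_const, smul_eq_mul]
        _ ≤ _ := Nat.mul_le_mul_right _ hF
    · rw [Finset.mem_biUnion]
      refine ⟨_, hm f h0 ⟨fun j h1 h2 => hf.adj j h1 (by omega), fun j h1 h2 => hf.nb j h1 (by omega)⟩, Finset.mem_image.2 ⟨f (n + 1), ?_, ?_⟩⟩
      · have hA := hf.adj (n + 1) (by omega) le_rfl
        have e1 : trc n x f (pj ℓ a (n + 1)) = f (pj ℓ a (n + 1)) := by rw [trc, if_pos (by omega)]
        rw [hS]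
        dsimp only
        split_ifs with h1 h2
        · rw [mem_nb hr, e1]; exact hA.2.symm
        · have hne := hf.nb (n + 1) (by omega) le_rfl (by simpa using h1)
          rw [Finset.mem_erase, mem_nb hr, e1]
          refine ⟨?_, hA.2.symm⟩
          have : pj ℓ a (n + 1) = n := by rw [pj]; simp [h1]
          rw [this] at hne ⊢
          have hn : 1 ≤ n := by
            rcases Nat.eq_zero_or_pos n with h | h
            · subst h; simp at h1
            · exact h
          have hB := hf.adj n hn (by omega)
          rw [trc, if_pos (by omega)]; exact hne
        · exfalso
          apply h2
          have : pj ℓ a (n + 1) = n := by rw [pj]; simp [h1]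
          have hn : 1 ≤ n := by
            rcases Nat.eq_zero_or_pos n with h | h
            · subst h; simp at h1
            · exact h
          have hB := hf.adj n hn (by omega)
          rw [this, trc, trc, if_pos le_rfl, if_pos (by omega)]
          exact hB.2
      · funext j
        by_cases hj : j = n + 1
        · subst hj; simp [trc]
        · rw [Function.update_of_ne hj]
          have : j ≤ n + 1 ↔ j ≤ n := by omega
          simp [trc, this]

lemma prod_bd (hb : 1 ≤ b) (hℓ : 1 ≤ ℓ) (k : ℕ) :
    ∏ j ∈ Finset.range (k * ℓ), (if j % ℓ = 0 then b + 1 else b) ≤ 2 ^ k * b ^ (k * ℓ) := by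
  induction k with
  | zero => simp
  | succ k ih =>
    rw [Nat.succ_mul, Finset.prod_range_add, pow_succ, pow_add]
    have : ∏ j ∈ Finset.range ℓ, (if (k * ℓ + j) % ℓ = 0 then b + 1 else b) ≤ 2 * b ^ ℓ := by
      obtain ⟨m, rfl⟩ : ∃ m, ℓ = m + 1 := ⟨ℓ - 1, by omega⟩
      rw [Finset.prod_range_succ']
      have : ∀ j ∈ Finset.range m, (if (k * (m + 1) + (j + 1)) % (m + 1) = 0 then b + 1 else b) = b := fun j hj => by
        rw [Finset.mem_range] at hj
        rw [if_neg]
        rw [mul_comm, Nat.mul_add_mod, Nat.mod_eq_of_lt (by omega)]; omega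
      rw [Finset.prod_congr rfl this]
      simp only [Finset.prod_const, Finset.card_range, add_zero, Nat.mul_mod_left, if_true]
      rw [pow_succ]
      have h0 : 0 ≤ b ^ m := Nat.zero_le _
      nlinarith
    calc _ ≤ (2 ^ k * b ^ (k * ℓ)) * (2 * b ^ ℓ) := Nat.mul_le_mul ih this
      _ = _ := by ring

lemma count (hr : IsReg G (b + 1)) (hb : 1 ≤ b) (hℓ : 1 ≤ ℓ) (x : V) (k : ℕ) : ∃ F : Finset (ℕ → V),
    (F.card : ℝ) ≤ (16 * ℓ * (b : ℝ) ^ ℓ) ^ k ∧ ∀ f a, f 0 = x → (∀ i j, i ≤ j → j < k → a i ≤ a j) → (∀ i < k, a i ≤ i * ℓ) →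
      Cod G ℓ (k * ℓ) a f → trc (k * ℓ) x f ∈ F := by
  obtain ⟨A, hA, hAm⟩ := mono_count k (k * ℓ)
  choose F hF hm using fun a => f_count (ℓ := ℓ) hr x a (k * ℓ)
  refine ⟨A.biUnion F, ?_, fun f a h0 h1 h2 hc => ?_⟩
  · have h1 : (A.biUnion F).card ≤ (k * ℓ + k).choose k * (2 ^ k * b ^ (k * ℓ)) := by
      refine Finset.card_biUnion_le.trans ?_
      calc _ ≤ ∑ a ∈ A, 2 ^ k * b ^ (k * ℓ) := Finset.sum_le_sum fun a _ => (hF a).trans (prod_bd hb hℓ k)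
        _ = A.card * (2 ^ k * b ^ (k * ℓ)) := by rw [Finset.sum_const, smul_eq_mul]
        _ ≤ _ := Nat.mul_le_mul_right _ hA
    have h2 : ((A.biUnion F).card : ℝ) ≤ ((k * ℓ + k).choose k : ℕ) * (2 ^ k * (b : ℝ) ^ (k * ℓ)) := by exact_mod_cast h1
    refine h2.trans ((mul_le_mul_of_nonneg_right (choose_bd hℓ k) (by positivity)).trans (le_of_eq ?_))
    rw [mul_comm k ℓ, pow_mul, ← mul_pow, ← mul_pow]; congr 1; ring
  · rw [Finset.mem_biUnion]
    refine ⟨_, hAm a h1 fun i hi => (h2 i hi).trans (Nat.mul_le_mul_right _ hi.le), hm _ f h0 ?_⟩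
    set a' : ℕ → ℕ := fun i => if i < k then a i else 0
    have hp : ∀ j, j - 1 < k * ℓ → pj ℓ a' j = pj ℓ a j := fun j hj => by
      rw [pj, pj]
      have : (j - 1) / ℓ < k := Nat.div_lt_of_lt_mul (by rwa [mul_comm])
      simp [a', this]
    refine ⟨fun j h1 h2 => ?_, fun j h1 h2 h3 => ?_⟩
    · rw [hp j (by omega)]; exact hc.adj j h1 h2
    · rw [hp j (by omega), hp _ (by have := (hc.adj j h1 h2).1; omega)]; exact hc.nb j h1 h2 h3
end
end GFF

namespace GFF
section
variable {V : Type*} {G : SimpleGraph V} {b : ℕ} {μ : Measure (V → ℝ)} {K : V → V → ℝ} {ν : ℝ}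
variable {T : Type*} {Gt : SimpleGraph T} {μT : Measure (T → ℝ)} {KT : T → T → ℝ} {νT : ℝ}

lemma seg_prob (hμ : IsGaussianField μ K) (hh : Harm μ G b ν) (hr : IsReg G (b + 1)) (hc : G.Connected)
    (hμT : IsGaussianField μT KT) (hhT : Harm μT Gt b νT) (hrT : IsReg Gt (b + 1)) (hcT : Gt.Connected)
    (haT : Gt.IsAcyclic) {L R : ℕ} {y : ℕ → V} (hy : ∀ t ≤ R, LT G (y t) (R + 2 * L))
    (hyd : ∀ s t, s ≤ t → t ≤ R → G.dist (y s) (y t) = t - s) {z : ℕ → T}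
    (hzd : ∀ s t, s ≤ t → t ≤ R → Gt.dist (z s) (z t) = t - s) (h : ℝ) :
    μ.real {ω | ∀ i ≤ R, h ≤ lin (sL G b L (y i)) ω} = μT.real {ω | ∀ i ≤ R, h ≤ lin (sL Gt b L (z i)) ω} := by
  have key : ∀ i j : Fin (R + 1), E2 μ (sL G b L (y i)) (sL G b L (y j)) = E2 μT (sL Gt b L (z i)) (sL Gt b L (z j)) := by
    have : ∀ s t, s ≤ t → t ≤ R → E2 μ (sL G b L (y s)) (sL G b L (y t)) = E2 μT (sL Gt b L (z s)) (sL Gt b L (z t)) := by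
      intro s t hst ht
      rw [sL_LT hμ hh hr hc (hy s (by omega)) (by rw [hyd s t hst ht]; omega),
        sL_LT hμT hhT hrT hcT (tree_LT hcT haT (z s) (R + 2 * L)) (by rw [hzd s t hst ht]; omega), hyd s t hst ht, hzd s t hst ht]
    intro i j
    rcases le_total i.1 j.1 with hij | hij
    · exact this _ _ hij (by omega)
    · rw [E2_comm, this _ _ hij (by omega), E2_comm]
  have hl := lin_law_eq hμ hμT (fun i : Fin (R + 1) => sL G b L (y i)) (fun i => sL Gt b L (z i)) key
  have hm : MeasurableSet {v : Fin (R + 1) → ℝ | ∀ i, h ≤ v i} := by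
    simp only [Set.ofPred_forall]
    exact MeasurableSet.iInter fun i => measurableSet_le measurable_const (measurable_pi_apply i)
  have e : ∀ (g : ℕ → ℝ), (∀ i ≤ R, h ≤ g i) ↔ ∀ i : Fin (R + 1), h ≤ g i := fun g =>
    ⟨fun H i => H i (by omega), fun H i hi => H ⟨i, by omega⟩⟩
  have h1 := congrArg (fun m => m.real {v : Fin (R + 1) → ℝ | ∀ i, h ≤ v i}) hl
  rw [map_measureReal_apply (measurable_pi_lambda _ fun i => lin_meas _) hm,
    map_measureReal_apply (measurable_pi_lambda _ fun i => lin_meas _) hm] at h1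
  convert h1 using 2
  · ext ω; exact e fun i => lin (sL G b L (y i)) ω
  · ext ω; exact e fun i => lin (sL Gt b L (z i)) ω

lemma open_prob (hμ : IsGaussianField μ K) (hh : Harm μ G b ν) (hr : IsReg G (b + 1)) (hc : G.Connected)
    {L R k : ℕ} (y : Fin k → ℕ → V) (I : Finset (Fin k)) {h δ : ℝ}
    (hf : ∀ i ∈ I, ∀ i' ∈ I, i ≠ i' → ∀ s ≤ R, ∀ t ≤ R, 2 * L ≤ G.dist (y i s) (y i' t))
    (hs : ∀ i ∈ I, μ.real {ω | ∀ t ≤ R, h ≤ lin (sL G b L (y i t)) ω} ≤ δ) :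
    μ.real {ω | ∀ i ∈ I, ∀ t ≤ R, h ≤ lin (sL G b L (y i t)) ω} ≤ δ ^ I.card := by
  have := hμ.1
  have hi := lin_indep_blocks hμ (ι := I) (κ := fun _ => Fin (R + 1)) (fun i t => sL G b L (y i t))
    (fun i j hij s t => sL_far hμ hh hr hc (hf i i.2 j j.2 (fun h => hij (Subtype.ext h)) _ (by omega) _ (by omega)))
  have hm : MeasurableSet {v : Fin (R + 1) → ℝ | ∀ i, h ≤ v i} := by
    simp only [Set.ofPred_forall]
    exact MeasurableSet.iInter fun i => measurableSet_le measurable_const (measurable_pi_apply i)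
  have h1 := hi.measure_inter_preimage_eq_mul Finset.univ (sets := fun _ => {v : Fin (R + 1) → ℝ | ∀ i, h ≤ v i}) (fun _ _ => hm)
  have e : ∀ (g : ℕ → ℝ), (∀ i ≤ R, h ≤ g i) ↔ ∀ i : Fin (R + 1), h ≤ g i := fun g =>
    ⟨fun H i => H i (by omega), fun H i hi => H ⟨i, by omega⟩⟩
  have h2 : {ω | ∀ i ∈ I, ∀ t ≤ R, h ≤ lin (sL G b L (y i t)) ω} =
      ⋂ i ∈ (Finset.univ : Finset I), (fun ω (k : Fin (R + 1)) => lin (sL G b L (y i k)) ω) ⁻¹' {v | ∀ i, h ≤ v i} := by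
    ext ω
    simp only [Set.mem_iInter, Set.mem_preimage, Set.mem_ofPred_eq, Finset.mem_univ, true_imp_iff, Subtype.forall]
    exact forall₂_congr fun i _ => e fun t => lin (sL G b L (y i t)) ω
  rw [h2, measureReal_def, h1, ENNReal.toReal_prod]
  calc _ ≤ ∏ i : I, δ := by
        refine Finset.prod_le_prod (fun _ _ => ENNReal.toReal_nonneg) fun i _ => ?_
        refine le_trans (le_of_eq ?_) (hs i i.2)
        rw [measureReal_def]
        congr 2
        ext ω
        exact (e fun t => lin (sL G b L (y i t)) ω).symm
    _ = _ := by simp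

lemma bad_prob (hμ : IsGaussianField μ K) {L : ℕ} {s ε : ℝ} (hs : 0 < s) (hε : 0 < ε)
    (hE : ∀ I : Finset V, E2 μ ((Q G b ^ L) (∑ x ∈ I, sg x)) ((Q G b ^ L) (∑ x ∈ I, sg x)) ≤ I.card * s) (I : Finset V) :
    μ.real {ω | ∀ z ∈ I, ε ≤ lin ((Q G b ^ L) (sg z)) ω} ≤ (Real.exp (-(ε ^ 2 / (2 * s)))) ^ I.card := by
  have := hμ.1
  rcases I.eq_empty_or_nonempty with rfl | hne
  · simp
  have hc : (0 : ℝ) < I.card := by exact_mod_cast hne.card_pos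
  have h1 := lin_tail hμ ((Q G b ^ L) (∑ x ∈ I, sg x)) (s := I.card * s) (t := I.card * ε) (by positivity) (by positivity) (hE I)
  rw [← Real.exp_nat_mul]
  refine le_trans (measureReal_mono (fun ω hω => ?_) (measure_ne_top _ _)) (h1.trans (le_of_eq ?_))
  · simp only [Set.mem_ofPred_eq] at hω ⊢
    rw [map_sum, lin_sum, ← nsmul_eq_mul]
    exact Finset.card_nsmul_le_sum _ _ _ hω
  · congr 1; field_simp

lemma val_prob (hμ : IsGaussianField μ K) (hh : Harm μ G b ν) (hr : IsReg G (b + 1)) (hc : G.Connected)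
    {L R k J u w : ℕ} (hL : 1 ≤ L) {s ε h δ : ℝ} (hs : 0 < s) (hε : 0 < ε)
    (hE : ∀ I : Finset V, E2 μ ((Q G b ^ L) (∑ x ∈ I, sg x)) ((Q G b ^ L) (∑ x ∈ I, sg x)) ≤ I.card * s)
    (hδ : ∀ y : ℕ → V, (∀ t ≤ R, LT G (y t) (R + 2 * L)) → (∀ s t, s ≤ t → t ≤ R → G.dist (y s) (y t) = t - s) →
      μ.real {ω | ∀ i ≤ R, h - ε ≤ lin (sL G b L (y i)) ω} ≤ δ)
    {f : ℕ → V} (hv : Val G L R k J f) (hk : u + w + J ≤ k + 1) (hδ0 : 0 ≤ δ) :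
    μ.real {ω | ∀ j ≤ k * (R + 2 * L), h ≤ ω (f j)} ≤
      (2 * (R + 1)) ^ k * (Real.exp (-(ε ^ 2 / (2 * s)))) ^ u + 2 ^ k * δ ^ w := by
  have := hμ.1
  obtain ⟨I0, hI0, hlt, hdist, hsep⟩ := hv
  set y : Fin k → ℕ → V := fun i t => f (i * (R + 2 * L) + (2 * L + t)) with hy
  set p := Real.exp (-(ε ^ 2 / (2 * s))) with hp
  have hinj : ∀ τ : Fin k → Fin (R + 1), Set.InjOn (fun i => y i (τ i)) (I0 : Set (Fin k)) := by
    intro τ i hi j hj hij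
    by_contra hne
    have := hsep i hi j hj hne (τ i) (by omega) (τ j) (by omega)
    change y i (τ i) = y j (τ j) at hij
    change 2 * L ≤ G.dist (y i (τ i)) (y j (τ j)) at this
    rw [hij, SimpleGraph.dist_self] at this
    omega
  set B : Finset (Fin k) × (Fin k → Fin (R + 1)) → Set (V → ℝ) := fun q =>
    {ω | ∀ i ∈ q.1, ε ≤ lin ((Q G b ^ L) (sg (y i (q.2 i)))) ω} with hB
  set O : Finset (Fin k) → Set (V → ℝ) := fun I => {ω | ∀ i ∈ I, ∀ t ≤ R, h - ε ≤ lin (sL G b L (y i t)) ω} with hO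
  have hBp : ∀ q ∈ (I0.powersetCard u) ×ˢ (Finset.univ : Finset (Fin k → Fin (R + 1))), μ.real (B q) ≤ p ^ u := by
    intro q hq
    rw [Finset.mem_product, Finset.mem_powersetCard] at hq
    have h1 := bad_prob hμ hs hε hE (q.1.image fun i => y i (q.2 i))
    rw [Finset.card_image_of_injOn ((hinj q.2).mono (by exact_mod_cast hq.1.1)), hq.1.2] at h1
    refine le_trans (le_of_eq ?_) h1
    congr 1
    ext ω
    simp [hB]
  have hOp : ∀ I ∈ I0.powersetCard w, μ.real (O I) ≤ δ ^ w := by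
    intro I hI
    rw [Finset.mem_powersetCard] at hI
    have := open_prob hμ hh hr hc (R := R) y I (h := h - ε) (δ := δ) (fun i hi j hj hne => hsep i (hI.1 hi) j (hI.1 hj) hne)
      (fun i hi => hδ (y i) (hlt i (hI.1 hi)) (hdist i (hI.1 hi)))
    rwa [hI.2] at this
  have hsub : {ω : V → ℝ | ∀ j ≤ k * (R + 2 * L), h ≤ ω (f j)} ⊆
      (⋃ q ∈ (I0.powersetCard u) ×ˢ (Finset.univ : Finset (Fin k → Fin (R + 1))), B q) ∪ ⋃ I ∈ I0.powersetCard w, O I := by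
    intro ω hω
    rw [Set.mem_ofPred_eq] at hω
    set Bd := I0.filter fun i => ∃ t : Fin (R + 1), ε ≤ lin ((Q G b ^ L) (sg (y i t))) ω with hBd
    by_cases hu : u ≤ Bd.card
    · left
      obtain ⟨I1, hI1, hc1⟩ := Finset.exists_subset_card_eq hu
      have : ∀ i : Fin k, ∃ t : Fin (R + 1), i ∈ Bd → ε ≤ lin ((Q G b ^ L) (sg (y i t))) ω := fun i => by
        by_cases hi : i ∈ Bd
        · obtain ⟨t, ht⟩ := (Finset.mem_filter.1 hi).2
          exact ⟨t, fun _ => ht⟩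
        · exact ⟨0, fun h => absurd h hi⟩
      choose τ hτ using this
      simp only [Set.mem_iUnion]
      refine ⟨(I1, τ), ?_, fun i hi => hτ i (hI1 hi)⟩
      rw [Finset.mem_product, Finset.mem_powersetCard]
      exact ⟨⟨hI1.trans (Finset.filter_subset _ _), hc1⟩, Finset.mem_univ _⟩
    · right
      have hcd : w ≤ (I0 \ Bd).card := by
        have := Finset.card_sdiff_add_card_eq_card (Finset.filter_subset (fun i => ∃ t : Fin (R + 1), ε ≤ lin ((Q G b ^ L) (sg (y i t))) ω) I0)
        change (I0 \ Bd).card + Bd.card = _ at this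
        omega
      obtain ⟨I1, hI1, hc1⟩ := Finset.exists_subset_card_eq hcd
      simp only [Set.mem_iUnion]
      refine ⟨I1, Finset.mem_powersetCard.2 ⟨hI1.trans Finset.sdiff_subset, hc1⟩, fun i hi t ht => ?_⟩
      have hi' := Finset.mem_sdiff.1 (hI1 hi)
      have hnb : lin ((Q G b ^ L) (sg (y i t))) ω < ε := by
        by_contra hcon
        push Not at hcon
        exact hi'.2 (Finset.mem_filter.2 ⟨hi'.1, ⟨t, by omega⟩, hcon⟩)
      have hjk : i.1 * (R + 2 * L) + (2 * L + t) ≤ k * (R + 2 * L) := by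
        have : (i.1 + 1) * (R + 2 * L) ≤ k * (R + 2 * L) := Nat.mul_le_mul_right _ i.2
        rw [Nat.succ_mul] at this; omega
      have := hω _ hjk
      rw [sL, lin_sub, lin_single]
      change h ≤ ω (y i t) at this
      linarith
  have hc2 : ((I0.powersetCard w).card : ℝ) ≤ 2 ^ k ∧ ((I0.powersetCard u).card : ℝ) ≤ 2 ^ k := by
    have : ∀ v, (I0.powersetCard v).card ≤ 2 ^ k := fun v => by
      rw [Finset.card_powersetCard]
      refine (Nat.choose_le_two_pow _ _).trans (Nat.pow_le_pow_right (by norm_num) ?_)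
      simpa using Finset.card_le_univ I0
    exact ⟨by exact_mod_cast this w, by exact_mod_cast this u⟩
  have hp0 : 0 ≤ p := (Real.exp_pos _).le
  calc _ ≤ _ := measureReal_mono hsub (measure_ne_top _ _)
    _ ≤ _ := measureReal_union_le _ _
    _ ≤ ∑ q ∈ (I0.powersetCard u) ×ˢ (Finset.univ : Finset (Fin k → Fin (R + 1))), μ.real (B q) + ∑ I ∈ I0.powersetCard w, μ.real (O I) :=
        add_le_add (measureReal_biUnion_finset_le _ _) (measureReal_biUnion_finset_le _ _)
    _ ≤ (((I0.powersetCard u) ×ˢ (Finset.univ : Finset (Fin k → Fin (R + 1)))).card : ℝ) * p ^ u + (I0.powersetCard w).card * δ ^ w := by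
        rw [← nsmul_eq_mul, ← nsmul_eq_mul]
        exact add_le_add (Finset.sum_le_card_nsmul _ _ _ hBp) (Finset.sum_le_card_nsmul _ _ _ hOp)
    _ ≤ _ := by
        refine add_le_add ?_ (mul_le_mul_of_nonneg_right hc2.1 (by positivity))
        refine mul_le_mul_of_nonneg_right ?_ (by positivity)
        rw [Finset.card_product, mul_pow]
        push_cast
        refine mul_le_mul hc2.2 (le_of_eq ?_) (by positivity) (by positivity)
        simp
end
end GFF

namespace GFF
section
variable {V : Type*} {G : SimpleGraph V} {b : ℕ} {μ : Measure (V → ℝ)} {K : V → V → ℝ} {ν : ℝ}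

lemma lc_conn {h : ℝ} {ω : V → ℝ} {x : V} (hne : (levelComp G h ω x).Nonempty) :
    x ∈ levelComp G h ω x ∧ (G.induce (levelComp G h ω x)).Connected := by
  obtain ⟨y, p, hp⟩ := hne
  have hx : x ∈ levelComp G h ω x := ⟨SimpleGraph.Walk.nil, by simpa using hp x p.start_mem_support⟩
  refine ⟨hx, ?_⟩
  rw [SimpleGraph.connected_iff_exists_forall_reachable]
  refine ⟨⟨x, hx⟩, fun ⟨z, p, hp⟩ => ?_⟩
  exact ⟨p.induce (levelComp G h ω x) fun v hv => ⟨p.takeUntil v hv, fun u hu => hp u (p.support_takeUntil_subset_support hv hu)⟩⟩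

lemma lc_ge {h : ℝ} {ω : V → ℝ} {x y : V} (hy : y ∈ levelComp G h ω x) : h ≤ ω y := by
  obtain ⟨p, hp⟩ := hy
  exact hp y p.end_mem_support

lemma Val_trc {L R k J : ℕ} {f : ℕ → V} (x : V) (hv : Val G L R k J f) : Val G L R k J (trc (k * (R + 2 * L)) x f) := by
  obtain ⟨I0, h0, h1, h2, h3⟩ := hv
  have e : ∀ i : Fin k, ∀ t ≤ R, trc (k * (R + 2 * L)) x f (i * (R + 2 * L) + (2 * L + t)) = f (i * (R + 2 * L) + (2 * L + t)) := by
    intro i t ht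
    have : (i.1 + 1) * (R + 2 * L) ≤ k * (R + 2 * L) := Nat.mul_le_mul_right _ i.2
    rw [Nat.succ_mul] at this
    rw [trc, if_pos (by omega)]
  refine ⟨I0, h0, fun i hi t ht => ?_, fun i hi s t hs ht => ?_, fun i hi j hj hne s hs t ht => ?_⟩
  · rw [e i t ht]; exact h1 i hi t ht
  · rw [e i t ht, e i s (by omega)]; exact h2 i hi s t hs ht
  · rw [e i s hs, e j t ht]; exact h3 i hi j hj hne s hs t ht

lemma main_bd [Fintype V] (hb : 1 ≤ b) (hμ : IsGaussianField μ K) (hh : Harm μ G b ν) (hr : IsReg G (b + 1)) (hc : G.Connected)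
    {L R k q R0 u w : ℕ} (hL : 1 ≤ L) {s ε h δ : ℝ} (hs : 0 < s) (hε : 0 < ε)
    (hE : ∀ I : Finset V, E2 μ ((Q G b ^ L) (∑ x ∈ I, sg x)) ((Q G b ^ L) (∑ x ∈ I, sg x)) ≤ I.card * s)
    (hδ : ∀ y : ℕ → V, (∀ t ≤ R, LT G (y t) (R + 2 * L)) → (∀ s t, s ≤ t → t ≤ R → G.dist (y s) (y t) = t - s) →
      μ.real {ω | ∀ i ≤ R, h - ε ≤ lin (sL G b L (y i)) ω} ≤ δ) (hδ0 : 0 ≤ δ)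
    (hq : 1 ≤ q) (hR : 3 * (q + (R + 2 * L) + 1) + 1 ≤ R0)
    (hcyc : ∀ z, adjPairs G (gball G z R0) ≤ 2 * (gball G z R0).ncard)
    (hk : u + w + 4 * ((k * (R + 2 * L) + 1) / q + 2) ^ 2 * (b + 2) ^ (R + 2 * L) ≤ k + 1) :
    μ.real {ω | ∃ x, (k * (R + 2 * L) + 1) * (b + 2) ^ (R + 2 * L) < (levelComp G h ω x).ncard} ≤
      Nat.card V * ((16 * (R + 2 * L : ℕ) * (b : ℝ) ^ (R + 2 * L)) ^ k *
        ((2 * (R + 1)) ^ k * (Real.exp (-(ε ^ 2 / (2 * s)))) ^ u + 2 ^ k * δ ^ w)) := by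
  have := hμ.1
  set ℓ := R + 2 * L with hℓ
  have hℓ1 : 1 ≤ ℓ := by omega
  choose F hF hFm using fun x => count hr hb hℓ1 x k
  set J := 4 * ((k * ℓ + 1) / q + 2) ^ 2 * (b + 2) ^ ℓ with hJ
  set X := (2 * (R + 1)) ^ k * (Real.exp (-(ε ^ 2 / (2 * s)))) ^ u + 2 ^ k * δ ^ w with hX
  have hX0 : 0 ≤ X := by positivity
  have hsub : {ω : V → ℝ | ∃ x, (k * ℓ + 1) * (b + 2) ^ ℓ < (levelComp G h ω x).ncard} ⊆
      ⋃ x ∈ (Finset.univ : Finset V), ⋃ g ∈ (F x).filter fun g => Val G L R k J g, {ω : V → ℝ | ∀ j ≤ k * ℓ, h ≤ ω (g j)} := by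
    rintro ω ⟨x, hx⟩
    have hne : (levelComp G h ω x).Nonempty := by
      by_contra hcon
      rw [Set.not_nonempty_iff_eq_empty] at hcon
      rw [hcon, Set.ncard_empty] at hx
      omega
    obtain ⟨hxC, hH⟩ := lc_conn hne
    set C := levelComp G h ω x
    have hd : ∀ v, ((G.induce C).neighborSet v).ncard ≤ b + 1 := fun v => by
      have h1 : (Subtype.val '' ((G.induce C).neighborSet v)) ⊆ G.neighborSet v.1 := by
        rintro _ ⟨z, hz, rfl⟩
        exact hz
      rw [← Set.ncard_image_of_injective _ Subtype.val_injective]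
      refine (Set.ncard_le_ncard h1 (Set.toFinite _)).trans (le_of_eq (hr v.1))
    obtain ⟨e, a, h0, hs'⟩ := extract hH hd hℓ1 ⟨x, hxC⟩ k (by exact hx)
    have hcod := Stp_cod hH hℓ1 hs'
    have hval := Stp_val hc hr hH hL hℓ hs' hq hR hcyc
    have hmem := hFm x (fun j => (e j : V)) a (by simp [h0]) (fun i j hij hj => Stp_mono hs' hij hj)
      (fun i hi => (hs' i hi).le) hcod
    simp only [Set.mem_iUnion]
    refine ⟨x, Finset.mem_univ _, _, Finset.mem_filter.2 ⟨hmem, Val_trc x hval⟩, fun j hj => ?_⟩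
    rw [trc, if_pos hj]
    exact lc_ge (e j).2
  calc _ ≤ _ := measureReal_mono hsub (measure_ne_top _ _)
    _ ≤ ∑ x ∈ (Finset.univ : Finset V), μ.real (⋃ g ∈ (F x).filter fun g => Val G L R k J g, {ω : V → ℝ | ∀ j ≤ k * ℓ, h ≤ ω (g j)}) :=
        measureReal_biUnion_finset_le _ _
    _ ≤ ∑ x ∈ (Finset.univ : Finset V), ((16 * (ℓ : ℕ) * (b : ℝ) ^ ℓ) ^ k * X) := by
        refine Finset.sum_le_sum fun x _ => (measureReal_biUnion_finset_le _ _).trans ?_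
        calc _ ≤ ((F x).filter fun g => Val G L R k J g).card • X :=
              Finset.sum_le_card_nsmul _ _ _ fun g hg =>
                val_prob hμ hh hr hc hL hs hε hE hδ (Finset.mem_filter.1 hg).2 hk hδ0
          _ = (((F x).filter fun g => Val G L R k J g).card : ℝ) * X := nsmul_eq_mul _ _
          _ ≤ _ := by
              refine mul_le_mul_of_nonneg_right (le_trans ?_ (hF x)) hX0
              exact_mod_cast Finset.card_filter_le _ _
    _ = _ := by rw [Finset.sum_const, nsmul_eq_mul, Finset.card_univ, Nat.card_eq_fintype_card]
end
end GFF

namespace GFF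

lemma exp_beat {c γ : ℝ} (hc : 0 < c) (hγ : 1 < γ) {B : ℝ} (hB : 0 ≤ B) :
    Tendsto (fun L : ℕ => B ^ L * Real.exp (-(c * γ ^ L))) atTop (nhds 0) := by
  obtain ⟨m, hm⟩ := pow_unbounded_of_one_lt B hγ
  have h1 : Tendsto (fun L : ℕ => c * γ ^ L) atTop atTop :=
    (tendsto_pow_atTop_atTop_of_one_lt hγ).const_mul_atTop hc
  have h2 := ((Real.tendsto_pow_mul_exp_neg_atTop_nhds_zero m).comp h1).const_mul ((c ^ m)⁻¹)
  rw [mul_zero] at h2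
  refine squeeze_zero (fun L => by positivity) (fun L => ?_) h2
  have : B ^ L ≤ (c ^ m)⁻¹ * (c * γ ^ L) ^ m := by
    rw [mul_pow, ← mul_assoc, inv_mul_cancel₀ (by positivity), one_mul, ← pow_mul, mul_comm L m, pow_mul]
    gcongr
  calc _ ≤ ((c ^ m)⁻¹ * (c * γ ^ L) ^ m) * Real.exp (-(c * γ ^ L)) := by gcongr
    _ = _ := by simp only [Function.comp]; ring

lemma L_two (L : ℕ) : (L : ℝ) ≤ 2 ^ L := by
  exact_mod_cast (Nat.lt_two_pow_self (n := L)).le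

lemma consts {b : ℕ} (hb : 2 ≤ b) {l C ε θ ρ β : ℝ} (hl : 0 < l) (hl1 : l < 1) (hC : 0 < C) (hε : 0 < ε)
    (hθ : 0 < θ) (hθ1 : θ < 1) (hρ : 0 < ρ) (hρ1 : ρ < 1) (hβ : 0 < β) :
    ∃ A L R : ℕ, 1 ≤ L ∧ 2 ≤ A ∧
      (16 * (R + 2 * L : ℕ) * (b : ℝ) ^ (R + 2 * L) * (2 * (R + 1))) ^ A * Real.exp (-(ε ^ 2 / (2 * (ρ ^ (2 * L) / β)))) ≤ 1 / 2 ∧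
      (16 * (R + 2 * L : ℕ) * (b : ℝ) ^ (R + 2 * L) * 2) ^ A *
        (C * (l / b) ^ R + (R + 1) * Real.exp (-(ε ^ 2 / (2 * ((b / (b - 1)) * θ ^ (2 * L)))))) ^ (A - 2) ≤ 1 / 2 := by
  have hb2 : (2 : ℝ) ≤ b := by exact_mod_cast hb
  obtain ⟨A', hA'⟩ := exists_pow_lt_of_lt_one (show (0 : ℝ) < 1 / b ^ 2 by positivity) hl1
  have hA1 : 1 ≤ A' := by
    rcases Nat.eq_zero_or_pos A' with h | h
    · subst h
      rw [pow_zero, lt_div_iff₀ (by positivity)] at hA'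
      nlinarith
    · exact h
  set A := 2 * A' + 2 with hA
  obtain ⟨D, hD⟩ := exists_pow_lt_of_lt_one (show (0 : ℝ) < 1 / (2 * b ^ (2 * A)) by positivity)
    (pow_lt_one₀ hl.le hl1 (by omega) : l ^ A' < 1)
  have hlD : ∀ L : ℕ, ((D * L + 2 * L : ℕ) : ℝ) = (D + 2) * L := fun L => by push_cast; ring
  have hbD : ∀ L : ℕ, (b : ℝ) ^ (D * L + 2 * L) = (b ^ (D + 2)) ^ L := fun L => by rw [← pow_mul]; congr 1; ring
  have hDL : ∀ L : ℕ, ((D * L : ℕ) : ℝ) + 1 ≤ (D + 1) * 2 ^ L := fun L => by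
    push_cast
    have h1 := L_two L
    have h2 : (1 : ℝ) ≤ 2 ^ L := one_le_pow₀ (by norm_num)
    nlinarith [(Nat.cast_nonneg D : (0 : ℝ) ≤ D)]
  have γgen : ∀ x : ℝ, 0 < x → x < 1 → 1 < (x ^ 2)⁻¹ := fun x h0 h1 => by
    rw [one_lt_inv₀ (by positivity)]; exact pow_lt_one₀ h0.le h1 (by norm_num)
  -- first condition
  have t1 : Tendsto (fun L : ℕ => (32 * (D + 2) * (D + 1)) ^ A * (((4 * (b : ℝ) ^ (D + 2)) ^ A) ^ L *
      Real.exp (-((ε ^ 2 * β / 2) * ((ρ ^ 2)⁻¹) ^ L)))) atTop (nhds 0) := by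
    have := (exp_beat (c := ε ^ 2 * β / 2) (by positivity) (γgen ρ hρ hρ1) (B := (4 * (b : ℝ) ^ (D + 2)) ^ A) (by positivity)).const_mul
      ((32 * (D + 2) * (D + 1) : ℝ) ^ A)
    rwa [mul_zero] at this
  have t2 : Tendsto (fun L : ℕ => ((D + 1) / C) * ((2 * ((b : ℝ) / l) ^ D) ^ L *
      Real.exp (-((ε ^ 2 * (b - 1) / (2 * b)) * ((θ ^ 2)⁻¹) ^ L)))) atTop (nhds 0) := by
    have h1 : 0 < ε ^ 2 * ((b : ℝ) - 1) / (2 * b) := div_pos (mul_pos (by positivity) (by linarith)) (by positivity)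
    have := (exp_beat h1 (γgen θ hθ hθ1) (B := 2 * ((b : ℝ) / l) ^ D) (by positivity)).const_mul (((D : ℝ) + 1) / C)
    rwa [mul_zero] at this
  have t3 : Tendsto (fun L : ℕ => (32 * ((D : ℝ) + 2)) ^ A * (2 * C) ^ (A - 2) * ((L : ℝ) ^ A * (1 / 2 : ℝ) ^ L)) atTop (nhds 0) := by
    have := (tendsto_pow_const_mul_const_pow_of_lt_one A (show (0 : ℝ) ≤ 1 / 2 by norm_num) (by norm_num)).const_mul
      ((32 * ((D : ℝ) + 2)) ^ A * (2 * C) ^ (A - 2))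
    rwa [mul_zero] at this
  obtain ⟨L, ⟨⟨h1, h2⟩, h3⟩, hL⟩ := (((t1.eventually (ge_mem_nhds (show (0 : ℝ) < 1 / 2 by norm_num))).and
    (t2.eventually (ge_mem_nhds (show (0 : ℝ) < 1 by norm_num)))).and
    (t3.eventually (ge_mem_nhds (show (0 : ℝ) < 1 / 2 by norm_num)))).and (eventually_ge_atTop 1) |>.exists
  refine ⟨A, L, D * L, hL, by omega, le_trans ?_ h1, le_trans ?_ h3⟩
  · have e1 : Real.exp (-(ε ^ 2 / (2 * (ρ ^ (2 * L) / β)))) = Real.exp (-((ε ^ 2 * β / 2) * ((ρ ^ 2)⁻¹) ^ L)) := by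
      congr 2; rw [pow_mul, inv_pow]; field_simp
    rw [e1, ← mul_assoc ((32 * ((D : ℝ) + 2) * (D + 1)) ^ A)]
    refine mul_le_mul_of_nonneg_right ?_ (Real.exp_pos _).le
    rw [← pow_mul, mul_comm A L, pow_mul, ← mul_pow]
    refine pow_le_pow_left₀ (by positivity) ?_ _
    rw [hlD, hbD, mul_pow]
    have : (4 : ℝ) ^ L = 2 ^ L * 2 ^ L := by rw [← mul_pow]; norm_num
    rw [this]
    calc _ ≤ 16 * (((D : ℝ) + 2) * 2 ^ L) * (b ^ (D + 2)) ^ L * (2 * ((D + 1) * 2 ^ L)) := by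
          gcongr
          · exact L_two L
          · exact hDL L
      _ = _ := by ring
  · have hδ : C * (l / b) ^ (D * L) + ((D * L : ℕ) + 1) * Real.exp (-(ε ^ 2 / (2 * (((b : ℝ) / (b - 1)) * θ ^ (2 * L))))) ≤ 2 * C * (l / b) ^ (D * L) := by
      have e1 : Real.exp (-(ε ^ 2 / (2 * (((b : ℝ) / (b - 1)) * θ ^ (2 * L))))) = Real.exp (-((ε ^ 2 * (b - 1) / (2 * b)) * ((θ ^ 2)⁻¹) ^ L)) := by
        have : (b : ℝ) - 1 ≠ 0 := by linarith
        congr 2; rw [pow_mul, inv_pow]; field_simp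
      rw [e1]
      set E := Real.exp (-((ε ^ 2 * (b - 1) / (2 * b)) * ((θ ^ 2)⁻¹) ^ L)) with hE
      have hE0 : 0 < E := Real.exp_pos _
      have e2 : ((D + 1) / C) * ((2 * ((b : ℝ) / l) ^ D) ^ L * E) = ((D + 1) * 2 ^ L * E) / (C * (l / b) ^ (D * L)) := by
        rw [mul_pow, pow_mul, div_pow, div_pow, div_pow, div_pow]; field_simp
      rw [e2, div_le_one (by positivity)] at h2
      have := mul_le_mul_of_nonneg_right (hDL L) hE0.le
      linarith
    have hb1 : (0 : ℝ) < b - 1 := by linarith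
    calc _ ≤ (16 * ((D * L + 2 * L : ℕ) : ℝ) * (b : ℝ) ^ (D * L + 2 * L) * 2) ^ A * (2 * C * (l / b) ^ (D * L)) ^ (A - 2) := by
          refine mul_le_mul_of_nonneg_left (pow_le_pow_left₀ (by positivity) hδ _) (by positivity)
      _ = (32 * ((D : ℝ) + 2)) ^ A * (2 * C) ^ (A - 2) * ((L : ℝ) ^ A * (((b : ℝ) ^ (D + 2)) ^ A * ((l / b) ^ D) ^ (A - 2)) ^ L) := by
          rw [hlD, hbD, mul_pow (2 * C), mul_pow _ _ L, ← pow_mul _ A L, ← pow_mul _ (A - 2) L, mul_comm A L, mul_comm (A - 2) L,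
            pow_mul _ L A, pow_mul _ L (A - 2), ← pow_mul (l / b) D L]
          have : 16 * (((D : ℝ) + 2) * L) * (b ^ (D + 2)) ^ L * 2 = (32 * ((D : ℝ) + 2)) * L * (b ^ (D + 2)) ^ L := by ring
          rw [this, mul_pow _ (((b : ℝ) ^ (D + 2)) ^ L), mul_pow _ (L : ℝ)]; ring
      _ ≤ _ := by
          refine mul_le_mul_of_nonneg_left ?_ (by positivity)
          refine mul_le_mul_of_nonneg_left ?_ (by positivity)
          refine pow_le_pow_left₀ (by positivity) ?_ _
          have e3 : A - 2 = 2 * A' := by omega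
          have e4 : ((b : ℝ) ^ (D + 2)) ^ A * ((l / b) ^ D) ^ (A - 2) = (b ^ 2 * l ^ A') ^ D * ((l ^ A') ^ D * b ^ (2 * A)) := by
            rw [e3, div_pow, div_pow, mul_div_assoc', div_eq_iff (by positivity), hA]
            ring
          rw [e4]
          rw [lt_div_iff₀ (by positivity)] at hA' hD
          calc _ ≤ (1 : ℝ) ^ D * (1 / 2) := by
                gcongr
                · linarith
                · linarith
            _ = _ := by simp
end GFF

namespace GFF

lemma arith_J {b A ℓ M : ℕ} (hb : 2 ≤ b) {α κ : ℝ} (hα : 0 < α) (hκ : 0 < κ) : ∃ X0 : ℝ, 1 ≤ X0 ∧ ∀ X : ℝ, X0 ≤ X →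
    ∃ q : ℕ, 1 ≤ q ∧ 3 * (q + ℓ + 1) + 1 ≤ ⌊α * (X / Real.log b)⌋₊ ∧
      4 * ((A * ⌈2 * (κ + 1) * X⌉₊ * ℓ + 1) / q + 2) ^ 2 * M ≤ ⌈2 * (κ + 1) * X⌉₊ ∧
      ((A * ⌈2 * (κ + 1) * X⌉₊ * ℓ + 1 : ℕ) : ℝ) ≤ (A * ℓ * (2 * κ + 3) + 1) * X := by
  have hb2 : (2 : ℝ) ≤ b := by exact_mod_cast hb
  have hlb : 0 < Real.log b := Real.log_pos (by linarith)
  set lb := Real.log b with hlbd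
  set B := (A * ℓ * (2 * κ + 3) + 1) * (8 * lb / α) with hB
  have hB0 : 0 ≤ B := by positivity
  refine ⟨max (max 1 (8 * lb / α)) (max ((12 * ℓ + 17) * lb / α) (4 * (⌈B⌉₊ + 2) ^ 2 * M)), by simp, fun X hX => ?_⟩
  simp only [max_le_iff] at hX
  obtain ⟨⟨h1, h2⟩, h3, h4⟩ := hX
  set R0 := ⌊α * (X / lb)⌋₊ with hR0
  rw [div_le_iff₀ hα] at h2 h3
  have hR1 : α * (X / lb) < R0 + 1 := Nat.lt_floor_add_one _
  have hR2 : 12 * ℓ + 17 ≤ R0 := by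
    refine Nat.le_floor ?_
    rw [mul_div_assoc', le_div_iff₀ hlb]
    push_cast; linarith
  have hkk : (⌈2 * (κ + 1) * X⌉₊ : ℝ) ≤ (2 * κ + 3) * X := by
    have := (Nat.ceil_lt_add_one (show 0 ≤ 2 * (κ + 1) * X by positivity)).le
    nlinarith
  have hk2 : 2 * (κ + 1) * X ≤ (⌈2 * (κ + 1) * X⌉₊ : ℝ) := Nat.le_ceil _
  set k' := ⌈2 * (κ + 1) * X⌉₊ with hk'
  have hbig : ((A * k' * ℓ + 1 : ℕ) : ℝ) ≤ (A * ℓ * (2 * κ + 3) + 1) * X := by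
    push_cast
    have : (A : ℝ) * ℓ * k' ≤ A * ℓ * ((2 * κ + 3) * X) := by gcongr
    nlinarith
  refine ⟨R0 / 4, by omega, by omega, ?_, hbig⟩
  set q := R0 / 4 with hq
  have hq1 : (R0 : ℝ) ≤ 4 * q + 3 := by
    have : R0 ≤ 4 * q + 3 := by omega
    exact_mod_cast this
  have hq2 : α * X / (8 * lb) ≤ q := by
    rw [div_le_iff₀ (by positivity)]
    rw [mul_div_assoc', div_lt_iff₀ hlb] at hR1
    nlinarith
  have hq0 : (0 : ℝ) < q := by
    have : 1 ≤ q := by omega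
    exact_mod_cast this
  have hdiv : (A * k' * ℓ + 1) / q ≤ ⌈B⌉₊ := by
    have : (((A * k' * ℓ + 1) / q : ℕ) : ℝ) ≤ B := by
      refine Nat.cast_div_le.trans ?_
      rw [div_le_iff₀ hq0]
      refine hbig.trans ?_
      calc _ = B * (α * X / (8 * lb)) := by rw [hB]; field_simp
        _ ≤ _ := by gcongr
    exact_mod_cast this.trans (Nat.le_ceil _)
  have h5 : 4 * ((A * k' * ℓ + 1) / q + 2) ^ 2 * M ≤ 4 * (⌈B⌉₊ + 2) ^ 2 * M := by gcongr
  have h6 : ((4 * (⌈B⌉₊ + 2) ^ 2 * M : ℕ) : ℝ) ≤ k' := by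
    push_cast
    refine h4.trans (le_trans ?_ hk2)
    nlinarith
  exact h5.trans (by exact_mod_cast h6)

theorem uni (b : ℕ) (hb : 2 ≤ b) (α β : ℝ) (hα : 0 < α) (hβ : 0 < β) (T : Type) (Gt : SimpleGraph T) (o : T)
    (htree : IsRegTree Gt (b + 1)) (μT : Measure (T → ℝ)) (hμT : IsGaussianField μT (treeGreen Gt (b + 1)))
    (h : ℝ) (hh : hstar Gt o μT < h) (κ : ℝ) (hκ : 0 < κ) : ∃ c K : ℝ, 0 < c ∧ 0 < K ∧
    ∀ (V : Type) [Fintype V] (G : SimpleGraph V) (N : ℕ) (μ : Measure (V → ℝ)), 1 ≤ N → Nat.card V = N → G.Connected →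
      IsReg G (b + 1) → (∀ x, adjPairs G (gball G x ⌊α * Real.logb b N⌋₊) ≤ 2 * (gball G x ⌊α * Real.logb b N⌋₊).ncard) →
      SpectralGapLB G (b + 1) β → IsGaussianField μ (zGreen G (b + 1) N) →
      μ.real {ω | ∃ x, K * Real.log N ≤ ((levelComp G h ω x).ncard : ℝ)} ≤ c * (N : ℝ) ^ (-κ) := by
  obtain ⟨hcT, haT, hrT⟩ := htree
  obtain ⟨ε, l, C, hε, hl, hl1, hC, ht⟩ := tree_out hb hcT haT hrT hμT o hh
  have hth := thet_lt hb
  set β' := min β 1 with hβ'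
  have hβ0 : 0 < β' := lt_min hβ one_pos
  have hβ1 : β' ≤ 1 := min_le_right _ _
  obtain ⟨A, L, R, hL, hA, hc1, hc2⟩ := consts hb hl hl1 hC hε hth.1 hth.2 (show (0 : ℝ) < 1 - β' / 2 by linarith) (by linarith) hβ0
  obtain ⟨X0, hX0, hX⟩ := arith_J (A := A) (ℓ := R + 2 * L) (M := (b + 2) ^ (R + 2 * L)) hb hα hκ
  set ℓ := R + 2 * L with hℓ
  set s := (1 - β' / 2) ^ (2 * L) / β' with hs
  have hs0 : 0 < s := by
    have : 0 < 1 - β' / 2 := by linarith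
    positivity
  set δ := C * (l / b) ^ R + (R + 1) * Real.exp (-(ε ^ 2 / (2 * ((b / (b - 1)) * thet b ^ (2 * L))))) with hδ
  have hb0 : (0 : ℝ) < b := by positivity
  have hδ0 : 0 ≤ δ := by positivity
  obtain ⟨z, hzd, hz⟩ := ht L R
  refine ⟨2 + Real.exp (κ * X0), (A * ℓ * (2 * κ + 3) + 1) * ((b + 2) ^ ℓ : ℕ) + 1, by positivity, by positivity, ?_⟩
  intro V _ G N μ hN hcard hconn hreg hcyc hgap hμ
  have := hμ.1
  have hNr : (1 : ℝ) ≤ N := by exact_mod_cast hN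
  set X := Real.log N with hXd
  have hNX : ∀ r : ℝ, (N : ℝ) ^ r = Real.exp (X * r) := fun r => Real.rpow_def_of_pos (by linarith) r
  by_cases hXX : X0 ≤ X
  swap
  · push Not at hXX
    refine measureReal_le_one.trans ?_
    rw [hNX, add_mul, ← Real.exp_add]
    have : 1 ≤ Real.exp (κ * X0 + X * -κ) := Real.one_le_exp (by nlinarith)
    have := Real.exp_pos (X * -κ)
    linarith
  obtain ⟨q, hq1, hq2, hq3, hq4⟩ := hX X hXX
  have hg' : SpectralGapLB G (b + 1) β' := fun f lam h1 h2 => (hgap f lam h1 h2).imp_right fun h => (min_le_left _ _).trans h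
  obtain ⟨hH, hE⟩ := gside hconn hreg hβ0 hg' hcard hμ
  set k' := ⌈2 * (κ + 1) * X⌉₊ with hk'
  have hmain := main_bd (u := k') (w := (A - 2) * k') (k := A * k') (h := h) (by omega) hμ hH hreg hconn hL hs0 hε (hE L)
    (fun y hy1 hy2 => (seg_prob hμ hH hreg hconn hμT (tree_harm hb hcT haT hrT hμT) hrT hcT haT hy1 hy2 hzd (h - ε)).le.trans hz)
    hδ0 hq1 hq2 hcyc (by
      have : A * k' = k' + (A - 2) * k' + k' := by
        obtain ⟨A0, rfl⟩ : ∃ A0, A = A0 + 2 := ⟨A - 2, by omega⟩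
        simp only [Nat.add_sub_cancel]; ring
      exact le_trans (Nat.add_le_add_left hq3 _) (le_trans this.ge (Nat.le_succ _)))
  have hsub : {ω : V → ℝ | ∃ x, ((A * ℓ * (2 * κ + 3) + 1) * ((b + 2) ^ ℓ : ℕ) + 1) * X ≤ ((levelComp G h ω x).ncard : ℝ)} ⊆
      {ω | ∃ x, (A * k' * ℓ + 1) * (b + 2) ^ ℓ < (levelComp G h ω x).ncard} := by
    rintro ω ⟨x, hx⟩
    refine ⟨x, ?_⟩
    have h1 : ((A * k' * ℓ + 1 : ℕ) : ℝ) * ((b + 2) ^ ℓ : ℕ) ≤ (A * ℓ * (2 * κ + 3) + 1) * X * ((b + 2) ^ ℓ : ℕ) := by gcongr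
    have h2 : (((A * k' * ℓ + 1) * (b + 2) ^ ℓ : ℕ) : ℝ) < (levelComp G h ω x).ncard := by
      rw [Nat.cast_mul]
      refine lt_of_lt_of_le ?_ hx
      have : 0 < X := by linarith
      linarith
    exact_mod_cast h2
  refine (measureReal_mono hsub (measure_ne_top _ _)).trans (hmain.trans ?_)
  rw [hcard, mul_add, ← mul_assoc _ ((2 * ((R : ℝ) + 1)) ^ (A * k')), ← mul_assoc _ ((2 : ℝ) ^ (A * k')), ← mul_pow, ← mul_pow, pow_mul, pow_mul _ A k',
    pow_mul _ (A - 2) k', ← mul_pow, ← mul_pow]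
  have hp1 := pow_le_pow_left₀ (by positivity) hc1 k'
  have hp2 := pow_le_pow_left₀ (by positivity) hc2 k'
  have h2k : (1 / 2 : ℝ) ^ k' ≤ Real.exp (-((κ + 1) * X)) := by
    have e : (1 / 2 : ℝ) = Real.exp (-Real.log 2) := by rw [Real.exp_neg, Real.exp_log (by norm_num)]; norm_num
    rw [e, ← Real.exp_nat_mul]
    apply Real.exp_le_exp.2
    have h1 : 2 * (κ + 1) * X ≤ k' := Nat.le_ceil _
    have h2 := Real.log_two_gt_d9
    have h3 : 0 ≤ (κ + 1) * X := by positivity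
    nlinarith
  have hNe : (N : ℝ) = Real.exp X := (Real.exp_log (by linarith)).symm
  calc _ ≤ (N : ℝ) * ((1 / 2) ^ k' + (1 / 2) ^ k') := by gcongr
    _ ≤ (N : ℝ) * (2 * Real.exp (-((κ + 1) * X))) := by gcongr; linarith
    _ = 2 * (N : ℝ) ^ (-κ) := by
        rw [hNX, hNe, mul_left_comm, ← Real.exp_add]; congr 2; ring
    _ ≤ _ := by
        refine mul_le_mul_of_nonneg_right ?_ (by positivity)
        linarith [Real.exp_pos (κ * X0)]
end GFF

theorem subcritical_microscopic_components
    (d : ℕ) (hd : 3 ≤ d)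
    (V : ℕ → Type) [∀ n, Fintype (V n)]
    (G : ∀ n, SimpleGraph (V n)) (N : ℕ → ℕ) (α β : ℝ)
    (hα : 0 < α ∧ α ≤ 1) (hβ : 0 < β ∧ β ≤ 2)
    (hNmono : StrictMono N) (hNpos : ∀ n, 1 ≤ N n)
    (hcard : ∀ n, Nat.card (V n) = N n)
    (hconn : ∀ n, (G n).Connected)
    (hreg : ∀ n, GFF.IsReg (G n) d)
    (hcyc : ∀ n (x : V n),
      GFF.adjPairs (G n) (GFF.gball (G n) x ⌊α * Real.logb ((d : ℝ) - 1) (N n : ℝ)⌋₊) ≤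
        2 * (GFF.gball (G n) x ⌊α * Real.logb ((d : ℝ) - 1) (N n : ℝ)⌋₊).ncard)
    (hgap : ∀ n, GFF.SpectralGapLB (G n) d β)
    (μ : ∀ n, Measure (V n → ℝ))
    (hμ : ∀ n, GFF.IsGaussianField (μ n) (GFF.zGreen (G n) d (N n)))
    (T : Type) (Gt : SimpleGraph T) (o : T) (htree : GFF.IsRegTree Gt d)
    (μT : Measure (T → ℝ)) (hμT : GFF.IsGaussianField μT (GFF.treeGreen Gt d))
    (h : ℝ) (hh : GFF.hstar Gt o μT < h) :
    (∀ κ : ℝ, 0 < κ → ∃ c K : ℝ, 0 < c ∧ 0 < K ∧ ∀ n : ℕ,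
      μ n {ω | ∃ x : V n,
          K * Real.log (N n) ≤ ((GFF.levelComp (G n) h ω x).ncard : ℝ)} ≤
        ENNReal.ofReal (c * (N n : ℝ) ^ (-κ))) ∧
    (∃ K : ℝ, 0 < K ∧
      Filter.Tendsto
        (fun n => μ n {ω | ∀ x : V n,
          ((GFF.levelComp (G n) h ω x).ncard : ℝ) ≤ K * Real.log (N n)})
        Filter.atTop (nhds 1)) := by
  obtain ⟨b, rfl⟩ : ∃ b, d = b + 1 := ⟨d - 1, by omega⟩
  have hbc : (((b + 1 : ℕ) : ℝ)) - 1 = b := by push_cast; ring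
  rw [hbc] at hcyc
  have key : ∀ κ : ℝ, 0 < κ → ∃ c K : ℝ, 0 < c ∧ 0 < K ∧ ∀ n : ℕ,
      μ n {ω | ∃ x : V n,
          K * Real.log (N n) ≤ ((GFF.levelComp (G n) h ω x).ncard : ℝ)} ≤
        ENNReal.ofReal (c * (N n : ℝ) ^ (-κ)) := by
    intro κ hκ
    obtain ⟨c, K, hc, hK, H⟩ := GFF.uni b (by omega) α β hα.1 hβ.1 T Gt o htree μT hμT h hh κ hκ
    refine ⟨c, K, hc, hK, fun n => ?_⟩
    have := (hμ n).1
    rw [← ofReal_measureReal]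
    exact ENNReal.ofReal_le_ofReal (H (V n) (G n) (N n) (μ n) (hNpos n) (hcard n) (hconn n) (hreg n) (hcyc n) (hgap n) (hμ n))
  refine ⟨key, ?_⟩
  obtain ⟨c, K, hc, hK, H⟩ := key 1 one_pos
  refine ⟨K, hK, ?_⟩
  have hN : Tendsto (fun n => (N n : ℝ)) atTop atTop := tendsto_natCast_atTop_atTop.comp hNmono.tendsto_atTop
  have h0 : Tendsto (fun n => ENNReal.ofReal (c * (N n : ℝ) ^ (-(1 : ℝ)))) atTop (nhds 0) := by
    have := ((tendsto_rpow_neg_atTop (one_pos : (0 : ℝ) < 1)).comp hN).const_mul c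
    rw [mul_zero] at this
    simpa using ENNReal.tendsto_ofReal this
  have h1 : Tendsto (fun n => 1 - ENNReal.ofReal (c * (N n : ℝ) ^ (-(1 : ℝ)))) atTop (nhds 1) := by
    have := ENNReal.Tendsto.sub (tendsto_const_nhds (x := (1 : ℝ≥0∞)) (f := atTop)) h0 (Or.inl (by simp))
    simpa using this
  refine tendsto_of_tendsto_of_tendsto_of_le_of_le h1 tendsto_const_nhds (fun n => ?_) (fun n => ?_)
  · have := (hμ n).1
    refine tsub_le_iff_right.2 ?_
    calc (1 : ℝ≥0∞) = μ n Set.univ := measure_univ.symm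
      _ ≤ _ := measure_mono (t := {ω | ∀ x : V n, ((GFF.levelComp (G n) h ω x).ncard : ℝ) ≤ K * Real.log (N n)} ∪
          {ω | ∃ x : V n, K * Real.log (N n) ≤ ((GFF.levelComp (G n) h ω x).ncard : ℝ)}) (fun ω _ => by
            by_cases hω : ∀ x : V n, ((GFF.levelComp (G n) h ω x).ncard : ℝ) ≤ K * Real.log (N n)
            · exact Or.inl hω
            · right
              push Not at hω
              obtain ⟨x, hx⟩ := hω
              exact ⟨x, hx.le⟩)
      _ ≤ _ := measure_union_le _ _
      _ ≤ _ := by gcongr; exact H n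
  · have := (hμ n).1
    exact prob_le_one
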